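/- For the pure-gravity stratified water-wave system (no surface tension, σ = 0): if β is Hölder continuous of exponent μ on [p₀,0] and ρ is continuously differentiable with ρ' Hölder continuous of exponent μ on [p₀,0], then every streamline, including the free surface y = η(x), is a real-analytic curve (for each c ∈ [0,−p₀] the level set {ψ = c} in Ω̄ is the graph of a real-analytic function of x). If, in addition, β and ρ belong to the Gevrey class G^s([p₀,0]) for some s ≥ 1, then ψ is smooth on Ω̄ and belongs to G^s(Ω̄), i.e. there exists C ≥ 1 with sup_{Ω̄}|∂_x^{α₁}∂_y^{α₂}ψ| ≤ C^{|α|+1}(|α|!)^s for all multi-indices α; in particular if s = 1 then ψ is real analytic on Ω̄. -/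

import Mathlib

open Set

noncomputable section

/-- The mixed partial derivative `∂_x^a ∂_y^b f` of `f : ℝ² → ℝ` within the set `S`,
realized as the iterated Fréchet derivative within `S` applied to the corresponding
coordinate directions. -/
def mpw (S : Set (ℝ × ℝ)) (a b : ℕ) (f : ℝ × ℝ → ℝ) (z : ℝ × ℝ) : ℝ :=
  iteratedFDerivWithin ℝ (a + b) f S z
    (fun i => if (i : ℕ) < a then ((1 : ℝ), (0 : ℝ)) else ((0 : ℝ), (1 : ℝ)))

/-- Euclidean distance on `ℝ²`. -/
def edist2 (z z' : ℝ × ℝ) : ℝ := Real.sqrt ((z.1 - z'.1) ^ 2 + (z.2 - z'.2) ^ 2)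

/-- Gevrey regularity on `[p₀, 0]` of index `s`. -/
def GevreyOnIcc (s p₀ : ℝ) (f : ℝ → ℝ) : Prop :=
  ContDiffOn ℝ (⊤ : ℕ∞) f (Set.Icc p₀ 0) ∧
  ∃ M : ℝ, 1 ≤ M ∧ ∀ k : ℕ, ∀ p ∈ Set.Icc p₀ 0,
    |iteratedDerivWithin k f (Set.Icc p₀ 0) p| ≤ M ^ (k + 1) * (Nat.factorial k : ℝ) ^ s

/-- Gevrey regularity of index `s` of a function of two variables on a set `S`. -/
def GevreyOn2 (s : ℝ) (S : Set (ℝ × ℝ)) (f : ℝ × ℝ → ℝ) : Prop :=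
  ContDiffOn ℝ (⊤ : ℕ∞) f S ∧
  ∃ C : ℝ, 1 ≤ C ∧ ∀ a b : ℕ, ∀ z ∈ S,
    |mpw S a b f z| ≤ C ^ (a + b + 1) * (Nat.factorial (a + b) : ℝ) ^ s

section

open MeasureTheory Filter Topology

def CB (f : ℝ → ℝ → ℝ) : Prop :=
  Continuous (fun z : ℝ × ℝ => f z.1 z.2) ∧ ∃ K, ∀ q p, |f q p| ≤ K

def om (x : ℝ) : ℝ := (1 + x ^ 2)⁻¹

def JJ (p0 q0 : ℝ) (f : ℝ → ℝ → ℝ) : ℝ := ∫ q, om (q - q0) * ∫ p in p0..0, f q p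

def LB (p0 : ℝ) (f : ℝ → ℝ → ℝ) (M : ℝ) : Prop := ∀ q0, JJ p0 q0 (f * f) ≤ M ^ 2

def sh (t : ℝ) (f : ℝ → ℝ → ℝ) : ℝ → ℝ → ℝ := fun q p => f (q + t) p

def DD (t : ℝ) (f : ℝ → ℝ → ℝ) : ℝ → ℝ → ℝ := fun q p => (f (q + t) p - f q p) / t

def cst (c : ℝ) : ℝ → ℝ → ℝ := fun _ _ => c

theorem CB.add {f g} (hf : CB f) (hg : CB g) : CB (f + g) := by
  obtain ⟨cf, K, hK⟩ := hf
  obtain ⟨cg, L, hL⟩ := hg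
  exact ⟨cf.add cg, K + L, fun q p => (abs_add_le _ _).trans (add_le_add (hK q p) (hL q p))⟩

theorem CB.mul {f g} (hf : CB f) (hg : CB g) : CB (f * g) := by
  obtain ⟨cf, K, hK⟩ := hf
  obtain ⟨cg, L, hL⟩ := hg
  refine ⟨cf.mul cg, K * L, fun q p => ?_⟩
  simp only [Pi.mul_apply, abs_mul]
  exact mul_le_mul (hK q p) (hL q p) (abs_nonneg _) ((abs_nonneg _).trans (hK q p))

theorem CB.cst (c : ℝ) : CB (cst c) := ⟨continuous_const, |c|, fun _ _ => le_rfl⟩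

theorem CB.neg {f} (hf : CB f) : CB (-f) := by
  obtain ⟨cf, K, hK⟩ := hf
  exact ⟨cf.neg, K, fun q p => by simpa using hK q p⟩

theorem CB.sub {f g} (hf : CB f) (hg : CB g) : CB (f - g) := by
  rw [sub_eq_add_neg]; exact hf.add hg.neg

theorem CB.sh {f} (hf : CB f) (t : ℝ) : CB (sh t f) := by
  obtain ⟨cf, K, hK⟩ := hf
  refine ⟨?_, K, fun q p => hK _ _⟩
  exact cf.comp (by fun_prop : Continuous (fun z : ℝ × ℝ => ((z.1 + t, z.2) : ℝ × ℝ)))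

theorem DD_eq (t : ℝ) (f : ℝ → ℝ → ℝ) : DD t f = cst t⁻¹ * (sh t f - f) := by
  funext q p; simp [DD, cst, sh, div_eq_inv_mul]

theorem CB.DD {f} (hf : CB f) (t : ℝ) : CB (DD t f) := by
  rw [DD_eq]; exact (CB.cst _).mul ((hf.sh t).sub hf)

theorem CB.cont_q {f} (hf : CB f) (p : ℝ) : Continuous (fun q => f q p) :=
  hf.1.comp (by fun_prop : Continuous (fun q : ℝ => ((q, p) : ℝ × ℝ)))

theorem CB.cont_p {f} (hf : CB f) (q : ℝ) : Continuous (fun p => f q p) :=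
  hf.1.comp (by fun_prop : Continuous (fun p : ℝ => ((q, p) : ℝ × ℝ)))

theorem CB.ii {f} (hf : CB f) (q a b : ℝ) : IntervalIntegrable (fun p => f q p) volume a b :=
  (hf.cont_p q).intervalIntegrable a b

theorem CB.cont_int {f} (hf : CB f) (p0 : ℝ) : Continuous (fun q => ∫ p in p0..0, f q p) := by
  apply intervalIntegral.continuous_parametric_intervalIntegral_of_continuous'
  exact hf.1

theorem CB.bdd_int {f} (hf : CB f) (p0 : ℝ) : ∃ K, ∀ q, |∫ p in p0..0, f q p| ≤ K := by
  obtain ⟨_, K, hK⟩ := hf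
  refine ⟨K * |0 - p0|, fun q => ?_⟩
  have := intervalIntegral.norm_integral_le_of_norm_le_const (a := p0) (b := 0)
    (f := fun p => f q p) (C := K) (fun p _ => by simpa using hK q p)
  simpa using this

theorem om_pos (x : ℝ) : 0 < om x := by unfold om; positivity

theorem om_cont : Continuous om := by
  unfold om
  exact Continuous.inv₀ (by fun_prop) (fun x => by positivity)

theorem om_int (q0 : ℝ) : Integrable (fun q => om (q - q0)) := by
  unfold om
  exact (integrable_inv_one_add_sq : Integrable (fun x : ℝ => (1 + x ^ 2)⁻¹)).comp_sub_right q0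

theorem om_mul_int {m : ℝ → ℝ} (hm : Continuous m) (hb : ∃ K, ∀ q, |m q| ≤ K) (q0 : ℝ) :
    Integrable (fun q => om (q - q0) * m q) := by
  obtain ⟨K, hK⟩ := hb
  refine (om_int q0).mul_bdd (c := K) hm.aestronglyMeasurable ?_
  exact ae_of_all _ hK

theorem CB.Jint {f} (hf : CB f) (p0 q0 : ℝ) :
    Integrable (fun q => om (q - q0) * ∫ p in p0..0, f q p) :=
  om_mul_int (hf.cont_int p0) (hf.bdd_int p0) q0

theorem JJ_add {f g} (hf : CB f) (hg : CB g) (p0 q0 : ℝ) :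
    JJ p0 q0 (f + g) = JJ p0 q0 f + JJ p0 q0 g := by
  unfold JJ
  rw [← integral_add (hf.Jint p0 q0) (hg.Jint p0 q0)]
  congr 1; funext q
  rw [← mul_add, ← intervalIntegral.integral_add (hf.ii q _ _) (hg.ii q _ _)]
  rfl

theorem JJ_cmul (c : ℝ) (f) (p0 q0 : ℝ) : JJ p0 q0 (cst c * f) = c * JJ p0 q0 f := by
  unfold JJ
  rw [← integral_const_mul]
  congr 1; funext q
  have : ∫ p in p0..0, (cst c * f) q p = c * ∫ p in p0..0, f q p := by
    rw [← intervalIntegral.integral_const_mul]; rfl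
  rw [this]; ring

theorem JJ_mono {f g} (hf : CB f) (hg : CB g) {p0 : ℝ} (hp : p0 < 0) (q0 : ℝ)
    (h : ∀ q, ∀ p ∈ Icc p0 0, f q p ≤ g q p) : JJ p0 q0 f ≤ JJ p0 q0 g := by
  unfold JJ
  refine integral_mono (hf.Jint p0 q0) (hg.Jint p0 q0) fun q => ?_
  exact mul_le_mul_of_nonneg_left
    (intervalIntegral.integral_mono_on hp.le (hf.ii q _ _) (hg.ii q _ _) (h q)) (om_pos _).le

theorem JJ_sh (p0 q0 t : ℝ) (f) : JJ p0 q0 (sh t f) = JJ p0 (q0 + t) f := by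
  unfold JJ
  rw [← integral_add_right_eq_self (fun q => om (q - (q0 + t)) * ∫ p in p0..0, f q p) t]
  congr 1; funext q
  rw [show q + t - (q0 + t) = q - q0 by ring]; rfl

theorem LB.sh {p0 f M} (h : LB p0 f M) (t : ℝ) : LB p0 (sh t f) M := fun q0 => by
  have := h (q0 + t)
  rwa [← JJ_sh] at this

theorem LB.mono {p0 f M N} (h : LB p0 f M) (h0 : 0 ≤ M) (hMN : M ≤ N) : LB p0 f N := fun q0 =>
  (h q0).trans (by gcongr)

theorem LB.neg {p0 f M} (h : LB p0 f M) : LB p0 (-f) M := fun q0 => by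
  rw [neg_mul_neg]; exact h q0

theorem LB.of_le {p0 f g M} (hp : p0 < 0) (hf : CB f) (hg : CB g) (h : LB p0 g M)
    (hfg : ∀ q, ∀ p ∈ Icc p0 0, |f q p| ≤ |g q p|) : LB p0 f M := fun q0 => by
  refine (JJ_mono (hf.mul hf) (hg.mul hg) hp q0 fun q p hpp => ?_).trans (h q0)
  simp only [Pi.mul_apply]
  exact abs_le_iff_mul_self_le.mp (hfg q p hpp)

theorem LB.bmul {p0 f g K M} (hp : p0 < 0) (hf : CB f) (hg : CB g) (h : LB p0 g M)
    (hfK : ∀ q, ∀ p ∈ Icc p0 0, |f q p| ≤ K) : LB p0 (f * g) (K * M) := fun q0 => by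
  have e1 : JJ p0 q0 ((f * g) * (f * g)) ≤ JJ p0 q0 (cst (K^2) * (g * g)) := by
    refine JJ_mono ((hf.mul hg).mul (hf.mul hg)) ((CB.cst _).mul (hg.mul hg)) hp q0
      fun q p hpp => ?_
    simp only [Pi.mul_apply, cst]
    have h2 : f q p ^ 2 ≤ K ^ 2 := sq_le_sq' (abs_le.mp (hfK q p hpp)).1 (abs_le.mp (hfK q p hpp)).2
    nlinarith [mul_self_nonneg (g q p)]
  rw [JJ_cmul] at e1
  rw [mul_pow]
  exact e1.trans (mul_le_mul_of_nonneg_left (h q0) (sq_nonneg K))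

theorem LB.cmul {p0 g M} (h : LB p0 g M) (c : ℝ) : LB p0 (cst c * g) (|c| * M) := fun q0 => by
  rw [show cst c * g * (cst c * g) = cst (c^2) * (g * g) by
    funext q p; simp only [Pi.mul_apply, cst]; ring, JJ_cmul, mul_pow, sq_abs]
  exact mul_le_mul_of_nonneg_left (h q0) (sq_nonneg c)

theorem LB.add {p0 f g M N} (hp : p0 < 0) (hf : CB f) (hg : CB g) (h1 : LB p0 f M)
    (h2 : LB p0 g N) (hM : 0 ≤ M) (hN : 0 ≤ N) : LB p0 (f + g) (M + N) := fun q0 => by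
  have key : ∀ ε > 0, JJ p0 q0 ((f + g) * (f + g)) ≤ (M + N + 2 * ε) ^ 2 := by
    intro ε he
    have hM' : 0 < M + ε := by positivity
    have hN' : 0 < N + ε := by positivity
    have e1 : JJ p0 q0 ((f + g) * (f + g)) ≤
        JJ p0 q0 (cst (1 + (N + ε) / (M + ε)) * (f * f) + cst (1 + (M + ε) / (N + ε)) * (g * g)) := by
      refine JJ_mono ((hf.add hg).mul (hf.add hg))
        (((CB.cst _).mul (hf.mul hf)).add ((CB.cst _).mul (hg.mul hg))) hp q0 fun q p hpp => ?_
      simp only [Pi.mul_apply, cst, Pi.add_apply]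
      set a := f q p
      set b := g q p
      have : (1 + (N + ε) / (M + ε)) * (a * a) + (1 + (M + ε) / (N + ε)) * (b * b) -
        (a + b) * (a + b) = ((N + ε) * a - (M + ε) * b) ^ 2 / ((M + ε) * (N + ε)) := by
        field_simp; ring
      have h3 : 0 ≤ ((N + ε) * a - (M + ε) * b) ^ 2 / ((M + ε) * (N + ε)) := by positivity
      linarith
    rw [JJ_add ((CB.cst _).mul (hf.mul hf)) ((CB.cst _).mul (hg.mul hg)), JJ_cmul, JJ_cmul] at e1
    have e2 := (h1 q0).trans (by gcongr; linarith : M ^ 2 ≤ (M + ε) ^ 2)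
    have e3 := (h2 q0).trans (by gcongr; linarith : N ^ 2 ≤ (N + ε) ^ 2)
    calc _ ≤ _ := e1
      _ ≤ (1 + (N + ε) / (M + ε)) * (M + ε) ^ 2 + (1 + (M + ε) / (N + ε)) * (N + ε) ^ 2 := by
          gcongr
      _ = _ := by field_simp; ring
  have ht : Tendsto (fun ε : ℝ => (M + N + 2 * ε) ^ 2) (𝓝[>] 0) (𝓝 ((M + N) ^ 2)) := by
    have : Continuous (fun ε : ℝ => (M + N + 2 * ε) ^ 2) := by fun_prop
    have h := (this.tendsto 0).mono_left (nhdsWithin_le_nhds (s := Ioi 0))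
    simpa using h
  exact ge_of_tendsto ht (eventually_mem_nhdsWithin.mono fun ε he => key ε he)

theorem LB.sub {p0 f g M N} (hp : p0 < 0) (hf : CB f) (hg : CB g) (h1 : LB p0 f M)
    (h2 : LB p0 g N) (hM : 0 ≤ M) (hN : 0 ≤ N) : LB p0 (f - g) (M + N) := by
  rw [sub_eq_add_neg]; exact h1.add hp hf hg.neg h2.neg hM hN

/-- bounded functions are LB -/
theorem LB.of_bdd {p0 f K} (hp : p0 < 0) (hf : CB f) (hK : ∀ q, ∀ p ∈ Icc p0 0, |f q p| ≤ K) :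
    LB p0 f (K * Real.sqrt (JJ p0 0 (cst 1))) := by
  have e0 : ∀ q0, JJ p0 q0 (cst 1) = JJ p0 0 (cst 1) := fun q0 => by
    have := JJ_sh p0 0 q0 (cst 1)
    rw [zero_add] at this
    rw [← this]; rfl
  have h1 : LB p0 (cst 1) (Real.sqrt (JJ p0 0 (cst 1))) := fun q0 => by
    have hn : 0 ≤ JJ p0 0 (cst 1) := by
      have := JJ_mono (CB.cst 0) (CB.cst 1) hp 0 (fun q p _ => by simp [cst])
      have h00 : JJ p0 0 (cst 0) = 0 := by simp [JJ, cst]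
      linarith
    rw [show cst 1 * cst 1 = cst 1 by funext q p; simp [cst], Real.sq_sqrt hn, e0]
  have := h1.bmul hp hf (CB.cst 1) hK
  rwa [show f * cst 1 = f by funext q p; simp [cst]] at this

end

section

open MeasureTheory Filter Topology

def PD (p0 : ℝ) (f fp : ℝ → ℝ → ℝ) : Prop :=
  CB f ∧ CB fp ∧ ∀ q, ∀ p ∈ Ioo p0 0, HasDerivAt (f q) (fp q p) p

theorem sobp_aux {p0 : ℝ} {f fp : ℝ → ℝ → ℝ} (h : PD p0 f fp) (q a b : ℝ) (ha : p0 ≤ a)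
    (hab : a ≤ b) (hb : b ≤ 0) :
    |f q b ^ 2 - f q a ^ 2| ≤ ∫ p in p0..0, (f * f + fp * fp) q p := by
  obtain ⟨cf, cfp, hd⟩ := h
  have e1 : ∫ p in a..b, 2 * f q p * fp q p = f q b ^ 2 - f q a ^ 2 := by
    refine intervalIntegral.integral_eq_sub_of_hasDerivAt_of_le (f := fun p => f q p ^ 2) hab
      ((cf.cont_p q).pow 2).continuousOn (fun x hx => ?_) ?_
    · have := (hd q x ⟨ha.trans_lt hx.1, hx.2.trans_le hb⟩).pow 2
      exact this.congr_deriv (by norm_num)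
    · exact ((continuous_const.mul (cf.cont_p q)).mul (cfp.cont_p q)).intervalIntegrable _ _
  rw [← e1]
  have cE : Continuous fun p => (f * f + fp * fp) q p := ((cf.mul cf).add (cfp.mul cfp)).cont_p q
  calc |∫ p in a..b, 2 * f q p * fp q p| ≤ ∫ p in a..b, |2 * f q p * fp q p| :=
        intervalIntegral.abs_integral_le_integral_abs hab
    _ ≤ ∫ p in a..b, (f * f + fp * fp) q p := by
        refine intervalIntegral.integral_mono_on hab ?_ (cE.intervalIntegrable _ _) fun p _ => ?_
        · exact ((continuous_const.mul (cf.cont_p q)).mul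
            (cfp.cont_p q)).abs.intervalIntegrable _ _
        · simp only [Pi.add_apply, Pi.mul_apply]
          rw [abs_le]
          constructor <;> nlinarith [sq_nonneg (f q p - fp q p), sq_nonneg (f q p + fp q p)]
    _ ≤ ∫ p in p0..0, (f * f + fp * fp) q p := by
        refine intervalIntegral.integral_mono_interval ha hab hb ?_ (cE.intervalIntegrable _ _)
        refine ae_of_all _ fun p => ?_
        simp only [Pi.add_apply, Pi.mul_apply, Pi.zero_apply]
        exact add_nonneg (mul_self_nonneg _) (mul_self_nonneg _)

theorem sobp {p0 : ℝ} (hp : p0 < 0) {f fp : ℝ → ℝ → ℝ} (h : PD p0 f fp) (q p : ℝ)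
    (hpp : p ∈ Icc p0 0) :
    f q p ^ 2 ≤ (1 + 1 / (-p0)) * ∫ p in p0..0, (f * f + fp * fp) q p := by
  have hp' : 0 < -p0 := by linarith
  set E := ∫ p in p0..0, (f * f + fp * fp) q p with hE
  have h1 : ∀ p' ∈ Icc p0 0, f q p ^ 2 - E ≤ f q p' ^ 2 := by
    intro p' hp1
    rcases le_total p' p with hle | hle
    · have := sobp_aux h q p' p hp1.1 hle hpp.2
      rw [abs_le] at this; linarith [this.2]
    · have := sobp_aux h q p p' hpp.1 hle hp1.2
      rw [abs_le] at this; linarith [this.1]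
  have h2 : ∫ p' in p0..0, (f q p ^ 2 - E) ≤ ∫ p' in p0..0, (f * f + fp * fp) q p' := by
    refine intervalIntegral.integral_mono_on hp.le (by simp)
      ((((h.1.mul h.1).add (h.2.1.mul h.2.1)).cont_p q).intervalIntegrable _ _) fun p' hp1 => ?_
    refine (h1 p' hp1).trans ?_
    simp only [Pi.add_apply, Pi.mul_apply]
    nlinarith [sq_nonneg (fp q p')]
  rw [intervalIntegral.integral_const, ← hE, smul_eq_mul, zero_sub] at h2
  have h3 : f q p ^ 2 - E ≤ E / (-p0) := by
    rw [le_div_iff₀ hp']; linarith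
  calc f q p ^ 2 ≤ E + E / (-p0) := by linarith
    _ = _ := by ring

theorem sobq_aux {m : ℝ → ℝ} (hm : Continuous m) (a b s : ℝ) (hs : s ≠ 0) :
    ∫ q in a..b, (m (q + s) - m q) / s =
      s⁻¹ * ((∫ x in (0:ℝ)..(b + s), m x) - ∫ x in (0:ℝ)..b, m x) -
      s⁻¹ * ((∫ x in (0:ℝ)..(a + s), m x) - ∫ x in (0:ℝ)..a, m x) := by
  have hI : ∀ x y, IntervalIntegrable m volume x y := fun x y => hm.intervalIntegrable _ _
  rw [intervalIntegral.integral_div, intervalIntegral.integral_sub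
    ((by fun_prop : Continuous fun q => m (q + s)).intervalIntegrable _ _) (hI _ _),
    intervalIntegral.integral_comp_add_right (fun q => m q) s,
    ← intervalIntegral.integral_interval_sub_left (hI 0 (b + s)) (hI 0 (a + s)),
    ← intervalIntegral.integral_interval_sub_left (hI 0 b) (hI 0 a)]
  field_simp; ring

theorem sobq_lim {m : ℝ → ℝ} (hm : Continuous m) (b : ℝ) :
    Tendsto (fun s : ℝ => s⁻¹ * ((∫ x in (0:ℝ)..(b + s), m x) - ∫ x in (0:ℝ)..b, m x))
      (𝓝[>] 0) (𝓝 (m b)) := by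
  have h : HasDerivAt (fun u => ∫ x in (0:ℝ)..u, m x) (m b) b :=
    intervalIntegral.integral_hasDerivAt_right (hm.intervalIntegrable _ _)
      (hm.stronglyMeasurableAtFilter _ _) hm.continuousAt
  have := (hasDerivAt_iff_tendsto_slope_zero.mp h)
  exact this.mono_left (nhdsWithin_mono _ (fun x hx => ne_of_gt hx))

theorem om_half {x : ℝ} (h : |x| ≤ 1) : 1 / 2 ≤ om x := by
  unfold om
  rw [one_div]
  apply inv_anti₀ (by positivity)
  have := abs_le.mp h
  nlinarith

theorem JJ_window {f : ℝ → ℝ → ℝ} (hf : CB f) (h0 : ∀ q p, 0 ≤ f q p) {p0 : ℝ} (hp : p0 < 0)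
    (a b : ℝ) (hab : a ≤ b) (hab1 : b - 1 ≤ a) :
    ∫ q in a..b, (∫ p in p0..0, f q p) ≤ 2 * JJ p0 b f := by
  have hm0 : ∀ q, 0 ≤ ∫ p in p0..0, f q p := fun q =>
    intervalIntegral.integral_nonneg hp.le (fun p _ => h0 q p)
  have h1 : ∫ q in a..b, (∫ p in p0..0, f q p) ≤
      ∫ q in a..b, 2 * (om (q - b) * ∫ p in p0..0, f q p) := by
    refine intervalIntegral.integral_mono_on hab ((hf.cont_int p0).intervalIntegrable _ _) ?_ ?_
    · have := hf.cont_int p0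
      have := om_cont
      exact Continuous.intervalIntegrable (by fun_prop) _ _
    · intro q hq
      have := om_half (x := q - b) (by rw [abs_le]; constructor <;> linarith [hq.1, hq.2])
      nlinarith [hm0 q]
  refine h1.trans ?_
  rw [intervalIntegral.integral_const_mul, intervalIntegral.integral_of_le hab]
  refine mul_le_mul_of_nonneg_left ?_ (by norm_num)
  exact setIntegral_le_integral (hf.Jint p0 b)
    (ae_of_all _ fun q => mul_nonneg (om_pos _).le (hm0 q))

theorem sobq {p0 τ : ℝ} (hp : p0 < 0) (hτ : 0 < τ) {f : ℝ → ℝ → ℝ} {M : ℝ} (hf : CB f)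
    (h1 : LB p0 f M) (h2 : ∀ s ∈ Ioc 0 τ, LB p0 (DD s f) M) (b : ℝ) :
    ∫ p in p0..0, (f * f) b p ≤ 7 * M ^ 2 := by
  set m : ℝ → ℝ := fun q => ∫ p in p0..0, (f * f) q p with hm
  have cm : Continuous m := (hf.mul hf).cont_int p0
  have key : ∀ a, a ≤ b → b - 1 ≤ a → ∀ s ∈ Ioc 0 τ,
      ∫ q in a..b, (m (q + s) - m q) / s ≤ 5 * M ^ 2 := by
    intro a hab hab1 s hs
    have hs0 : s ≠ 0 := hs.1.ne'
    set e : ℝ → ℝ → ℝ := cst (1/2) * (DD s f * DD s f) + (sh s f * sh s f + f * f) with he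
    have c1 : CB (cst (1/2) * (DD s f * DD s f)) := (CB.cst _).mul ((hf.DD s).mul (hf.DD s))
    have c2 : CB (sh s f * sh s f) := (hf.sh s).mul (hf.sh s)
    have c3 : CB (f * f) := hf.mul hf
    have ce : CB e := c1.add (c2.add c3)
    have he0 : ∀ q p, 0 ≤ e q p := fun q p => by
      simp only [he, Pi.add_apply, Pi.mul_apply, cst]
      linarith [mul_self_nonneg (DD s f q p), mul_self_nonneg (sh s f q p), mul_self_nonneg (f q p)]
    have e1 : ∀ q, (m (q + s) - m q) / s ≤ ∫ p in p0..0, e q p := by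
      intro q
      have : (m (q + s) - m q) / s = ∫ p in p0..0, (DD s f * (sh s f + f)) q p := by
        simp only [hm]
        rw [← intervalIntegral.integral_sub (c3.ii _ _ _) (c3.ii _ _ _),
          ← intervalIntegral.integral_div]
        congr 1; funext p
        simp only [DD, sh, Pi.mul_apply, Pi.add_apply]; field_simp; ring
      rw [this]
      refine intervalIntegral.integral_mono_on hp.le
        (((hf.DD s).mul ((hf.sh s).add hf)).ii _ _ _) (ce.ii _ _ _) fun p _ => ?_
      simp only [he, Pi.add_apply, Pi.mul_apply, cst]
      nlinarith [sq_nonneg (DD s f q p - (sh s f q p + f q p)), sq_nonneg (sh s f q p - f q p)]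
    have e2 : ∫ q in a..b, (m (q + s) - m q) / s ≤ ∫ q in a..b, (∫ p in p0..0, e q p) := by
      refine intervalIntegral.integral_mono_on hab ?_ ((ce.cont_int p0).intervalIntegrable _ _)
        fun q _ => e1 q
      exact Continuous.intervalIntegrable (by fun_prop) _ _
    refine e2.trans ((JJ_window ce he0 hp a b hab hab1).trans ?_)
    rw [he, JJ_add c1 (c2.add c3), JJ_add c2 c3, JJ_cmul]
    have i1 := h2 s hs b
    have i2 := h1.sh s b
    have i3 := h1 b
    linarith
  have key2 : ∀ a, a ≤ b → b - 1 ≤ a → m b - 5 * M ^ 2 ≤ m a := by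
    intro a hab hab1
    have t1 := (sobq_lim cm b).sub (sobq_lim cm a)
    have : m b - m a ≤ 5 * M ^ 2 := by
      refine le_of_tendsto t1 ?_
      have : Ioc 0 τ ∈ 𝓝[>] (0:ℝ) := Ioc_mem_nhdsGT hτ
      filter_upwards [this] with s hs
      rw [← sobq_aux cm a b s hs.1.ne']
      exact key a hab hab1 s hs
    linarith
  have h3 : ∫ a in (b - 1)..b, (m b - 5 * M ^ 2) ≤ ∫ a in (b - 1)..b, m a :=
    intervalIntegral.integral_mono_on (by linarith) (by simp) (cm.intervalIntegrable _ _)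
      fun a ha => key2 a ha.2 ha.1
  rw [intervalIntegral.integral_const, smul_eq_mul] at h3
  have h4 := JJ_window (hf.mul hf) (fun q p => mul_self_nonneg _) hp (b - 1) b (by linarith) le_rfl
  have h5 := h1 b
  have h6 : m b = ∫ p in p0..0, (f * f) b p := rfl
  have h7 : ∫ a in (b - 1)..b, m a = ∫ q in (b-1)..b, ∫ p in p0..0, (f * f) q p := rfl
  rw [← h6]
  linarith

def cS (p0 : ℝ) : ℝ := Real.sqrt (14 * (1 + 1 / (-p0)))

theorem cS_pos {p0 : ℝ} (hp : p0 < 0) : 0 < cS p0 := by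
  unfold cS
  have : 0 < -p0 := by linarith
  positivity

theorem cS_sq {p0 : ℝ} (hp : p0 < 0) : cS p0 ^ 2 = 14 * (1 + 1 / (-p0)) := by
  unfold cS
  have : 0 < -p0 := by linarith
  rw [Real.sq_sqrt (by positivity)]

/-- mixed product -/
theorem LB.mix {p0 τ : ℝ} (hp : p0 < 0) (hτ : 0 < τ) {f fp g : ℝ → ℝ → ℝ} {M N : ℝ}
    (hf : PD p0 f fp) (hg : CB g) (f1 : LB p0 f M) (f2 : LB p0 fp M)
    (g1 : LB p0 g N) (g2 : ∀ s ∈ Ioc 0 τ, LB p0 (DD s g) N) :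
    LB p0 (f * g) (cS p0 * M * N) := fun q0 => by
  have hp' : 0 < -p0 := by linarith
  have cE : CB (f * f + fp * fp) := (hf.1.mul hf.1).add (hf.2.1.mul hf.2.1)
  set c : ℝ := (1 + 1 / (-p0)) * (7 * N ^ 2) with hc
  have hc0 : 0 ≤ c := by positivity
  have h1 : ∀ q, ∫ p in p0..0, ((f * g) * (f * g)) q p ≤
      ∫ p in p0..0, (cst c * (f * f + fp * fp)) q p := by
    intro q
    set E := ∫ p in p0..0, (f * f + fp * fp) q p with hE
    have hE0 : 0 ≤ E := intervalIntegral.integral_nonneg hp.le fun p _ => by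
      simp only [Pi.add_apply, Pi.mul_apply]
      exact add_nonneg (mul_self_nonneg _) (mul_self_nonneg _)
    have e1 : ∫ p in p0..0, ((f * g) * (f * g)) q p ≤
        ∫ p in p0..0, ((1 + 1 / (-p0)) * E) * (g * g) q p := by
      refine intervalIntegral.integral_mono_on hp.le
        (((hf.1.mul hg).mul (hf.1.mul hg)).ii _ _ _) (((hg.mul hg).ii _ _ _).const_mul _)
        fun p hpp => ?_
      have := sobp hp hf q p hpp
      simp only [Pi.mul_apply]
      rw [← hE] at this
      nlinarith [mul_self_nonneg (g q p)]
    rw [intervalIntegral.integral_const_mul] at e1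
    have e2 := sobq hp hτ hg g1 g2 q
    have e3 : ∫ p in p0..0, (cst c * (f * f + fp * fp)) q p = c * E := by
      rw [hE, ← intervalIntegral.integral_const_mul]; rfl
    rw [e3, hc]
    refine e1.trans ?_
    have : (1 + 1 / -p0) * E * ∫ p in p0..0, (g * g) q p ≤ (1 + 1 / -p0) * E * (7 * N ^ 2) :=
      mul_le_mul_of_nonneg_left e2 (by positivity)
    linarith
  have h2 : JJ p0 q0 ((f * g) * (f * g)) ≤ JJ p0 q0 (cst c * (f * f + fp * fp)) := by
    unfold JJ
    refine integral_mono (((hf.1.mul hg).mul (hf.1.mul hg)).Jint p0 q0)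
      (((CB.cst _).mul cE).Jint p0 q0) fun q => ?_
    exact mul_le_mul_of_nonneg_left (h1 q) (om_pos _).le
  rw [JJ_cmul, JJ_add (hf.1.mul hf.1) (hf.2.1.mul hf.2.1)] at h2
  have h3 := f1 q0
  have h4 := f2 q0
  rw [mul_pow, mul_pow, cS_sq hp]
  calc _ ≤ _ := h2
    _ ≤ c * (M ^ 2 + M ^ 2) := by gcongr
    _ = _ := by rw [hc]; ring

theorem sup_bd {p0 τ : ℝ} (hp : p0 < 0) (hτ : 0 < τ) {f fp : ℝ → ℝ → ℝ} {M : ℝ} (hM : 0 ≤ M)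
    (hf : PD p0 f fp) (f1 : LB p0 f M) (f2 : ∀ s ∈ Ioc 0 τ, LB p0 (DD s f) M)
    (f3 : LB p0 fp M) (f4 : ∀ s ∈ Ioc 0 τ, LB p0 (DD s fp) M) (q p : ℝ) (hpp : p ∈ Icc p0 0) :
    |f q p| ≤ cS p0 * M := by
  have hp' : 0 < -p0 := by linarith
  have h1 := sobp hp hf q p hpp
  have h2 := sobq hp hτ hf.1 f1 f2 q
  have h3 := sobq hp hτ hf.2.1 f3 f4 q
  have h4 : ∫ p in p0..0, (f * f + fp * fp) q p =
      (∫ p in p0..0, (f * f) q p) + ∫ p in p0..0, (fp * fp) q p := by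
    rw [← intervalIntegral.integral_add ((hf.1.mul hf.1).ii _ _ _)
      ((hf.2.1.mul hf.2.1).ii _ _ _)]; rfl
  refine abs_le_of_sq_le_sq ?_ (mul_nonneg (cS_pos hp).le hM)
  rw [mul_pow, cS_sq hp]
  calc _ ≤ _ := h1
    _ ≤ (1 + 1 / -p0) * (7 * M ^ 2 + 7 * M ^ 2) := by rw [h4]; gcongr
    _ = _ := by ring

end

section

open MeasureTheory Filter Topology

theorem DD_add (t : ℝ) (f g) : DD t (f + g) = DD t f + DD t g := by
  funext q p; simp only [DD, Pi.add_apply]; ring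
theorem DD_sub (t : ℝ) (f g) : DD t (f - g) = DD t f - DD t g := by
  funext q p; simp only [DD, Pi.sub_apply]; ring
theorem DD_mul (t : ℝ) (f g) : DD t (f * g) = DD t f * sh t g + f * DD t g := by
  funext q p; simp only [DD, Pi.add_apply, Pi.mul_apply, sh]; ring
theorem DD_comm (s t : ℝ) (f) : DD s (DD t f) = DD t (DD s f) := by
  funext q p; simp only [DD]
  rw [show q + s + t = q + t + s by ring]; ring
theorem DD_sh (s t : ℝ) (f) : DD s (sh t f) = sh t (DD s f) := by
  funext q p; simp only [DD, sh]
  rw [show q + s + t = q + t + s by ring]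
theorem sh_add' (t : ℝ) (f g) : sh t (f + g) = sh t f + sh t g := rfl
theorem sh_sub' (t : ℝ) (f g) : sh t (f - g) = sh t f - sh t g := rfl
theorem sh_mul' (t : ℝ) (f g) : sh t (f * g) = sh t f * sh t g := rfl
theorem sh_sh (s t : ℝ) (f) : sh s (sh t f) = sh (s + t) f := by
  funext q p; simp only [sh, add_assoc]
theorem sh_zero (f) : sh 0 f = f := by funext q p; simp [sh]

def DL : List ℝ → (ℝ → ℝ → ℝ) → (ℝ → ℝ → ℝ)
  | [], f => f
  | t :: ts, f => DL ts (DD t f)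

theorem DL_DD (ts : List ℝ) (t : ℝ) (f) : DL ts (DD t f) = DD t (DL ts f) := by
  induction ts generalizing f with
  | nil => rfl
  | cons s ts ih => simp only [DL]; rw [DD_comm, ih]
theorem DL_cons (t : ℝ) (ts : List ℝ) (f) : DL (t :: ts) f = DD t (DL ts f) := DL_DD ts t f
theorem DL_sh (ts : List ℝ) (t : ℝ) (f) : DL ts (sh t f) = sh t (DL ts f) := by
  induction ts generalizing f with
  | nil => rfl
  | cons s ts ih => simp only [DL]; rw [DD_sh, ih]
theorem DL_add (ts : List ℝ) (f g) : DL ts (f + g) = DL ts f + DL ts g := by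
  induction ts generalizing f g with
  | nil => rfl
  | cons s ts ih => simp only [DL]; rw [DD_add, ih]
theorem DL_sub (ts : List ℝ) (f g) : DL ts (f - g) = DL ts f - DL ts g := by
  induction ts generalizing f g with
  | nil => rfl
  | cons s ts ih => simp only [DL]; rw [DD_sub, ih]
theorem CB.DL {f} (hf : CB f) (ts : List ℝ) : CB (DL ts f) := by
  induction ts generalizing f with
  | nil => exact hf
  | cons s ts ih => exact ih (hf.DD s)

theorem PD.add {p0 f fp g gp} (hf : PD p0 f fp) (hg : PD p0 g gp) : PD p0 (f + g) (fp + gp) :=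
  ⟨hf.1.add hg.1, hf.2.1.add hg.2.1, fun q p hp => (hf.2.2 q p hp).add (hg.2.2 q p hp)⟩
theorem PD.sub {p0 f fp g gp} (hf : PD p0 f fp) (hg : PD p0 g gp) : PD p0 (f - g) (fp - gp) :=
  ⟨hf.1.sub hg.1, hf.2.1.sub hg.2.1, fun q p hp => (hf.2.2 q p hp).sub (hg.2.2 q p hp)⟩
theorem PD.mul {p0 f fp g gp} (hf : PD p0 f fp) (hg : PD p0 g gp) :
    PD p0 (f * g) (fp * g + f * gp) :=
  ⟨hf.1.mul hg.1, (hf.2.1.mul hg.1).add (hf.1.mul hg.2.1),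
    fun q p hp => (hf.2.2 q p hp).mul (hg.2.2 q p hp)⟩
theorem PD.sh {p0 f fp} (hf : PD p0 f fp) (t : ℝ) : PD p0 (sh t f) (sh t fp) :=
  ⟨hf.1.sh t, hf.2.1.sh t, fun q p hp => hf.2.2 (q + t) p hp⟩
theorem PD.DD {p0 f fp} (hf : PD p0 f fp) (t : ℝ) : PD p0 (DD t f) (DD t fp) :=
  ⟨hf.1.DD t, hf.2.1.DD t, fun q p hp =>
    ((hf.2.2 (q + t) p hp).sub (hf.2.2 q p hp)).div_const t⟩
theorem PD.DL {p0 f fp} (hf : PD p0 f fp) (ts : List ℝ) : PD p0 (DL ts f) (DL ts fp) := by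
  induction ts generalizing f fp with
  | nil => exact hf
  | cons s ts ih => exact ih (hf.DD s)

structure XB (p0 τ : ℝ) (f fp : ℝ → ℝ → ℝ) (M : ℝ) : Prop where
  pd : PD p0 f fp
  nn : 0 ≤ M
  l0 : LB p0 f M
  l1 : ∀ s ∈ Ioc 0 τ, LB p0 (DD s f) M
  l2 : ∀ s ∈ Ioc 0 τ, ∀ t ∈ Ioc 0 τ, LB p0 (DD s (DD t f)) M
  q0 : LB p0 fp M
  q1 : ∀ s ∈ Ioc 0 τ, LB p0 (DD s fp) M

section
variable {p0 τ : ℝ} {f fp g gp : ℝ → ℝ → ℝ} {M N : ℝ}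

theorem XB.mono (h : XB p0 τ f fp M) (hMN : M ≤ N) : XB p0 τ f fp N where
  pd := h.pd
  nn := h.nn.trans hMN
  l0 := h.l0.mono h.nn hMN
  l1 s hs := (h.l1 s hs).mono h.nn hMN
  l2 s hs t ht := (h.l2 s hs t ht).mono h.nn hMN
  q0 := h.q0.mono h.nn hMN
  q1 s hs := (h.q1 s hs).mono h.nn hMN

theorem XB.sh (h : XB p0 τ f fp M) (r : ℝ) : XB p0 τ (sh r f) (sh r fp) M where
  pd := h.pd.sh r
  nn := h.nn
  l0 := h.l0.sh r
  l1 s hs := by rw [DD_sh]; exact (h.l1 s hs).sh r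
  l2 s hs t ht := by rw [DD_sh, DD_sh]; exact (h.l2 s hs t ht).sh r
  q0 := h.q0.sh r
  q1 s hs := by rw [DD_sh]; exact (h.q1 s hs).sh r

theorem XB.add (hp : p0 < 0) (h : XB p0 τ f fp M) (k : XB p0 τ g gp N) :
    XB p0 τ (f + g) (fp + gp) (M + N) where
  pd := h.pd.add k.pd
  nn := add_nonneg h.nn k.nn
  l0 := h.l0.add hp h.pd.1 k.pd.1 k.l0 h.nn k.nn
  l1 s hs := by
    rw [DD_add]; exact (h.l1 s hs).add hp (h.pd.1.DD s) (k.pd.1.DD s) (k.l1 s hs) h.nn k.nn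
  l2 s hs t ht := by
    rw [DD_add, DD_add]
    exact (h.l2 s hs t ht).add hp ((h.pd.1.DD t).DD s) ((k.pd.1.DD t).DD s) (k.l2 s hs t ht)
      h.nn k.nn
  q0 := h.q0.add hp h.pd.2.1 k.pd.2.1 k.q0 h.nn k.nn
  q1 s hs := by
    rw [DD_add]; exact (h.q1 s hs).add hp (h.pd.2.1.DD s) (k.pd.2.1.DD s) (k.q1 s hs) h.nn k.nn

theorem XB.sup (hp : p0 < 0) (hτ : 0 < τ) (h : XB p0 τ f fp M) (q p : ℝ) (hpp : p ∈ Icc p0 0) :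
    |f q p| ≤ cS p0 * M :=
  sup_bd hp hτ h.nn h.pd h.l0 h.l1 h.q0 h.q1 q p hpp

theorem XB.mul (hp : p0 < 0) (hτ : 0 < τ) (h : XB p0 τ f fp M) (k : XB p0 τ g gp N) :
    XB p0 τ (f * g) (fp * g + f * gp) (4 * cS p0 * M * N) := by
  have c0 := cS_pos hp
  have hM := h.nn
  have hN := k.nn
  have cf := h.pd.1
  have cg := k.pd.1
  have cfp := h.pd.2.1
  have cgp := k.pd.2.1
  have e0 : 0 ≤ cS p0 * M * N := by positivity
  have e1 : ∀ {u : ℝ → ℝ → ℝ}, CB u → LB p0 u N → LB p0 (f * u) (cS p0 * M * N) := fun cu hu =>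
    hu.bmul hp cf cu (h.sup hp hτ)
  have e2 : ∀ {u : ℝ → ℝ → ℝ} (t : ℝ), CB u → LB p0 u M → LB p0 (u * _root_.sh t g) (cS p0 * M * N) := by
    intro u t cu hu
    have := hu.bmul hp (cg.sh t) cu ((k.sh t).sup hp hτ)
    rw [mul_comm u]
    convert this using 1; ring
  have e3 : LB p0 (fp * g) (cS p0 * M * N) := by have := e2 0 cfp h.q0; rwa [sh_zero] at this
  refine ⟨h.pd.mul k.pd, by linarith, ?_, ?_, ?_, ?_, ?_⟩
  · exact (e1 cg k.l0).mono e0 (by linarith)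
  · intro s hs
    rw [DD_mul]
    exact ((e2 s (cf.DD s) (h.l1 s hs)).add hp ((cf.DD s).mul (cg.sh s)) (cf.mul (cg.DD s))
      (e1 (cg.DD s) (k.l1 s hs)) e0 e0).mono (by linarith) (by linarith)
  · intro s hs t ht
    rw [DD_mul, DD_add, DD_mul, DD_mul, DD_sh, sh_sh]
    have i1 := e2 (s + t) ((cf.DD t).DD s) (h.l2 s hs t ht)
    have i2 : LB p0 (DD t f * _root_.sh t (DD s g)) (cS p0 * M * N) :=
      LB.mix hp hτ (h.pd.DD t) ((cg.DD s).sh t) (h.l1 t ht) (h.q1 t ht) ((k.l1 s hs).sh t)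
        (fun r hr => by rw [DD_sh]; exact (k.l2 r hr s hs).sh t)
    have i3 : LB p0 (DD s f * _root_.sh s (DD t g)) (cS p0 * M * N) :=
      LB.mix hp hτ (h.pd.DD s) ((cg.DD t).sh s) (h.l1 s hs) (h.q1 s hs) ((k.l1 t ht).sh s)
        (fun r hr => by rw [DD_sh]; exact (k.l2 r hr t ht).sh s)
    have i4 := e1 ((cg.DD t).DD s) (k.l2 s hs t ht)
    have c1 := ((cf.DD t).DD s).mul (cg.sh (s + t))
    have c2 := (cf.DD t).mul ((cg.DD s).sh t)
    have c3 := (cf.DD s).mul ((cg.DD t).sh s)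
    have c4 := cf.mul ((cg.DD t).DD s)
    have := (i1.add hp c1 c2 i2 e0 e0).add hp (c1.add c2) (c3.add c4) (i3.add hp c3 c4 i4 e0 e0)
      (by linarith) (by linarith)
    exact this.mono (by linarith) (by linarith)
  · exact (e3.add hp (cfp.mul cg) (cf.mul cgp) (e1 cgp k.q0) e0 e0).mono (by linarith)
      (by linarith)
  · intro s hs
    rw [DD_add, DD_mul, DD_mul]
    have i1 := e2 s (cfp.DD s) (h.q1 s hs)
    have i2 : LB p0 (fp * DD s g) (cS p0 * M * N) := by
      have := LB.mix hp hτ (k.pd.DD s) cfp (k.l1 s hs) (k.q1 s hs) h.q0 h.q1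
      rw [mul_comm fp]
      convert this using 1; ring
    have i3 : LB p0 (DD s f * _root_.sh s gp) (cS p0 * M * N) :=
      LB.mix hp hτ (h.pd.DD s) (cgp.sh s) (h.l1 s hs) (h.q1 s hs) (k.q0.sh s)
        (fun r hr => by rw [DD_sh]; exact (k.q1 r hr).sh s)
    have i4 := e1 (cgp.DD s) (k.q1 s hs)
    have c1 := (cfp.DD s).mul (cg.sh s)
    have c2 := cfp.mul (cg.DD s)
    have c3 := (cf.DD s).mul (cgp.sh s)
    have c4 := cf.mul (cgp.DD s)
    have := (i1.add hp c1 c2 i2 e0 e0).add hp (c1.add c2) (c3.add c4) (i3.add hp c3 c4 i4 e0 e0)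
      (by linarith) (by linarith)
    exact this.mono (by linarith) (by linarith)
end

/-- Leibniz remainder -/
def Rem (ts : List ℝ) (f g : ℝ → ℝ → ℝ) : ℝ → ℝ → ℝ :=
  DL ts (f * g) - f * DL ts g - DL ts f * sh ts.sum g

def Remp (ts : List ℝ) (f fp g gp : ℝ → ℝ → ℝ) : ℝ → ℝ → ℝ := Rem ts fp g + Rem ts f gp

theorem Rem_nil' (t : ℝ) (f g) : Rem [t] f g = 0 := by
  simp only [Rem, DL, DD_mul, List.sum_cons, List.sum_nil, add_zero]; ring

theorem Rem_cons (t : ℝ) (ts : List ℝ) (f g) : Rem (t :: ts) f g =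
    Rem ts (DD t f) (sh t g) + DD t f * sh t (DL ts g) + Rem ts f (DD t g)
      + DL ts f * sh ts.sum (DD t g) := by
  simp only [Rem, DL, DD_mul, DL_add, List.sum_cons, sh_sh, DL_sh]
  rw [add_comm t]; ring

theorem Rem_cons' (t : ℝ) (ts : List ℝ) (f g) : Rem (t :: ts) f g =
    DD t (Rem ts f g) + DD t f * sh t (DL ts g) + DL ts f * sh ts.sum (DD t g) := by
  simp only [Rem, DL_cons, List.sum_cons, DD_sub, DD_mul, sh_sh, DD_sh]
  ring

theorem CB.Rem {f g} (hf : CB f) (hg : CB g) (ts : List ℝ) : CB (Rem ts f g) :=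
  (((hf.mul hg).DL ts).sub (hf.mul (hg.DL ts))).sub ((hf.DL ts).mul (hg.sh _))

theorem PD.Rem {p0 f fp g gp} (hf : PD p0 f fp) (hg : PD p0 g gp) (ts : List ℝ) :
    PD p0 (Rem ts f g) (Remp ts f fp g gp) := by
  have := (((hf.mul hg).DL ts).sub (hf.mul (hg.DL ts))).sub ((hf.DL ts).mul (hg.sh ts.sum))
  have e : Remp ts f fp g gp = _root_.DL ts (fp * g + f * gp)
    - (fp * _root_.DL ts g + f * _root_.DL ts gp) -
    (_root_.DL ts fp * _root_.sh ts.sum g + _root_.DL ts f * _root_.sh ts.sum gp) := by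
    simp only [Remp, _root_.Rem, DL_add]; ring
  rw [e]; exact this

def rs : ℕ → (ℕ → ℝ) → (ℕ → ℝ) → ℝ
  | 0, _, _ => 0
  | 1, _, _ => 0
  | n + 2, A, B => rs (n + 1) (fun j => A (j + 1)) B + A 1 * B (n + 1)
      + rs (n + 1) A (fun j => B (j + 1)) + A (n + 1) * B 1

theorem rs_eq (n : ℕ) (A B : ℕ → ℝ) : rs (n + 1) A B + A 0 * B (n + 1) + A (n + 1) * B 0 =
    ∑ ij ∈ Finset.HasAntidiagonal.antidiagonal (n + 1), ((n + 1).choose ij.1 : ℝ) * (A ij.1 * B ij.2) := by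
  induction n generalizing A B with
  | zero => simp [rs, Finset.HasAntidiagonal.antidiagonal]
  | succ n ih =>
    have := Finset.sum_antidiagonal_choose_succ_mul (R := ℝ) (fun i j => A i * B j) (n + 1)
    have e : ∑ ij ∈ Finset.HasAntidiagonal.antidiagonal (n + 1),
        ((n + 1).choose ij.2 : ℝ) * (A (ij.1 + 1) * B ij.2) =
        ∑ ij ∈ Finset.HasAntidiagonal.antidiagonal (n + 1),
        ((n + 1).choose ij.1 : ℝ) * (A (ij.1 + 1) * B ij.2) := by
      refine Finset.sum_congr rfl fun ij hij => ?_
      rw [Finset.HasAntidiagonal.mem_antidiagonal] at hij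
      rw [Nat.choose_symm_of_eq_add hij.symm]
    rw [this, e, ← ih A (fun j => B (j + 1)), ← ih (fun j => A (j + 1)) B]
    simp only [rs]; ring

/-- family bounds -/
def Fm (p0 τ τ' : ℝ) (n : ℕ) (f fp : ℝ → ℝ → ℝ) (A : ℕ → ℝ) : Prop :=
  ∀ ts : List ℝ, (∀ t ∈ ts, 0 < t) → ts.sum ≤ τ' → ts.length ≤ n →
    XB p0 τ (DL ts f) (DL ts fp) (A ts.length)

theorem Fm.sh {p0 τ τ' n f fp A} (h : Fm p0 τ τ' n f fp A) (t : ℝ) :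
    Fm p0 τ τ' n (sh t f) (sh t fp) A := fun ts h1 h2 h3 => by
  rw [DL_sh, DL_sh]; exact (h ts h1 h2 h3).sh t

theorem Fm.DD {p0 τ τ' n f fp A} (h : Fm p0 τ τ' (n + 1) f fp A) {t : ℝ} (ht : 0 < t) :
    Fm p0 τ (τ' - t) n (DD t f) (DD t fp) (fun j => A (j + 1)) := fun ts h1 h2 h3 => by
  refine h (t :: ts) ?_ ?_ ?_
  · intro x hx; rcases List.mem_cons.mp hx with rfl | hx
    · exact ht
    · exact h1 x hx
  · simp only [List.sum_cons]; linarith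
  · simpa using h3

theorem Fm.weak {p0 τ τ' τ'' n m f fp A} (h : Fm p0 τ τ' n f fp A) (h1 : τ'' ≤ τ') (h2 : m ≤ n) :
    Fm p0 τ τ'' m f fp A := fun ts a b c => h ts a (b.trans h1) (c.trans h2)

theorem XB_Rem {p0 τ : ℝ} (hp : p0 < 0) (hτ : 0 < τ) (n : ℕ) : ∀ (τ' : ℝ) (f fp g gp : ℝ → ℝ → ℝ)
    (A B : ℕ → ℝ), Fm p0 τ τ' n f fp A → Fm p0 τ τ' n g gp B → 
    ∀ ts : List ℝ, (∀ t ∈ ts, 0 < t) → ts.sum ≤ τ' → ts.length = n + 1 → 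
    XB p0 τ (Rem ts f g) (Remp ts f fp g gp) (4 * cS p0 * rs (n + 1) A B) := by
  induction n with
  | zero =>
    intro τ' f fp g gp A B _ _ ts _ _ hl
    obtain ⟨t, rfl⟩ := List.length_eq_one_iff.mp hl
    rw [Remp, Rem_nil', Rem_nil', Rem_nil', add_zero]
    simp only [rs, mul_zero]
    have z : LB p0 0 0 := fun q0 => by simp [JJ]
    have d0 : ∀ s, DD s 0 = 0 := fun s => by funext q p; simp [DD]
    have c0 : CB 0 := ⟨continuous_const, 0, fun q p => by simp⟩
    refine ⟨⟨c0, c0, fun q p _ => hasDerivAt_const _ _⟩, le_rfl, z, ?_, ?_, z, ?_⟩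
    · intro s _; rw [d0]; exact z
    · intro s _ t _; rw [d0, d0]; exact z
    · intro s _; rw [d0]; exact z
  | succ n ih =>
    intro τ' f fp g gp A B hf hg ts h1 h2 hl
    match ts, hl with
    | t :: ts, hl =>
      have hl' : ts.length = n + 1 := by simpa using hl
      have ht : 0 < t := h1 t (by simp)
      have h1' : ∀ x ∈ ts, 0 < x := fun x hx => h1 x (by simp [hx])
      have hs0 : 0 ≤ ts.sum := List.sum_nonneg fun x hx => (h1' x hx).le
      have h2' : ts.sum ≤ τ' - t := by simp only [List.sum_cons] at h2; linarith
      have i1 := ih (τ' - t) _ _ _ _ _ _ (hf.DD ht) ((hg.weak (by linarith) (by omega)).sh t)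
        ts h1' h2' hl'
      have i3 := ih (τ' - t) _ _ _ _ _ _ (hf.weak (by linarith) (by omega)) (hg.DD ht) ts h1' h2' hl'
      have f1 : XB p0 τ (DD t f) (DD t fp) (A 1) := hf [t] (by simpa using ht)
        (by simp; linarith) (by simp)
      have g1 : XB p0 τ (DD t g) (DD t gp) (B 1) := hg [t] (by simpa using ht)
        (by simp; linarith) (by simp)
      have fn := hf ts h1' (by linarith) (by omega)
      have gn := hg ts h1' (by linarith) (by omega)
      have i2 := f1.mul hp hτ (gn.sh t)
      have i4 := fn.mul hp hτ (g1.sh ts.sum)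
      have := ((i1.add hp i2).add hp i3).add hp i4
      rw [Remp, Rem_cons, Rem_cons, Rem_cons]
      rw [hl'] at this
      convert this using 1
      · simp only [Remp]; ring
      · simp only [rs]; ring

end

section

open MeasureTheory Filter Topology

theorem quad_main {K δ U V A G : ℝ} (hδ : 0 < δ) (hU : |U| ≤ K) (hδV : δ ≤ V) :
    δ / (2 + (2 * K ^ 2 + 1) / δ ^ 2) / 2 * (|A| + |G|) ^ 2 ≤
      V * ((A - U * G) ^ 2 + V ^ 2 * G ^ 2) := by
  set P := (A - U * G) ^ 2 with hP
  have hP0 : 0 ≤ P := sq_nonneg _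
  set D := (2 * K ^ 2 + 1) / δ ^ 2 with hD
  have hD0 : 0 ≤ D := by positivity
  have h1 : (|A| + |G|) ^ 2 ≤ 2 * (A ^ 2 + G ^ 2) := by
    nlinarith [sq_abs A, sq_abs G, sq_nonneg (|A| - |G|)]
  have hUK : U ^ 2 ≤ K ^ 2 := by rw [← sq_abs U]; gcongr
  have h2 : A ^ 2 + G ^ 2 ≤ 2 * P + (2 * K ^ 2 + 1) * G ^ 2 := by
    have := mul_le_mul_of_nonneg_right hUK (sq_nonneg G)
    nlinarith [sq_nonneg (A - 2 * (U * G))]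
  have h3 : (2 * K ^ 2 + 1) * G ^ 2 ≤ D * (V ^ 2 * G ^ 2) := by
    have : δ ^ 2 ≤ V ^ 2 := by gcongr
    have e : (2 * K ^ 2 + 1) * G ^ 2 = D * (δ ^ 2 * G ^ 2) := by rw [hD]; field_simp
    rw [e]; gcongr
  have h4 : A ^ 2 + G ^ 2 ≤ (2 + D) * (P + V ^ 2 * G ^ 2) := by
    have : 0 ≤ D * P := by positivity
    have := mul_nonneg (sq_nonneg V) (sq_nonneg G)
    linarith
  have h5 : δ / (2 + D) * (A ^ 2 + G ^ 2) ≤ δ * (P + V ^ 2 * G ^ 2) := by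
    rw [div_mul_eq_mul_div, div_le_iff₀ (by positivity)]
    have := mul_le_mul_of_nonneg_left h4 hδ.le
    linarith
  have h6 : δ * (P + V ^ 2 * G ^ 2) ≤ V * (P + V ^ 2 * G ^ 2) :=
    mul_le_mul_of_nonneg_right hδV (by positivity)
  have h7 := mul_le_mul_of_nonneg_left h1 (by positivity : 0 ≤ δ / (2 + D) / 2)
  linarith

theorem quad_y1 {c K R N : ℝ} (hc : 0 < c) :
    16 * K ^ 2 * R * N ≤ c / 4 * N ^ 2 + 16 * 16 * K ^ 4 / c * R ^ 2 := by
  have h : 16 * 16 * K ^ 4 / c * R ^ 2 + c / 4 * N ^ 2 - 16 * K ^ 2 * R * N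
      = (16 * K ^ 2 * R - c / 2 * N) ^ 2 / c := by field_simp; ring
  have : 0 ≤ (16 * K ^ 2 * R - c / 2 * N) ^ 2 / c := by positivity
  linarith

theorem quad_y2 (R1 R2 R3 R4 w : ℝ) : (|R1| + |R2| + |R3| + |R4| + |w|) ^ 2 ≤
    5 * (R1 * R1 + R2 * R2 + R3 * R3 + R4 * R4 + w * w) := by
  rw [← abs_mul_abs_self R1, ← abs_mul_abs_self R2, ← abs_mul_abs_self R3,
      ← abs_mul_abs_self R4, ← abs_mul_abs_self w]
  generalize |R1| = a; generalize |R2| = b; generalize |R3| = c; generalize |R4| = d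
  generalize |w| = e
  linarith [sq_nonneg (a - b), sq_nonneg (a - c), sq_nonneg (a - d), sq_nonneg (a - e),
    sq_nonneg (b - c), sq_nonneg (b - d), sq_nonneg (b - e), sq_nonneg (c - d),
    sq_nonneg (c - e), sq_nonneg (d - e)]

theorem quad_y3 (A G : ℝ) : A * A + G * G ≤ (|A| + |G|) ^ 2 := by
  rw [← abs_mul_abs_self A, ← abs_mul_abs_self G]
  linarith [mul_nonneg (abs_nonneg A) (abs_nonneg G)]

set_option maxHeartbeats 1000000 in
theorem quad_lem {K δ : ℝ} (hK : 1 ≤ K) (hδ : 0 < δ) : ∃ ε > 0, ε ≤ 1 ∧ ∃ c > 0, ∃ C ≥ 0,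
    ∀ U V S T A G R1 R2 R3 R4 w rh DU DV DE : ℝ, |U| ≤ K → |V| ≤ K → δ ≤ V → |S| ≤ K →
    |S - V| ≤ ε → |T - U| ≤ ε → |rh| ≤ K →
    DV = -V * S * G - V * R1 → DU = S * A - U * S * G - U * R1 + R2 →
    DE = (U + T) * DU + R3 + ((V + S) * DV + R4) →
    c * (A * A + G * G) ≤ DU * A - DE / 2 * G - 2 * rh * w * G - |DU * w|
      + C * (R1 * R1 + R2 * R2 + R3 * R3 + R4 * R4 + w * w) := by
  set C0 : ℝ := 2 + (2 * K ^ 2 + 1) / δ ^ 2 with hC0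
  have hC0p : 0 < C0 := by positivity
  set c0 := δ / C0 with hc0
  have hc0p : 0 < c0 := by positivity
  refine ⟨min 1 (c0 / 56 / K ^ 2), by positivity, min_le_left _ _, c0 / 8, by positivity,
    5 * (16 * 16 * K ^ 4 / c0 + 4 * K), by positivity, ?_⟩
  intro U V S T A G R1 R2 R3 R4 w rh DU DV DE hU hV hδV hS hSV hTU hrh hDV hDU hDE
  set ε := min 1 (c0 / 56 / K ^ 2) with hε
  have hε0 : 0 < ε := by positivity
  have hε1 : ε ≤ 1 := min_le_left _ _
  have hε2 : 7 * K ^ 2 * ε ≤ c0 / 8 := by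
    have : ε ≤ c0 / 56 / K ^ 2 := min_le_right _ _
    rw [le_div_iff₀ (by positivity)] at this
    linarith
  set N := |A| + |G| with hN
  set R := |R1| + |R2| + |R3| + |R4| + |w| with hR
  have hN0 : 0 ≤ N := by positivity
  have hR0 : 0 ≤ R := by positivity
  have a1 := abs_nonneg A
  have a2 := abs_nonneg G
  have b1 := abs_nonneg R1
  have b2 := abs_nonneg R2
  have b3 := abs_nonneg R3
  have b4 := abs_nonneg R4
  have b5 := abs_nonneg w
  have hAN : |A| ≤ N := by linarith
  have hGN : |G| ≤ N := by linarith
  have hK0 : 0 ≤ K := by linarith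
  have hKN : K * N ≤ K ^ 2 * N := by
    have := mul_le_mul_of_nonneg_right hK (mul_nonneg hK0 hN0); linarith
  have hεN : ε * N ≤ K * ε * N := by
    have := mul_le_mul_of_nonneg_right hK (mul_nonneg hε0.le hN0); linarith
  have hKe : K * ε * N ≤ K ^ 2 * ε * N := by
    have := mul_le_mul_of_nonneg_left hεN hK0; linarith
  have hRK : R ≤ K * R := by have := mul_le_mul_of_nonneg_right hK hR0; linarith
  have hKR : K * R ≤ K ^ 2 * R := by have := mul_le_mul_of_nonneg_left hRK hK0; linarith
  have mm : ∀ {x y X Y : ℝ}, |x| ≤ X → |y| ≤ Y → |x * y| ≤ X * Y := fun hx hy => by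
    rw [abs_mul]; exact mul_le_mul hx hy (abs_nonneg _) ((abs_nonneg _).trans hx)
  have r1 : |R1| ≤ R := by linarith
  have r2 : |R2| ≤ R := by linarith
  have r34 : |R3| + |R4| ≤ R := by linarith
  have rw' : |w| ≤ R := by linarith
  have hDU1 : |DU| ≤ 2 * K ^ 2 * N + 2 * K * R := by
    have h1 := mm hS hAN
    have h2 := mm (mm hU hS) hGN
    have h3 := mm hU r1
    rw [hDU]
    have := abs_add_le (S * A - U * S * G - U * R1) R2
    have := abs_sub (S * A - U * S * G) (U * R1)
    have := abs_sub (S * A) (U * S * G)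
    linarith
  have hDV1 : |DV| ≤ K ^ 2 * N + K * R := by
    have h2 := mm (mm hV hS) hGN
    have h3 := mm hV r1
    rw [hDV]
    have := abs_sub (-V * S * G) (V * R1)
    have e : |-V * S * G| = |V * S * G| := by rw [← abs_neg]; ring_nf
    linarith
  set e1 := (S - V) * A - U * (S - V) * G - U * R1 + R2 with he1
  set e2 := -(V * (S - V) * G) - V * R1 with he2
  set e3 := (T - U) * DU / 2 + (S - V) * DV / 2 + (R3 + R4) / 2 with he3
  have hA1 : DU = V * A - U * V * G + e1 := by rw [hDU, he1]; ring
  have hA2 : DV = -(V ^ 2 * G) + e2 := by rw [hDV, he2]; ring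
  have hA3 : DE / 2 = U * DU + V * DV + e3 := by rw [hDE, he3]; ring
  have be1 : |e1| ≤ 2 * K * ε * N + 2 * K * R := by
    have h1 := mm hSV hAN
    have h2 := mm (mm hU hSV) hGN
    have h3 := mm hU r1
    rw [he1]
    have := abs_add_le ((S - V) * A - U * (S - V) * G - U * R1) R2
    have := abs_sub ((S - V) * A - U * (S - V) * G) (U * R1)
    have := abs_sub ((S - V) * A) (U * (S - V) * G)
    linarith
  have be2 : |e2| ≤ K * ε * N + K * R := by
    have h2 := mm (mm hV hSV) hGN
    have h3 := mm hV r1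
    rw [he2]
    have := abs_sub (-(V * (S - V) * G)) (V * R1)
    rw [abs_neg] at this
    linarith
  have be3 : |e3| ≤ 3 / 2 * K ^ 2 * ε * N + 3 / 2 * K * R + R := by
    have h1 := mm hTU hDU1
    have h2 := mm hSV hDV1
    have h3 := abs_add_le ((T - U) * DU / 2 + (S - V) * DV / 2) ((R3 + R4) / 2)
    have h4 := abs_add_le ((T - U) * DU / 2) ((S - V) * DV / 2)
    have h5 := abs_add_le R3 R4
    rw [abs_div, abs_two] at h3
    rw [abs_div, abs_two, abs_div, abs_two] at h4
    have : ε * (K * R) ≤ 1 * (K * R) := mul_le_mul_of_nonneg_right hε1 (mul_nonneg hK0 hR0)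
    rw [he3]
    linarith
  have main := quad_main (A := A) (G := G) hδ hU hδV
  rw [← hC0, ← hc0] at main
  have ident : DU * A - DE / 2 * G = V * ((A - U * G) ^ 2 + V ^ 2 * G ^ 2)
      + e1 * A - (U * e1 + V * e2 + e3) * G := by
    rw [hA3, hA2, hA1]; ring
  have p1 : |e1 * A| ≤ (2 * K ^ 2 * ε * N + 2 * K ^ 2 * R) * N := mm (by linarith) hAN
  have p2 : |(U * e1 + V * e2 + e3) * G| ≤
      (9/2 * K ^ 2 * ε * N + 6 * K ^ 2 * R) * N := by
    refine mm ?_ hGN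
    have := abs_add_le (U * e1 + V * e2) e3
    have := abs_add_le (U * e1) (V * e2)
    have h1 := mm hU be1
    have h2 := mm hV be2
    linarith
  have p3 : |2 * rh * w * G| ≤ 2 * K * R * N := by
    have := mm (mm hrh rw') hGN
    rw [show 2 * rh * w * G = 2 * (rh * w * G) by ring, abs_mul, abs_two]; linarith
  have p4 : |DU * w| ≤ (2 * K ^ 2 * N + 2 * K * R) * R := mm hDU1 rw'
  have tot : (c0 / 2) * N ^ 2 - (7 * K ^ 2 * ε) * N ^ 2 - 16 * K ^ 2 * R * N - 2 * K * R ^ 2 ≤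
      DU * A - DE / 2 * G - 2 * rh * w * G - |DU * w| := by
    rw [ident]
    have q1 := (abs_le.mp p1).1
    have q2 := (abs_le.mp p2).2
    have q3 := (abs_le.mp p3).2
    have z1 : 0 ≤ K ^ 2 * (ε * N ^ 2) := by positivity
    have z2 : 0 ≤ K ^ 2 * (R * N) := by positivity
    have z3 := mul_le_mul_of_nonneg_right hKR hN0
    linarith
  have y1 : 16 * K ^ 2 * R * N ≤ c0 / 4 * N ^ 2 + 16 * 16 * K ^ 4 / c0 * R ^ 2 :=
    quad_y1 hc0p
  have y2 : R ^ 2 ≤ 5 * (R1 * R1 + R2 * R2 + R3 * R3 + R4 * R4 + w * w) := quad_y2 ..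
  have y3 : A * A + G * G ≤ N ^ 2 := quad_y3 ..
  have y4 : (7 * K ^ 2 * ε) * N ^ 2 ≤ c0 / 8 * N ^ 2 := by gcongr
  have y5 := mul_le_mul_of_nonneg_left y3 (by positivity : 0 ≤ c0 / 8)
  have y6 := mul_le_mul_of_nonneg_left y2 (by positivity : 0 ≤ 16 * 16 * K ^ 4 / c0 + 4 * K)
  have y7 : 0 ≤ K * R ^ 2 := by positivity
  linarith

end

section

open MeasureTheory Filter Topology

theorem icc_of_ioo {p0 K : ℝ} {f : ℝ → ℝ → ℝ} (hp : p0 < 0) (hf : CB f)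
    (h : ∀ q, ∀ p ∈ Ioo p0 0, |f q p| ≤ K) : ∀ q, ∀ p ∈ Icc p0 0, |f q p| ≤ K := by
  intro q p hpp
  rw [← closure_Ioo hp.ne] at hpp
  exact closure_minimal (s := Ioo p0 0) (t := {p | |f q p| ≤ K}) (fun x hx => h q x hx)
    (isClosed_le (hf.cont_p q).abs continuous_const) hpp

theorem LB.lim {p0 K M : ℝ} {f : ℝ → ℝ → ℝ} {F : ℕ → ℝ → ℝ → ℝ} (hp : p0 < 0) (hf : CB f)
    (hF : ∀ n, CB (F n)) (hK : ∀ n q, ∀ p ∈ Ioo p0 0, |F n q p| ≤ K)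
    (hl : ∀ q, ∀ p ∈ Ioo p0 0, Tendsto (fun n => F n q p) atTop (𝓝 (f q p)))
    (h : ∀ n, LB p0 (F n) M) : LB p0 f M := fun q0 => by
  have hK2 := fun n => icc_of_ioo hp (hF n) (hK n)
  have hin : ∀ q, Tendsto (fun n => ∫ p in p0..0, (F n * F n) q p) atTop
      (𝓝 (∫ p in p0..0, (f * f) q p)) := by
    intro q
    refine intervalIntegral.tendsto_integral_filter_of_dominated_convergence (fun _ => K * K) ?_ ?_
      (by simp) ?_
    · exact Eventually.of_forall fun n =>
        (((hF n).mul (hF n)).cont_p q).aestronglyMeasurable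
    · refine Eventually.of_forall fun n => ae_of_all _ fun p hpp => ?_
      rw [uIoc_of_le hp.le] at hpp
      have := hK2 n q p ⟨hpp.1.le, hpp.2⟩
      rw [Pi.mul_apply, Pi.mul_apply, Real.norm_eq_abs, abs_mul]
      exact mul_le_mul this this (abs_nonneg _) ((abs_nonneg _).trans this)
    · have : ∀ᵐ p : ℝ, p ≠ 0 := by simp [ae_iff]
      filter_upwards [this] with p hp0 hpp
      rw [uIoc_of_le hp.le] at hpp
      have := hl q p ⟨hpp.1, lt_of_le_of_ne hpp.2 hp0⟩
      exact this.mul this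
  have : Tendsto (fun n => JJ p0 q0 (F n * F n)) atTop (𝓝 (JJ p0 q0 (f * f))) := by
    refine tendsto_integral_of_dominated_convergence (fun q => om (q - q0) * (K * K * |0 - p0|)) ?_
      ?_ ?_ ?_
    · exact fun n => (((hF n).mul (hF n)).Jint p0 q0).aestronglyMeasurable
    · exact (om_int q0).mul_const _
    · refine fun n => ae_of_all _ fun q => ?_
      rw [norm_mul, Real.norm_eq_abs, abs_of_pos (om_pos _)]
      refine mul_le_mul_of_nonneg_left ?_ (om_pos _).le
      refine intervalIntegral.norm_integral_le_of_norm_le_const fun p hpp => ?_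
      rw [uIoc_of_le hp.le] at hpp
      have := hK2 n q p ⟨hpp.1.le, hpp.2⟩
      rw [Pi.mul_apply, Pi.mul_apply, Real.norm_eq_abs, abs_mul]
      exact mul_le_mul this this (abs_nonneg _) ((abs_nonneg _).trans this)
    · exact ae_of_all _ fun q => (hin q).const_mul _
  exact le_of_tendsto' this fun n => h n q0

/-- q-derivative on the open strip -/
def QD (p0 : ℝ) (f fq : ℝ → ℝ → ℝ) : Prop :=
  ∀ p ∈ Ioo p0 0, ∀ q, HasDerivAt (fun q => f q p) (fq q p) q

theorem QD.DD {p0 f fq} (h : QD p0 f fq) (t : ℝ) : QD p0 (DD t f) (DD t fq) := fun p hp q =>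
  (((h p hp (q + t)).comp_add_const q t).sub (h p hp q)).div_const t
theorem QD.DL {p0 f fq} (h : QD p0 f fq) (ts : List ℝ) : QD p0 (DL ts f) (DL ts fq) := by
  induction ts generalizing f fq with
  | nil => exact h
  | cons s ts ih => exact ih (h.DD s)

theorem QD.mv {p0 f fq} (h : QD p0 f fq) {p} (hp : p ∈ Ioo p0 0) (q : ℝ) {s : ℝ} (hs : 0 < s) :
    ∃ ξ ∈ Ioo q (q + s), fq ξ p = _root_.DD s f q p := by
  obtain ⟨c, hc, e⟩ := exists_hasDerivAt_eq_slope (fun q => f q p) (fun q => fq q p)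
    (show q < q + s by linarith)
    (fun x _ => (h p hp x).continuousAt.continuousWithinAt) (fun x _ => h p hp x)
  exact ⟨c, hc, by rw [e, _root_.DD]; congr 1; ring⟩

theorem LB.qlim {p0 τ M : ℝ} {f fq : ℝ → ℝ → ℝ} (hp : p0 < 0) (hτ : 0 < τ) (hf : CB f)
    (hfq : CB fq) (h : QD p0 f fq) (hl : ∀ s ∈ Ioc 0 τ, LB p0 (DD s f) M) : LB p0 fq M := by
  obtain ⟨_, K, hK⟩ := id hfq
  have hpos : ∀ n : ℕ, 0 < τ / (n + 1) := fun n => by positivity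
  refine LB.lim hp hfq (F := fun n => DD (τ / (n + 1)) f) (K := K) (fun n => hf.DD _) ?_ ?_ ?_
  · intro n q p hpp
    obtain ⟨ξ, _, e⟩ := h.mv hpp q (hpos n)
    rw [← e]; exact hK _ _
  · intro q p hpp
    have h1 := hasDerivAt_iff_tendsto_slope_zero.mp (h p hpp q)
    have h2 : Tendsto (fun n : ℕ => τ / ((n : ℝ) + 1)) atTop (𝓝[≠] 0) := by
      refine tendsto_nhdsWithin_iff.mpr ⟨?_, Eventually.of_forall fun n => (hpos n).ne'⟩
      have := (tendsto_one_div_add_atTop_nhds_zero_nat (𝕜 := ℝ)).const_mul τ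
      simpa [div_eq_mul_inv] using this
    refine (h1.comp h2).congr fun n => ?_
    simp only [Function.comp, DD, smul_eq_mul]; rw [div_eq_inv_mul _ (τ / _)]
  · intro n
    refine hl _ ⟨hpos n, div_le_self hτ.le ?_⟩
    have : (0:ℝ) ≤ n := Nat.cast_nonneg n
    linarith

theorem DD_half {t : ℝ} (ht : t ≠ 0) (f) :
    DD t f = cst (1/2) * (DD (t/2) f + sh (t/2) (DD (t/2) f)) := by
  funext q p
  simp only [DD, Pi.mul_apply, Pi.add_apply, sh, cst]
  rw [show q + t / 2 + t / 2 = q + t by ring]; field_simp; ring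

theorem LB.jensen {p0 M K : ℝ} {f fq : ℝ → ℝ → ℝ} (hp : p0 < 0) (hM : 0 ≤ M) (hf : CB f)
    (hfq : CB fq) (h : QD p0 f fq) (hK : ∀ s > 0, ∀ q p, |DD s fq q p| ≤ K) (hl : LB p0 fq M)
    {t : ℝ} (ht : 0 < t) : LB p0 (DD t f) M := by
  have hK0 : 0 ≤ K := (abs_nonneg _).trans (hK 1 one_pos 0 0)
  set S := Real.sqrt (JJ p0 0 (cst 1)) with hS
  have hS0 : 0 ≤ S := Real.sqrt_nonneg _
  have h1 : ∀ s > 0, LB p0 (DD s f) (M + K * s * S) := by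
    intro s hs
    have hd : CB (DD s f - fq) := (hf.DD s).sub hfq
    have e : DD s f = fq + (DD s f - fq) := by ring
    rw [e]
    refine hl.add hp hfq hd (LB.of_bdd hp hd (icc_of_ioo hp hd fun q p hpp => ?_)) hM (by positivity)
    obtain ⟨ξ, hξ, e⟩ := h.mv hpp q hs
    have h2 := hK (ξ - q) (by linarith [hξ.1]) q p
    have h3 : 0 < ξ - q := by linarith [hξ.1]
    rw [Pi.sub_apply, Pi.sub_apply, ← e]
    rw [DD, abs_div, abs_of_pos h3, div_le_iff₀ h3, show q + (ξ - q) = ξ by ring] at h2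
    refine h2.trans ?_
    gcongr; linarith [hξ.2]
  have h2 : ∀ n : ℕ, ∀ s > 0, LB p0 (DD s f) (M + K * (s / 2 ^ n) * S) := by
    intro n
    induction n with
    | zero => intro s hs; simpa using h1 s hs
    | succ n ih =>
      intro s hs
      have i := ih (s / 2) (by positivity)
      have nn : 0 ≤ M + K * (s / 2 / 2 ^ n) * S := by positivity
      have := (i.add hp (hf.DD _) ((hf.DD _).sh _) (i.sh (s / 2)) nn nn).cmul (1/2)
      rw [← DD_half hs.ne'] at this
      convert this using 1
      rw [abs_of_pos (by norm_num), pow_succ]; field_simp; ring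
  intro q0
  have lim : Tendsto (fun n : ℕ => (M + K * (t / 2 ^ n) * S) ^ 2) atTop
      (𝓝 ((M + K * 0 * S) ^ 2)) := by
    have : Tendsto (fun n : ℕ => t / 2 ^ n) atTop (𝓝 0) :=
      tendsto_const_nhds.div_atTop (tendsto_pow_atTop_atTop_of_one_lt (by norm_num))
    exact (((this.const_mul K).mul_const S).const_add M).pow 2
  have := ge_of_tendsto' lim fun n => h2 n t ht q0
  simpa using this

structure WFlow (p0 d Q K δ : ℝ) (Y Uq : ℝ → ℝ → ℝ) (W Wp : Fin 4 → ℝ → ℝ → ℝ)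
    (rh bb cc : ℝ → ℝ) : Prop where
  hp : p0 < 0
  hδ : 0 < δ
  hK : 1 ≤ K
  pY : PD p0 Y (W 3)
  pW : ∀ i, PD p0 (W i) (Wp i)
  cUq : CB Uq
  qY : QD p0 Y (W 2)
  qU : QD p0 (W 0) Uq
  qga : QD p0 (W 3) (Wp 2)
  gaV : W 3 * W 1 = cst 1
  alV : W 2 * W 1 = W 0
  Vpos : ∀ q p, δ ≤ W 1 q p
  eq2 : ∀ q, ∀ p ∈ Ioo p0 0, W 0 q p * Wp 0 q p + W 1 q p * Wp 1 q p =
    Uq q p - (cc p * Y q p + bb p)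
  rhc : Continuous rh
  ccc : Continuous cc
  bbc : Continuous bb
  rhd : ∀ p ∈ Ioo p0 0, HasDerivAt rh (cc p) p
  top : ∀ q, W 0 q 0 ^ 2 + W 1 q 0 ^ 2 + 2 * (Y q 0 + d) * rh 0 = Q
  bot : ∀ q, Y q p0 = -d
  bW : ∀ i q p, |W i q p| ≤ K
  bWp : ∀ i q p, |Wp i q p| ≤ K
  bUq : ∀ q p, |Uq q p| ≤ K
  brh : ∀ p, |rh p| ≤ K
  bcc : ∀ p, |cc p| ≤ K
  lip : ∀ i, ∀ s > 0, ∀ q p, |DD s (W i) q p| ≤ K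

theorem DL_congr {f g : ℝ → ℝ → ℝ} {p : ℝ} (h : ∀ q, f q p = g q p) (ts : List ℝ) (q : ℝ) :
    DL ts f q p = DL ts g q p := by
  induction ts generalizing f g with
  | nil => exact h q
  | cons s ts ih => exact ih fun q => by simp only [DD, h]

theorem DL_zero {f : ℝ → ℝ → ℝ} {p c : ℝ} (h : ∀ q, f q p = c) {ts : List ℝ} (hne : ts ≠ [])
    (q : ℝ) : DL ts f q p = 0 := by
  match ts, hne with
  | s :: ts, _ =>
    have : ∀ (ts : List ℝ) q, DL ts (0 : ℝ → ℝ → ℝ) q p = 0 := by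
      intro ts
      induction ts with
      | nil => exact fun q => rfl
      | cons s ts ih => intro q; rw [DL_cons, DD, ih, ih]; simp
    have e : ∀ q, DD s f q p = (0 : ℝ → ℝ → ℝ) q p := fun q => by simp [DD, h]
    rw [DL, DL_congr e, this]

theorem DL_pmul (c : ℝ → ℝ) (f : ℝ → ℝ → ℝ) (ts : List ℝ) :
    DL ts ((fun _ p => c p) * f) = (fun _ p => c p) * DL ts f := by
  induction ts generalizing f with
  | nil => rfl
  | cons s ts ih =>
    have : DD s ((fun _ p => c p) * f) = (fun _ p => c p) * DD s f := by
      funext q p; simp only [DD, Pi.mul_apply]; ring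
    rw [DL, this, ih]; rfl

end

section

open MeasureTheory Filter Topology

section
variable {p0 d Q K δ : ℝ} {Y Uq : ℝ → ℝ → ℝ} {W Wp : Fin 4 → ℝ → ℝ → ℝ} {rh bb cc : ℝ → ℝ}

def pf (c : ℝ → ℝ) : ℝ → ℝ → ℝ := fun _ p => c p

theorem CB.pf {c : ℝ → ℝ} (hc : Continuous c) {K : ℝ} (hK : ∀ p, |c p| ≤ K) : CB (pf c) :=
  ⟨hc.comp continuous_snd, K, fun _ p => hK p⟩

/-- p-identity -/
theorem WFlow.id1 (h : WFlow p0 d Q K δ Y Uq W Wp rh bb cc) {L : List ℝ} (hL : L ≠ []) (q : ℝ) :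
    ∫ p in p0..0, (DL L Uq * DL L Y + cst (1/2) * DL L (W 0 * W 0 + W 1 * W 1) * DL L (W 3)
      + cst 2 * pf rh * DL L Y * DL L (W 3)) q p = 0 := by
  set E2 := W 0 * W 0 + W 1 * W 1 with hE2
  have pE := (((h.pW 0).mul (h.pW 0)).add ((h.pW 1).mul (h.pW 1))).DL L
  rw [← hE2] at pE
  have pw := h.pY.DL L
  have crh := CB.pf h.rhc h.brh
  set F : ℝ → ℝ := fun p => 1/2 * DL L E2 q p * DL L Y q p + rh p * DL L Y q p ^ 2 with hF
  have key : ∫ p in p0..0, (DL L Uq * DL L Y + cst (1/2) * DL L E2 * DL L (W 3)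
      + cst 2 * pf rh * DL L Y * DL L (W 3)) q p = F 0 - F p0 := by
    refine intervalIntegral.integral_eq_sub_of_hasDerivAt_of_le h.hp.le ?_ ?_ ?_
    · have := pE.1.cont_p q
      have := pw.1.cont_p q
      have := h.rhc
      exact Continuous.continuousOn (by fun_prop)
    · intro p hp
      have d1 := pE.2.2 q p hp
      have d2 := pw.2.2 q p hp
      have d3 := h.rhd p hp
      have := ((d1.const_mul (1/2)).mul d2).add (d3.mul (d2.pow 2))
      refine this.congr_deriv ?_
      have e1 : DL L (Wp 0 * W 0 + W 0 * Wp 0 + (Wp 1 * W 1 + W 1 * Wp 1)) q p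
          = 2 * (DL L Uq q p - cc p * DL L Y q p) := by
        have c1 : ∀ q, (Wp 0 * W 0 + W 0 * Wp 0 + (Wp 1 * W 1 + W 1 * Wp 1)) q p
            = ((fun _ p => 2) * (Uq - (fun _ p => cc p) * Y - (fun _ p => bb p)) :
              ℝ → ℝ → ℝ) q p := fun q => by
          have := h.eq2 q p hp
          simp only [Pi.add_apply, Pi.mul_apply, Pi.sub_apply]
          linarith
        rw [DL_congr c1, DL_pmul (fun _ => 2), DL_sub, DL_sub, DL_pmul]
        simp only [Pi.mul_apply, Pi.sub_apply]
        rw [DL_zero (f := fun _ p => bb p) (p := p) (c := bb p) (fun _ => rfl) hL]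
        ring
      rw [e1]
      simp only [Pi.add_apply, Pi.mul_apply, cst, pf, Nat.cast_ofNat, Pi.pow_apply]
      ring
    · have c1 := (h.cUq.DL L).mul pw.1
      have c2 := ((CB.cst (1/2)).mul pE.1).mul pw.2.1
      have c3 := (((CB.cst 2).mul crh).mul pw.1).mul pw.2.1
      exact ((c1.add c2).add c3).ii q _ _
  rw [key]
  have z1 : DL L Y q p0 = 0 := DL_zero h.bot hL q
  have z2 : DL L E2 q 0 + 2 * rh 0 * DL L Y q 0 = 0 := by
    have c1 : ∀ q, (E2 + (fun _ p => 2 * rh p) * Y : ℝ → ℝ → ℝ) q 0 = Q - 2 * d * rh 0 := fun q => by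
      have := h.top q
      simp only [hE2, Pi.add_apply, Pi.mul_apply]
      linarith
    have := DL_zero c1 hL q
    rwa [DL_add, DL_pmul] at this
  simp only [hF, z1]
  linear_combination (1/2 * DL L Y q 0) * z2

theorem om_deriv (x : ℝ) : HasDerivAt om (-(2 * x) / (1 + x ^ 2) ^ 2) x := by
  have h : HasDerivAt (fun x : ℝ => 1 + x ^ 2) (2 * x) x := by
    simpa using (hasDerivAt_pow 2 x).const_add 1
  exact h.inv (by positivity)

theorem om_deriv_le (x : ℝ) : |-(2 * x) / (1 + x ^ 2) ^ 2| ≤ om x := by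
  have h0 : 0 < 1 + x ^ 2 := by positivity
  rw [om, abs_div, abs_of_pos (pow_pos h0 2), div_le_iff₀ (pow_pos h0 2)]
  have : (1 + x ^ 2)⁻¹ * (1 + x ^ 2) ^ 2 = 1 + x ^ 2 := by field_simp
  rw [this, abs_neg, abs_le]
  constructor <;> nlinarith [sq_nonneg (x - 1), sq_nonneg (x + 1)]

/-- q-integration by parts -/
theorem ibp_q {u uq w wq : ℝ → ℝ → ℝ} (hp : p0 < 0) (cu : CB u) (cuq : CB uq) (cw : CB w)
    (cwq : CB wq) (hu : QD p0 u uq) (hw : QD p0 w wq) (q0 : ℝ) {e : ℝ → ℝ → ℝ} (ce : CB e)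
    (hbd : ∀ q p, |u q p * w q p| ≤ e q p) :
    JJ p0 q0 (u * wq) + JJ p0 q0 (uq * w) ≤ JJ p0 q0 e := by
  have cm := cu.mul cw
  have cm' := (cuq.mul cw).add (cu.mul cwq)
  set m : ℝ → ℝ := fun q => ∫ p in p0..0, (u * w) q p with hm
  set m' : ℝ → ℝ := fun q => ∫ p in p0..0, (uq * w + u * wq) q p with hm'
  have hd : ∀ q, HasDerivAt m (m' q) q := by
    intro q
    obtain ⟨_, B, hB⟩ := id cm'
    refine (intervalIntegral.hasDerivAt_integral_of_dominated_loc_of_deriv_le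
      (F := fun q p => (u * w) q p) (F' := fun q p => (uq * w + u * wq) q p)
      (bound := fun _ => B) (s := univ) univ_mem ?_ (cm.ii q _ _) ?_ ?_ (by simp) ?_).2
    · exact Eventually.of_forall fun x => (cm.cont_p x).aestronglyMeasurable
    · exact (cm'.cont_p q).aestronglyMeasurable
    · exact ae_of_all _ fun p _ x _ => hB x p
    · have : ∀ᵐ p : ℝ, p ≠ 0 := by simp [ae_iff]
      filter_upwards [this] with p hp0 hpp x _
      rw [uIoc_of_le hp.le] at hpp
      have hpp' : p ∈ Ioo p0 0 := ⟨hpp.1, lt_of_le_of_ne hpp.2 hp0⟩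
      exact (hu p hpp' x).mul (hw p hpp' x)
  set o' : ℝ → ℝ := fun q => -(2 * (q - q0)) / (1 + (q - q0) ^ 2) ^ 2 with ho'
  have co' : Continuous o' := by
    refine Continuous.div (by fun_prop) (by fun_prop) fun q => by positivity
  have hd2 : ∀ q, HasDerivAt (fun q => om (q - q0) * m q) (o' q * m q + om (q - q0) * m' q) q :=
    fun q => ((om_deriv (q - q0)).comp_sub_const q q0).mul (hd q)
  have cmm : Continuous m := cm.cont_int p0
  have i1 : Integrable fun q => om (q - q0) * m' q := cm'.Jint p0 q0
  have i2 : Integrable fun q => o' q * m q := by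
    refine (cm.Jint p0 q0).mono (co'.mul cmm).aestronglyMeasurable (ae_of_all _ fun q => ?_)
    rw [norm_mul, norm_mul]
    refine mul_le_mul_of_nonneg_right ?_ (norm_nonneg _)
    rw [Real.norm_eq_abs, Real.norm_eq_abs, abs_of_pos (om_pos _)]
    exact om_deriv_le _
  have hz := integral_eq_zero_of_hasDerivAt_of_integrable hd2 (i2.add i1) (cm.Jint p0 q0)
  rw [integral_add i2 i1] at hz
  have e1 : ∫ q, om (q - q0) * m' q = JJ p0 q0 (uq * w) + JJ p0 q0 (u * wq) := by
    rw [← JJ_add (cuq.mul cw) (cu.mul cwq)]; rfl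
  have e2 : -∫ q, o' q * m q ≤ JJ p0 q0 e := by
    rw [← integral_neg]
    refine integral_mono i2.neg (ce.Jint p0 q0) fun q => ?_
    simp only
    have h1 : |m q| ≤ ∫ p in p0..0, e q p := by
      refine (intervalIntegral.abs_integral_le_integral_abs hp.le).trans ?_
      exact intervalIntegral.integral_mono_on hp.le ((cm.cont_p q).abs.intervalIntegrable _ _)
        (ce.ii _ _ _) fun p _ => hbd q p
    calc -(o' q * m q) ≤ |o' q * m q| := neg_le_abs _
      _ = |o' q| * |m q| := abs_mul _ _
      _ ≤ om (q - q0) * ∫ p in p0..0, e q p :=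
        mul_le_mul (om_deriv_le _) h1 (abs_nonneg _) (om_pos _).le
  linarith
end

end

section

open MeasureTheory Filter Topology

section
variable {p0 d Q K δ : ℝ} {Y Uq : ℝ → ℝ → ℝ} {W Wp : Fin 4 → ℝ → ℝ → ℝ} {rh bb cc : ℝ → ℝ}

theorem DL_mul (L : List ℝ) (f g : ℝ → ℝ → ℝ) :
    DL L (f * g) = f * DL L g + DL L f * sh L.sum g + Rem L f g := by
  rw [Rem]; ring

theorem WFlow.VR (h : WFlow p0 d Q K δ Y Uq W Wp rh bb cc) {L : List ℝ} (hL : L ≠ []) :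
    W 3 * DL L (W 1) + DL L (W 3) * sh L.sum (W 1) + Rem L (W 3) (W 1) = 0 := by
  rw [← DL_mul, h.gaV]
  funext q p
  exact DL_zero (c := 1) (fun _ => rfl) hL q

theorem WFlow.DV (h : WFlow p0 d Q K δ Y Uq W Wp rh bb cc) {L : List ℝ} (hL : L ≠ []) :
    DL L (W 1) = -(W 1 * (sh L.sum (W 1) * DL L (W 3) + Rem L (W 3) (W 1))) := by
  have e1 := h.VR hL
  have e2 := h.gaV
  have e3 : cst 1 = 1 := rfl
  rw [e3] at e2
  linear_combination W 1 * e1 - DL L (W 1) * e2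

theorem WFlow.DU (h : WFlow p0 d Q K δ Y Uq W Wp rh bb cc) (L : List ℝ) :
    DL L (W 0) = W 2 * DL L (W 1) + (sh L.sum (W 1) * DL L (W 2) + Rem L (W 2) (W 1)) := by
  conv_lhs => rw [← h.alV]
  rw [DL_mul]; ring

theorem WFlow.shd (h : WFlow p0 d Q K δ Y Uq W Wp rh bb cc) (i : Fin 4) {s : ℝ} (hs : 0 < s)
    (q p : ℝ) : |sh s (W i) q p - W i q p| ≤ K * s := by
  have := h.lip i s hs q p
  rwa [DD, abs_div, abs_of_pos hs, div_le_iff₀ hs] at this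

theorem sum_pos' {L : List ℝ} (hL : L ≠ []) (h : ∀ t ∈ L, 0 < t) : 0 < L.sum :=
  List.sum_pos L h hL

theorem WFlow.energy (h : WFlow p0 d Q K δ Y Uq W Wp rh bb cc) : ∃ τ > 0, ∃ C ≥ 1,
    ∀ L : List ℝ, L ≠ [] → (∀ t ∈ L, 0 < t) → L.sum ≤ τ → ∀ r ≥ 0,
    LB p0 (Rem L (W 3) (W 1)) r → LB p0 (Rem L (W 2) (W 1)) r → LB p0 (Rem L (W 0) (W 0)) r →
    LB p0 (Rem L (W 1) (W 1)) r → LB p0 (DL L Y) r → ∀ i, LB p0 (DL L (W i)) (C * r) := by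
  have hp := h.hp
  have hK := h.hK
  obtain ⟨ε, hε, hε1, c, hc, C, hC, hq⟩ := quad_lem h.hK h.hδ
  set C2 := Real.sqrt (5 * C / c) with hC2
  have hC20 : 0 ≤ C2 := Real.sqrt_nonneg _
  refine ⟨ε / K, by positivity, C2 + K * (K * C2 + 1) + (K * (K * (K * C2 + 1)) + (K * C2 + 1)), ?_,
    ?_⟩
  · have : 0 ≤ K * (K * C2 + 1) := by positivity
    have : 0 ≤ K * (K * (K * C2 + 1)) := by positivity
    have : 0 ≤ K * C2 := by positivity
    linarith
  intro L hL hLp hLs r hr r1 r2 r3 r4 hw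
  have hs : 0 < L.sum := sum_pos' hL hLp
  have hsε : K * L.sum ≤ ε := by
    rw [le_div_iff₀ (by positivity)] at hLs; linarith
  have cW := fun i => (h.pW i).1
  have cY := h.pY.1.DL L
  have cD := fun i => (cW i).DL L
  have cS1 := (cW 1).sh L.sum
  set A := DL L (W 2) with hA
  set G := DL L (W 3) with hG
  set w := DL L Y with hw'
  set R1 := Rem L (W 3) (W 1) with hR1
  set R2 := Rem L (W 2) (W 1) with hR2
  set R3 := Rem L (W 0) (W 0) with hR3
  set R4 := Rem L (W 1) (W 1) with hR4
  have cR1 : CB R1 := (cW 3).Rem (cW 1) L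
  have cR2 : CB R2 := (cW 2).Rem (cW 1) L
  have cR3 : CB R3 := (cW 0).Rem (cW 0) L
  have cR4 : CB R4 := (cW 1).Rem (cW 1) L
  have hDV := h.DV hL
  have hDU := h.DU L
  set e : ℝ → ℝ → ℝ := fun q p => |DL L (W 0) q p * w q p| with he
  have ce : CB e := by
    obtain ⟨a, B, hB⟩ := (cD 0).mul cY
    exact ⟨a.abs, B, fun q p => by simpa [he] using hB q p⟩
  set DE := DL L (W 0 * W 0 + W 1 * W 1) with hDE
  have cDE : CB DE := (((cW 0).mul (cW 0)).add ((cW 1).mul (cW 1))).DL L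
  set F2 := cst (1/2) * DE * G with hF2
  set F3 := cst 2 * pf rh * w * G with hF3
  set F5 := R1 * R1 + R2 * R2 + R3 * R3 + R4 * R4 + w * w with hF5
  have cF2 : CB F2 := ((CB.cst (1/2)).mul cDE).mul (cD 3)
  have cF3 : CB F3 := (((CB.cst 2).mul (CB.pf h.rhc h.brh)).mul cY).mul (cD 3)
  have c11 := cR1.mul cR1
  have c22 := cR2.mul cR2
  have c33 := cR3.mul cR3
  have c44 := cR4.mul cR4
  have cww := cY.mul cY
  have cF5 : CB F5 := (((c11.add c22).add c33).add c44).add cww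
  have cAA := (cD 2).mul (cD 2)
  have cGG := (cD 3).mul (cD 3)
  have key : ∀ q0, c * (JJ p0 q0 (A * A) + JJ p0 q0 (G * G)) ≤ C * (5 * r ^ 2) := by
    intro q0
    have m1 : JJ p0 q0 (cst c * (A * A + G * G) + F2 + F3 + e) ≤
        JJ p0 q0 (DL L (W 0) * A + cst C * F5) := by
      refine JJ_mono (((((CB.cst _).mul (cAA.add cGG)).add cF2).add cF3).add ce)
        (((cD 0).mul (cD 2)).add ((CB.cst _).mul cF5)) hp q0 fun q p _ => ?_
      have := hq (W 0 q p) (W 1 q p) (sh L.sum (W 1) q p) (sh L.sum (W 0) q p) (A q p) (G q p)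
        (R1 q p) (R2 q p) (R3 q p) (R4 q p) (w q p) (rh p) (DL L (W 0) q p) (DL L (W 1) q p)
        (DE q p) (h.bW 0 q p) (h.bW 1 q p) (h.Vpos q p) (h.bW 1 _ p)
        ((h.shd 1 hs q p).trans hsε) ((h.shd 0 hs q p).trans hsε) (h.brh p) ?_ ?_ ?_
      · simp only [Pi.add_apply, Pi.mul_apply, cst, pf, hF2, hF3, hF5, he]
        linarith
      · rw [hDV]; simp only [Pi.neg_apply, Pi.mul_apply, Pi.add_apply]; ring
      · rw [hDU, hDV]; simp only [Pi.neg_apply, Pi.mul_apply, Pi.add_apply]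
        have := congrFun (congrFun h.alV q) p
        rw [Pi.mul_apply, Pi.mul_apply] at this
        rw [← this]; ring
      · rw [hDE, DL_add, DL_mul, DL_mul]; simp only [Pi.mul_apply, Pi.add_apply]; ring
    rw [JJ_add ((((CB.cst _).mul (cAA.add cGG)).add cF2).add cF3) ce,
      JJ_add (((CB.cst _).mul (cAA.add cGG)).add cF2) cF3,
      JJ_add ((CB.cst _).mul (cAA.add cGG)) cF2, JJ_cmul, JJ_add cAA cGG,
      JJ_add ((cD 0).mul (cD 2)) ((CB.cst _).mul cF5), JJ_cmul] at m1
    have m2 := ibp_q hp (cD 0) (h.cUq.DL L) cY (cD 2) (h.qU.DL L) (h.qY.DL L) q0 ce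
      (fun q p => le_rfl)
    have m3 : JJ p0 q0 (DL L Uq * w + F2 + F3) = 0 := by
      rw [JJ]
      simp only [hF2, hF3, hDE, hG, hw']
      simp only [h.id1 hL, mul_zero, integral_zero]
    rw [JJ_add (((h.cUq.DL L).mul cY).add cF2) cF3, JJ_add ((h.cUq.DL L).mul cY) cF2] at m3
    have m4 : JJ p0 q0 F5 ≤ 5 * r ^ 2 := by
      rw [hF5, JJ_add (((c11.add c22).add c33).add c44) cww, JJ_add ((c11.add c22).add c33) c44,
        JJ_add (c11.add c22) c33, JJ_add c11 c22]
      linarith [r1 q0, r2 q0, r3 q0, r4 q0, hw q0]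
    have m5 := mul_le_mul_of_nonneg_left m4 hC
    linarith
  have nnJ : ∀ {f : ℝ → ℝ → ℝ} (q0 : ℝ), 0 ≤ JJ p0 q0 (f * f) := fun {f} q0 =>
    integral_nonneg fun q => mul_nonneg (om_pos _).le
      (intervalIntegral.integral_nonneg hp.le fun p _ => mul_self_nonneg _)
  have sq : (C2 * r) ^ 2 = C * (5 * r ^ 2) / c := by
    rw [mul_pow, hC2, Real.sq_sqrt (by positivity)]; ring
  have lA : LB p0 A (C2 * r) := fun q0 => by
    rw [sq, le_div_iff₀ hc]
    have := mul_nonneg hc.le (nnJ (f := G) q0)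
    linarith [key q0]
  have lG : LB p0 G (C2 * r) := fun q0 => by
    rw [sq, le_div_iff₀ hc]
    have := mul_nonneg hc.le (nnJ (f := A) q0)
    linarith [key q0]
  have hr2 : 0 ≤ C2 * r := by positivity
  have hKr : 0 ≤ K * (C2 * r) := by positivity
  have bS : ∀ q, ∀ p ∈ Icc p0 0, |sh L.sum (W 1) q p| ≤ K := fun q p _ => h.bW 1 _ p
  have lV : LB p0 (DL L (W 1)) (K * (K * (C2 * r) + r)) := by
    rw [hDV]
    refine LB.neg (LB.bmul hp (cW 1) ((cS1.mul (cD 3)).add cR1) ?_ fun q p _ => h.bW 1 q p)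
    exact (lG.bmul hp cS1 (cD 3) bS).add hp (cS1.mul (cD 3)) cR1 r1 hKr hr
  have hKr2 : 0 ≤ K * (K * (C2 * r) + r) := by positivity
  have hKr3 : 0 ≤ K * (K * (K * (C2 * r) + r)) := by positivity
  have lU : LB p0 (DL L (W 0)) (K * (K * (K * (C2 * r) + r)) + (K * (C2 * r) + r)) := by
    rw [hDU]
    refine LB.add hp ((cW 2).mul (cD 1)) ((cS1.mul (cD 2)).add cR2)
      (lV.bmul hp (cW 2) (cD 1) fun q p _ => h.bW 2 q p) ?_ hKr3 (by positivity)
    exact (lA.bmul hp cS1 (cD 2) bS).add hp (cS1.mul (cD 2)) cR2 r2 hKr hr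
  intro i
  fin_cases i
  · exact lU.mono (by positivity) (by linarith)
  · exact lV.mono (by positivity) (by linarith)
  · exact lA.mono (by positivity) (by linarith)
  · exact lG.mono (by positivity) (by linarith)
end

end

section

open MeasureTheory Filter Topology

structure LC (p0 : ℝ) (f : ℝ → ℝ → ℝ) (M : ℝ) : Prop where
  c : CB f
  nn : 0 ≤ M
  lb : LB p0 f M

theorem LC.sh {p0 f M} (h : LC p0 f M) (t) : LC p0 (sh t f) M := ⟨h.c.sh t, h.nn, h.lb.sh t⟩
theorem LC.mono {p0 f M N} (h : LC p0 f M) (e : M ≤ N) : LC p0 f N :=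
  ⟨h.c, h.nn.trans e, h.lb.mono h.nn e⟩
theorem LC.add {p0 f g M N} (hp : p0 < 0) (h : LC p0 f M) (k : LC p0 g N) :
    LC p0 (f + g) (M + N) :=
  ⟨h.c.add k.c, add_nonneg h.nn k.nn, h.lb.add hp h.c k.c k.lb h.nn k.nn⟩
theorem LC.bm {p0 f g K M} (hp : p0 < 0) (cf : CB f) (hb : ∀ q p, |f q p| ≤ K) (k : LC p0 g M) :
    LC p0 (f * g) (K * M) :=
  ⟨cf.mul k.c, mul_nonneg ((abs_nonneg _).trans (hb 0 0)) k.nn,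
    k.lb.bmul hp cf k.c fun q p _ => hb q p⟩
theorem LC.mb {p0 f g K M} (hp : p0 < 0) (cf : CB f) (hb : ∀ q p, |f q p| ≤ K) (k : LC p0 g M) :
    LC p0 (g * f) (K * M) := by rw [mul_comm]; exact k.bm hp cf hb
theorem LC.flip {p0 f g M} (h : ∀ u, LC p0 (f * _root_.sh u g) M) (u : ℝ) :
    LC p0 (g * _root_.sh u f) M := by
  have := (h (-u)).sh u
  rwa [sh_mul', sh_sh, add_neg_cancel, sh_zero, mul_comm] at this
theorem LC.of_bdd {p0 f K} (hp : p0 < 0) (cf : CB f) (hb : ∀ q p, |f q p| ≤ K) :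
    LC p0 f (K * Real.sqrt (JJ p0 0 (cst 1))) :=
  ⟨cf, mul_nonneg ((abs_nonneg _).trans (hb 0 0)) (Real.sqrt_nonneg _),
    LB.of_bdd hp cf fun q p _ => hb q p⟩

theorem LC.sum {p0 r : ℝ} (hp : p0 < 0) : ∀ (n : ℕ) (f : Fin n → ℝ → ℝ → ℝ),
    (∀ i, LC p0 (f i) r) → LC p0 (∑ i, f i) (n * r)
  | 0, f, _ => by
    simp only [Finset.univ_eq_empty, Finset.sum_empty, Nat.cast_zero, zero_mul]
    exact ⟨⟨continuous_const, 0, fun q p => by simp⟩, le_rfl, fun q0 => by simp [JJ]⟩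
  | n + 1, f, h => by
    rw [Fin.sum_univ_succ]
    exact ((h 0).add hp (LC.sum hp n _ fun i => h i.succ)).mono (by push_cast; linarith)

theorem LC.abs {p0 f M} (hp : p0 < 0) (h : LC p0 f M) : LC p0 (fun q p => |f q p|) M := by
  have c : CB (fun q p => |f q p|) := by
    obtain ⟨a, B, hB⟩ := h.c
    exact ⟨a.abs, B, fun q p => by simpa using hB q p⟩
  exact ⟨c, h.nn, h.lb.of_le hp c h.c fun q p _ => by simp⟩

theorem LC.dom {p0 r C : ℝ} (hp : p0 < 0) (hC : 0 ≤ C) {n : ℕ} (f : Fin n → ℝ → ℝ → ℝ)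
    (h : ∀ i, LC p0 (f i) r) {F} (cF : CB F)
    (hF' : ∀ q, ∀ p ∈ Ioo p0 0, |F q p| ≤ C * ∑ i, |f i q p|) : LC p0 F (C * (n * r)) := by
  have hF : ∀ q, ∀ p ∈ Icc p0 0, |F q p| ≤ C * ∑ i, |f i q p| := by
    intro q p hpp
    rw [← closure_Ioo hp.ne] at hpp
    exact closure_minimal (s := Ioo p0 0) (t := {p | |F q p| ≤ C * ∑ i, |f i q p|})
      (fun x hx => hF' q x hx) (isClosed_le (cF.cont_p q).abs (continuous_const.mul
      (continuous_finset_sum _ fun i _ => ((h i).c.cont_p q).abs))) hpp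
  have a := (LC.sum hp n _ fun i => (h i).abs hp)
  have b := a.bm (K := C) hp (CB.cst C) (fun q p => by simp [cst, abs_of_nonneg hC])
  refine ⟨cF, b.nn, LB.of_le hp cF b.c b.lb fun q p hpp => (hF q p hpp).trans (le_of_eq ?_)⟩
  simp only [Pi.mul_apply, cst, Finset.sum_apply]
  rw [abs_of_nonneg (mul_nonneg hC (Finset.sum_nonneg fun i _ => abs_nonneg _))]

theorem ab2 (a b : ℝ) {A B : ℝ} (ha : |a| ≤ A) (hb : |b| ≤ B) : |a * b| ≤ A * B := by
  rw [abs_mul]; exact mul_le_mul ha hb (abs_nonneg _) ((abs_nonneg _).trans ha)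

set_option maxHeartbeats 1000000 in
theorem R_pt {K δ : ℝ} (hK : 1 ≤ K) (hδ : 0 < δ) (U V Us Vs al ga alp gap Up Vp Ups Vps c : ℝ)
    (x y a b DU DV Da Dg Uq w R31 R21 R00 R11 S : ℝ)
    (bal : |al| ≤ K) (bga : |ga| ≤ K) (balp : |alp| ≤ K) (bgap : |gap| ≤ K) (bUp : |Up| ≤ K)
    (bVp : |Vp| ≤ K) (bUps : |Ups| ≤ K) (bVps : |Vps| ≤ K) (bc : |c| ≤ K) (bU : |U| ≤ K)
    (bUs : |Us| ≤ K) (bVs : |Vs| ≤ K) 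
    (hV : δ ≤ V) (hVs : δ ≤ Vs) (hU : U = al * V) (hUs : K * |Us - U| ≤ δ)
    (hS : S = |DU| + |DV| + |Da| + |Dg| + |a| + |Uq| + |w| + |R31| + |R21| + |R00| + |R11|)
    (e1 : x = alp * DV + a * Vs + R21 + (al * y + Da * Vps))
    (e2 : 2 * (Uq - c * w) = (U + Us) * x + (Up + Ups) * DU + (V + Vs) * y + (Vp + Vps) * DV
      + R00 + R11)
    (e3 : gap * DV + b * Vs + ga * y + Dg * Vps + R31 = 0) :
    |x| ≤ K * (1 + 4 * K ^ 2 / δ) * (1 + 1 / δ) * S ∧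
    |y| ≤ K * (1 + 4 * K ^ 2 / δ) * (1 + 1 / δ) * S ∧
    |a| ≤ K * (1 + 4 * K ^ 2 / δ) * (1 + 1 / δ) * S ∧
    |b| ≤ K * (1 + 4 * K ^ 2 / δ) * (1 + 1 / δ) * S := by
  have n1 := abs_nonneg DU
  have n2 := abs_nonneg DV
  have n3 := abs_nonneg Da
  have n4 := abs_nonneg Dg
  have n5 := abs_nonneg a
  have n6 := abs_nonneg Uq
  have n7 := abs_nonneg w
  have n8 := abs_nonneg R31
  have n9 := abs_nonneg R21
  have n10 := abs_nonneg R00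
  have n11 := abs_nonneg R11
  have hS0 : 0 ≤ S := by rw [hS]; positivity
  have KS : S ≤ K * S := le_mul_of_one_le_left hS0 hK
  have KKS : K * S ≤ K * (K * S) := le_mul_of_one_le_left (by positivity) hK
  have k : ∀ {u v : ℝ}, |u| ≤ K → |u * v| ≤ K * |v| := fun h => ab2 _ _ h le_rfl
  have t2 : ∀ {u v : ℝ}, |u| ≤ K → |v| ≤ K → |u + v| ≤ 2 * K := fun h1 h2 =>
    (abs_add_le _ _).trans ((add_le_add h1 h2).trans (two_mul K).ge)
  set P := alp * DV + a * Vs + R21 + Da * Vps with hP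
  have bP : |P| ≤ K * |DV| + K * |a| + |R21| + K * |Da| := by
    have i1 := k (v := DV) balp
    have i2 := k (v := a) bVs
    have i3 := k (v := Da) bVps
    rw [mul_comm] at i2 i3
    rw [hP]
    exact (abs_add_le _ _).trans (add_le_add ((abs_add_le _ _).trans (add_le_add
      ((abs_add_le _ _).trans (add_le_add i1 i2)) le_rfl)) i3)
  have hx : x = al * y + P := by rw [e1, hP]; ring
  have KR : |R21| ≤ K * |R21| := le_mul_of_one_le_left n9 hK
  have bPS : |P| ≤ K * (|DV| + |a| + |R21| + |Da|) := by linarith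
  have bPS' : |P| ≤ K * S := bPS.trans (by gcongr; rw [hS]; linarith)
  have hcoef : δ ≤ (U + Us) * al + V + Vs := by
    have : |(Us - U) * al| ≤ |Us - U| * K := ab2 _ _ le_rfl bal
    have := (abs_le.mp this).1
    have : 0 ≤ al * al * V := mul_nonneg (mul_self_nonneg _) (hδ.le.trans hV)
    have : (U + Us) * al = 2 * (al * al * V) + (Us - U) * al := by rw [hU]; ring
    linarith
  have hy : y * ((U + Us) * al + V + Vs) =
      2 * (Uq - c * w) - (U + Us) * P - (Up + Ups) * DU - (Vp + Vps) * DV - R00 - R11 := by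
    rw [e2, hx]; ring
  have bR : |2 * (Uq - c * w) - (U + Us) * P - (Up + Ups) * DU - (Vp + Vps) * DV - R00 - R11|
      ≤ 4 * K ^ 2 * S := by
    have i0 : |2 * (Uq - c * w)| ≤ 2 * |Uq| + 2 * (K * |w|) := by
      rw [abs_mul, abs_two]
      have := abs_sub Uq (c * w)
      linarith [k (v := w) bc]
    have i1 : |(U + Us) * P| ≤ 2 * K * |P| :=
      ab2 _ _ (t2 bU bUs) le_rfl
    have i2 : |(Up + Ups) * DU| ≤ 2 * K * |DU| :=
      ab2 _ _ (t2 bUp bUps) le_rfl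
    have i3 : |(Vp + Vps) * DV| ≤ 2 * K * |DV| :=
      ab2 _ _ (t2 bVp bVps) le_rfl
    have i4 : 2 * K * |P| ≤ 2 * K * (K * (|DV| + |a| + |R21| + |Da|)) := by gcongr
    have g1 : K ≤ K ^ 2 := le_self_pow₀ hK (by norm_num)
    have g2 : 1 ≤ K ^ 2 := g1.trans' hK
    have tri : |2 * (Uq - c * w) - (U + Us) * P - (Up + Ups) * DU - (Vp + Vps) * DV - R00 - R11| ≤
        |2 * (Uq - c * w)| + |(U + Us) * P| + |(Up + Ups) * DU| + |(Vp + Vps) * DV| + |R00|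
        + |R11| := by
      refine (abs_sub _ _).trans (add_le_add ((abs_sub _ _).trans (add_le_add
        ((abs_sub _ _).trans (add_le_add ((abs_sub _ _).trans (add_le_add
        (abs_sub _ _) le_rfl)) le_rfl)) le_rfl)) le_rfl)
    have f : ∀ {v : ℝ}, 0 ≤ v → K * v ≤ K ^ 2 * v := fun hv => mul_le_mul_of_nonneg_right g1 hv
    have f' : ∀ {v : ℝ}, 0 ≤ v → v ≤ K ^ 2 * v := fun hv => le_mul_of_one_le_left hv g2
    have := f n7; have := f n1; have := f n2
    have := f' n6; have := f' n10; have := f' n11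
    have K2 : 0 ≤ K ^ 2 := by positivity
    have := mul_nonneg K2 n1
    have := mul_nonneg K2 n2
    have := mul_nonneg K2 n3
    have := mul_nonneg K2 n4
    have := mul_nonneg K2 n5
    have := mul_nonneg K2 n6
    have := mul_nonneg K2 n7
    have := mul_nonneg K2 n8
    have := mul_nonneg K2 n9
    have := mul_nonneg K2 n10
    have := mul_nonneg K2 n11
    rw [hS]
    have e : 2 * K * (K * (|DV| + |a| + |R21| + |Da|)) = 2 * (K ^ 2 * |DV|) + 2 * (K ^ 2 * |a|)
      + 2 * (K ^ 2 * |R21|) + 2 * (K ^ 2 * |Da|) := by ring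
    rw [e] at i4
    clear bal bga balp bgap bUp bVp bUps bVps bc bU bUs bVs hV hVs hUs e2 e3 e1 hx hy bP bPS bPS' hcoef
    linarith
  have by' : |y| ≤ 4 * K ^ 2 / δ * S := by
    have : |y| * δ ≤ 4 * K ^ 2 * S := by
      refine le_trans ?_ bR
      rw [← hy, abs_mul]
      exact mul_le_mul_of_nonneg_left (hcoef.trans (le_abs_self _)) (abs_nonneg _)
    rw [div_mul_eq_mul_div, le_div_iff₀ hδ]; exact this
  set T := 4 * K ^ 2 / δ with hT
  have T0 : 0 ≤ T := by positivity
  have d0 : 0 ≤ 1 / δ := by positivity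
  have bx : |x| ≤ K * (1 + T) * S := by
    rw [hx]
    have := k (v := y) bal
    have := mul_le_mul_of_nonneg_left by' (by linarith : (0:ℝ) ≤ K)
    linarith [abs_add_le (al * y) P]
  have bb : |b| ≤ K * (1 + T) * S * (1 / δ) := by
    rw [mul_one_div, le_div_iff₀ hδ]
    have q : b * Vs = -(gap * DV + Dg * Vps + R31 + ga * y) := by linarith
    have : |b| * δ ≤ |b * Vs| := by
      rw [abs_mul]; exact mul_le_mul_of_nonneg_left (hVs.trans (le_abs_self _)) (abs_nonneg _)
    refine this.trans ?_
    rw [q, abs_neg]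
    have i1 := k (v := DV) bgap
    have i2 := k (v := Dg) bVps
    have i3 := k (v := y) bga
    rw [mul_comm] at i2
    have i4 := mul_le_mul_of_nonneg_left by' (by linarith : (0:ℝ) ≤ K)
    have i5 : |gap * DV + Dg * Vps + R31 + ga * y| ≤ K * |DV| + K * |Dg| + |R31| + K * |y| :=
      (abs_add_le _ _).trans (add_le_add ((abs_add_le _ _).trans (add_le_add
      ((abs_add_le _ _).trans (add_le_add i1 i2)) le_rfl)) i3)
    have i6 : |R31| ≤ K * |R31| := le_mul_of_one_le_left n8 hK
    have i7 : K * (|DV| + |Dg| + |R31|) ≤ K * S := by gcongr; rw [hS]; linarith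
    linarith
  have Z : 0 ≤ K * (1 + T) * S := by positivity
  have Zd : 0 ≤ K * (1 + T) * S * (1 / δ) := by positivity
  have e : K * (1 + T) * (1 + 1 / δ) * S = K * (1 + T) * S + K * (1 + T) * S * (1 / δ) := by ring
  rw [e]
  have TS : T * S ≤ K * (1 + T) * S := by
    have : 1 * (T * S) ≤ K * (T * S) := by gcongr
    have : 0 ≤ K * S := by positivity
    linarith
  have aS : |a| ≤ K * (1 + T) * S := by
    have : |a| ≤ S := by rw [hS]; linarith
    have : 0 ≤ K * (T * S) := by positivity
    linarith
  refine ⟨by linarith, by linarith, by linarith, by linarith⟩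

end

section

open MeasureTheory Filter Topology

section
variable {p0 d Q K δ : ℝ} {Y Uq : ℝ → ℝ → ℝ} {W Wp : Fin 4 → ℝ → ℝ → ℝ} {rh bb cc : ℝ → ℝ}

theorem PD.mul_eq {f fp g gp k kp : ℝ → ℝ → ℝ} (hf : PD p0 f fp) (hg : PD p0 g gp)
    (hk : PD p0 k kp) (e : f * g = k) {p : ℝ} (hp : p ∈ Ioo p0 0) (L : List ℝ) (q : ℝ) :
    _root_.DL L kp q p = fp q p * _root_.DL L g q p + _root_.DL L fp q p * _root_.sh L.sum g q p
      + _root_.Rem L fp g q p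
      + (f q p * _root_.DL L gp q p + _root_.DL L f q p * _root_.sh L.sum gp q p
      + _root_.Rem L f gp q p) := by
  have e1 : ∀ q, kp q p = (fp * g + f * gp) q p := fun q => by
    have h1 := (hf.mul hg).2.2 q p hp
    rw [e] at h1
    exact (hk.2.2 q p hp).unique h1
  rw [DL_congr e1, DL_add, DL_mul, DL_mul]
  rfl

theorem WFlow.rest (h : WFlow p0 d Q K δ Y Uq W Wp rh bb cc) : ∃ τ > 0, ∃ C ≥ 1,
    ∀ L : List ℝ, L ≠ [] → (∀ t ∈ L, 0 < t) → L.sum ≤ τ → ∀ r, (∀ i, LC p0 (DL L (W i)) r) →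
    LC p0 (DL L (Wp 2)) r → LC p0 (DL L Uq) r → LC p0 (DL L Y) r →
    (∀ i j, LC p0 (Remp L (W i) (Wp i) (W j) (Wp j)) r) → ∀ i, LC p0 (DL L (Wp i)) (C * r) := by
  have hp := h.hp
  have hK := h.hK
  have hδ := h.hδ
  have K0 : 0 < K := by linarith
  set C := K * (1 + 4 * K ^ 2 / δ) * (1 + 1 / δ) with hC
  have hC1 : 1 ≤ C := by
    have h1 : 1 ≤ 1 + 4 * K ^ 2 / δ := le_add_of_nonneg_right (by positivity)
    have h2 : 1 ≤ 1 + 1 / δ := le_add_of_nonneg_right (by positivity)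
    exact one_le_mul_of_one_le_of_one_le (one_le_mul_of_one_le_of_one_le hK h1) h2
  refine ⟨δ / K ^ 2, by positivity, C * 11, by linarith, ?_⟩
  intro L hL hLp hLs r hW ha hUq hY hR
  have hs := sum_pos' hL hLp
  have hP := h.pW
  set f : Fin 11 → ℝ → ℝ → ℝ := ![DL L (W 0), DL L (W 1), DL L (W 2), DL L (W 3), DL L (Wp 2),
    DL L Uq, DL L Y, Remp L (W 3) (Wp 3) (W 1) (Wp 1), Remp L (W 2) (Wp 2) (W 1) (Wp 1),
    Remp L (W 0) (Wp 0) (W 0) (Wp 0), Remp L (W 1) (Wp 1) (W 1) (Wp 1)] with hf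
  have hLC : ∀ i, LC p0 (f i) r := by
    intro i
    fin_cases i
    exacts [hW 0, hW 1, hW 2, hW 3, ha, hUq, hY, hR 3 1, hR 2 1, hR 0 0, hR 1 1]
  have key : ∀ i, ∀ q, ∀ p ∈ Ioo p0 0, |DL L (Wp i) q p| ≤ C * ∑ i, |f i q p| := by
    intro i q p hpp
    have S : ∑ i, |f i q p| = |DL L (W 0) q p| + |DL L (W 1) q p| + |DL L (W 2) q p|
      + |DL L (W 3) q p| + |DL L (Wp 2) q p| + |DL L Uq q p| + |DL L Y q p|
      + |Remp L (W 3) (Wp 3) (W 1) (Wp 1) q p| + |Remp L (W 2) (Wp 2) (W 1) (Wp 1) q p|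
      + |Remp L (W 0) (Wp 0) (W 0) (Wp 0) q p| + |Remp L (W 1) (Wp 1) (W 1) (Wp 1) q p| := by
      rw [hf]; simp only [Fin.sum_univ_succ, Fin.sum_univ_zero]
      simp; ring
    have e1 := (hP 2).mul_eq (hP 1) (hP 0) h.alV hpp L q
    have c1 : PD p0 (cst 1) 0 := ⟨CB.cst 1, ⟨continuous_const, 0, fun q p => by simp⟩,
      fun q p _ => hasDerivAt_const p 1⟩
    have e3 := (hP 3).mul_eq (hP 1) c1 h.gaV hpp L q
    have z : DL L 0 q p = 0 := DL_zero (c := 0) (fun _ => rfl) hL q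
    rw [z] at e3
    have e0 := (hP 0).mul_eq (hP 0) ((hP 0).mul (hP 0)) rfl hpp L q
    have e4 := (hP 1).mul_eq (hP 1) ((hP 1).mul (hP 1)) rfl hpp L q
    have E : ∀ q, (Wp 0 * W 0 + W 0 * Wp 0 + (Wp 1 * W 1 + W 1 * Wp 1)) q p =
      (Uq + Uq - (pf cc * (Y + Y) + pf (fun p => 2 * bb p))) q p := fun q => by
      have := h.eq2 q p hpp
      simp only [Pi.add_apply, Pi.sub_apply, Pi.mul_apply, pf]; linarith
    have E2 := DL_congr E L q
    have z2 : DL L (pf fun p => 2 * bb p) q p = 0 := DL_zero (f := pf fun p => 2 * bb p) (p := p)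
      (c := 2 * bb p) (fun _ => rfl) hL q
    have z3 : DL L (pf cc * (Y + Y)) = pf cc * DL L (Y + Y) := DL_pmul cc _ L
    rw [DL_add L (Wp 0 * W 0 + W 0 * Wp 0), DL_sub, DL_add L Uq, DL_add L (pf cc * (Y + Y)), z3,
      DL_add L Y] at E2
    simp only [Pi.add_apply, Pi.sub_apply, Pi.mul_apply, z2] at E2
    rw [e0, e4] at E2
    simp only [pf] at E2
    have t1 : K * |sh L.sum (W 0) q p - W 0 q p| ≤ δ := by
      have := h.shd 0 hs q p
      rw [le_div_iff₀ (by positivity)] at hLs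
      calc _ ≤ K * (K * L.sum) := by gcongr
        _ ≤ δ := by linarith
    have t2 : DL L (Wp 0) q p = Wp 2 q p * DL L (W 1) q p + DL L (Wp 2) q p * sh L.sum (W 1) q p
        + Remp L (W 2) (Wp 2) (W 1) (Wp 1) q p + (W 2 q p * DL L (Wp 1) q p
        + DL L (W 2) q p * sh L.sum (Wp 1) q p) := by
      rw [e1]; simp only [Remp, Pi.add_apply]; ring
    have t3 : 2 * (DL L Uq q p - cc p * DL L Y q p) = (W 0 q p + sh L.sum (W 0) q p) *
        DL L (Wp 0) q p + (Wp 0 q p + sh L.sum (Wp 0) q p) * DL L (W 0) q p +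
        (W 1 q p + sh L.sum (W 1) q p) * DL L (Wp 1) q p
        + (Wp 1 q p + sh L.sum (Wp 1) q p) * DL L (W 1) q p
        + Remp L (W 0) (Wp 0) (W 0) (Wp 0) q p + Remp L (W 1) (Wp 1) (W 1) (Wp 1) q p := by
      simp only [Remp, Pi.add_apply]; linarith
    have t4 : Wp 3 q p * DL L (W 1) q p + DL L (Wp 3) q p * sh L.sum (W 1) q p
        + W 3 q p * DL L (Wp 1) q p + DL L (W 3) q p * sh L.sum (Wp 1) q p
        + Remp L (W 3) (Wp 3) (W 1) (Wp 1) q p = 0 := by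
      rw [e3]; simp only [Remp, Pi.add_apply]; ring
    have RR := R_pt hK hδ (W 0 q p) (W 1 q p) (sh L.sum (W 0) q p)
      (sh L.sum (W 1) q p)
      (W 2 q p) (W 3 q p) (Wp 2 q p) (Wp 3 q p) (Wp 0 q p) (Wp 1 q p) (sh L.sum (Wp 0) q p)
      (sh L.sum (Wp 1) q p) (cc p) (DL L (Wp 0) q p) (DL L (Wp 1) q p) (DL L (Wp 2) q p)
      (DL L (Wp 3) q p) (DL L (W 0) q p) (DL L (W 1) q p) (DL L (W 2) q p) (DL L (W 3) q p)
      (DL L Uq q p) (DL L Y q p) (Remp L (W 3) (Wp 3) (W 1) (Wp 1) q p)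
      (Remp L (W 2) (Wp 2) (W 1) (Wp 1) q p) (Remp L (W 0) (Wp 0) (W 0) (Wp 0) q p)
      (Remp L (W 1) (Wp 1) (W 1) (Wp 1) q p) _ (h.bW _ _ _) (h.bW _ _ _) (h.bWp _ _ _)
      (h.bWp _ _ _) (h.bWp _ _ _) (h.bWp _ _ _) (h.bWp _ _ _) (h.bWp _ _ _) (h.bcc _)
      (h.bW _ _ _) (h.bW _ _ _) (h.bW _ _ _) (h.Vpos _ _) (h.Vpos _ _)
      (by rw [← h.alV]; rfl) t1 S t2 t3 t4
    fin_cases i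
    exacts [RR.1, RR.2.1, RR.2.2.1, RR.2.2.2]
  intro i
  have := LC.dom hp (by linarith : 0 ≤ C) f hLC ((h.pW i).2.1.DL L) (key i)
  exact this.mono (by push_cast; linarith)

end

end

section

open MeasureTheory Filter Topology

section
variable {p0 d Q K δ : ℝ} {Y Uq : ℝ → ℝ → ℝ} {W Wp : Fin 4 → ℝ → ℝ → ℝ} {rh bb cc : ℝ → ℝ}

theorem lip_DL {f : ℝ → ℝ → ℝ} (h : ∃ K, ∀ s > 0, ∀ q p, |DD s f q p| ≤ K) (L : List ℝ) :
    ∃ K, ∀ s > 0, ∀ q p, |DD s (DL L f) q p| ≤ K := by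
  induction L with
  | nil => exact h
  | cons t L ih =>
    obtain ⟨K', hK⟩ := ih
    refine ⟨(K' + K') / |t|, fun s hs q p => ?_⟩
    rw [DL_cons, DD_comm]
    rw [DD, abs_div]
    gcongr
    exact (abs_sub _ _).trans (add_le_add (hK s hs _ _) (hK s hs _ _))

/-- closure lemma: gain of one difference for `W`, and for `Wp` -/
theorem WFlow.core (h : WFlow p0 d Q K δ Y Uq W Wp rh bb cc) : ∃ τ > 0, ∃ C ≥ 1,
    (∀ s L, (∀ t ∈ s :: L, 0 < t) → (s :: L).sum ≤ 3 * τ → ∀ r,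
      (∀ i j, LC p0 (Rem (s :: L) (W i) (W j)) r) → LC p0 (DL L (W 2)) r →
      ∀ i, LC p0 (DD s (DL L (W i))) (C * r)) ∧
    (∀ s L, (∀ t ∈ s :: L, 0 < t) → (s :: L).sum ≤ 3 * τ → ∀ r,
      (∀ i j, LC p0 (Remp (s :: L) (W i) (Wp i) (W j) (Wp j)) r) → LC p0 (DL L (W 2)) r →
      (∀ i, LC p0 (DD s (DL L (W i))) r) →
      (∀ i, ∀ t ∈ Ioc 0 τ, LC p0 (DD t (DD s (DL L (W i)))) r) →
      ∀ i, LC p0 (DD s (DL L (Wp i))) (C * r)) := by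
  obtain ⟨τ1, h1, C1, hC1, e1⟩ := h.energy
  obtain ⟨τ2, h2, C2, hC2, e2⟩ := h.rest
  have hY : ∀ s > 0, ∀ L r, LC p0 (DL L (W 2)) r → LC p0 (DD s (DL L Y)) r := by
    intro s hs L r hl
    obtain ⟨K', hK'⟩ := lip_DL ⟨K, h.lip 2⟩ L
    exact ⟨(h.pY.1.DL L).DD s, hl.nn, LB.jensen h.hp hl.nn (h.pY.1.DL L) hl.c (h.qY.DL L) hK'
      hl.lb hs⟩
  refine ⟨min τ1 τ2 / 3, by positivity, max C1 C2, hC1.le.trans (le_max_left _ _), ?_, ?_⟩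
  · intro s L hL hs r hR h0 i
    rw [mul_div_cancel₀ _ (by norm_num)] at hs
    have y := hY s (hL s (by simp)) L r h0
    rw [← DL_cons] at y ⊢
    have := e1 (s :: L) (by simp) hL (hs.trans (min_le_left _ _)) r h0.nn (hR _ _).lb (hR _ _).lb
      (hR _ _).lb (hR _ _).lb y.lb i
    have nn := h0.nn
    exact LC.mono ⟨(h.pW i).1.DL _, by positivity, this⟩ (by gcongr; exact le_max_left _ _)
  · intro s L hL hs r hR h0 h3 h4 i
    have hτ : 0 < min τ1 τ2 / 3 := by positivity
    rw [mul_div_cancel₀ _ (by norm_num)] at hs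
    have y := hY s (hL s (by simp)) L r h0
    rw [← DL_cons] at y ⊢
    have nn := h0.nn
    have q1 : LC p0 (DL (s :: L) Uq) r := ⟨h.cUq.DL _, nn, LB.qlim h.hp hτ ((h.pW 0).1.DL _)
      (h.cUq.DL _) (h.qU.DL _) fun t ht => by rw [DL_cons]; exact (h4 0 t ht).lb⟩
    have q2 : LC p0 (DL (s :: L) (Wp 2)) r := ⟨(h.pW 2).2.1.DL _, nn, LB.qlim h.hp hτ
      ((h.pW 3).1.DL _) ((h.pW 2).2.1.DL _) (h.qga.DL _)
      fun t ht => by rw [DL_cons]; exact (h4 3 t ht).lb⟩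
    exact (e2 (s :: L) (by simp) hL (hs.trans (min_le_right _ _)) r
      (fun i => by rw [DL_cons]; exact h3 i) q2 q1 y hR i).mono (by gcongr; exact le_max_right _ _)

theorem Rem2 (s t : ℝ) (ts : List ℝ) (f g : ℝ → ℝ → ℝ) : Rem (s :: t :: ts) f g =
    DD s (DD t (Rem ts f g)) + DD s (DD t f) * sh (s + t) (DL ts g)
    + DD t f * sh t (DD s (DL ts g)) + DD s (DL ts f) * sh (s + ts.sum) (DD t g)
    + DL ts f * sh ts.sum (DD s (DD t g)) + DD s f * sh s (DD t (DL ts g))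
    + DD t (DL ts f) * sh (t + ts.sum) (DD s g) := by
  rw [Rem_cons', Rem_cons' t, DD_add, DD_add, DD_mul, DD_mul, sh_sh, sh_sh, DD_sh, DD_sh, DL_cons,
    DL_cons, List.sum_cons]
  ring

theorem Remp1 (s : ℝ) (ts : List ℝ) (f fp g gp : ℝ → ℝ → ℝ) : Remp (s :: ts) f fp g gp =
    DD s (Remp ts f fp g gp) + DD s fp * sh s (DL ts g) + DL ts fp * sh ts.sum (DD s g)
    + DD s f * sh s (DL ts gp) + DL ts f * sh ts.sum (DD s gp) := by
  rw [Remp, Rem_cons', Rem_cons', Remp, DD_add]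
  ring

theorem WFlow.step (h : WFlow p0 d Q K δ Y Uq W Wp rh bb cc) : ∃ τ > 0, ∃ C ≥ 1,
    (∃ a0, ∀ i, XB p0 τ (W i) (Wp i) a0) ∧
    ∀ ts : List ℝ, ts ≠ [] → (∀ t ∈ ts, 0 < t) → ts.sum ≤ τ → ∀ r,
      (∀ i, LC p0 (DL ts (W i)) r) → (∀ i, LC p0 (DL ts (Wp i)) r) →
      (∀ i, ∀ s ∈ Ioc 0 τ, LC p0 (DD s (DL ts (W i))) r) →
      (∀ i j u, ∀ s ∈ Ioc 0 τ, ∀ t ∈ Ioc 0 τ, LC p0 (DD s (DD t (W i)) * sh u (DL ts (W j))) r) →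
      (∀ i j u, ∀ s ∈ Ioc 0 τ, LC p0 (DD s (Wp i) * sh u (DL ts (W j))) r) →
      (∀ i j, ∀ s ∈ Ioc 0 τ, ∀ t ∈ Ioc 0 τ, LC p0 (DD s (DD t (Rem ts (W i) (W j)))) r) →
      (∀ i j, ∀ s ∈ Ioc 0 τ, LC p0 (DD s (Remp ts (W i) (Wp i) (W j) (Wp j))) r) →
      ∀ i, XB p0 τ (DL ts (W i)) (DL ts (Wp i)) (C * r) := by
  obtain ⟨τ, hτ, C, hC, e1, e2⟩ := h.core
  have hp := h.hp
  have hK := h.hK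
  have cW := fun i => (h.pW i).1
  have cP := fun i => (h.pW i).2.1
  set S := Real.sqrt (JJ p0 0 (cst 1)) with hS
  have S0 : 0 ≤ S := Real.sqrt_nonneg _
  have b0 : ∀ i, LC p0 (W i) (K * S) := fun i => LC.of_bdd hp (cW i) (h.bW i)
  have b0' : ∀ i, LC p0 (Wp i) (K * S) := fun i => LC.of_bdd hp (cP i) (h.bWp i)
  have b1 : ∀ i, ∀ s > 0, LC p0 (DD s (W i)) (K * S) := fun i s hs =>
    LC.of_bdd hp ((cW i).DD s) (h.lip i s hs)
  refine ⟨τ, hτ, C * (C * (7 * K)), ?_, ?_, ?_⟩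
  · have : 1 ≤ C * (7 * K) := one_le_mul_of_one_le_of_one_le hC (by linarith)
    exact one_le_mul_of_one_le_of_one_le hC this
  · set r := 2 * K * (K * S) with hr
    have r0 : 0 ≤ r := by positivity
    have rK : K * S ≤ r := by
      have : 1 * (K * S) ≤ K * (K * S) := by gcongr
      have : r = K * (K * S) + K * (K * S) := by rw [hr]; ring
      linarith [mul_nonneg (by linarith : 0 ≤ K) S0]
    have n2 : ∀ i, ∀ s ∈ Ioc 0 τ, ∀ t ∈ Ioc 0 τ, LC p0 (DD s (DD t (W i))) (C * r) := by
      intro i s hs t ht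
      have := e1 s [t] (by simp [hs.1, ht.1]) (by simp; linarith [hs.2, ht.2]) r ?_
        ((b1 2 t ht.1).mono rK) i
      · exact this
      · intro i j
        rw [Rem_cons', Rem_nil']
        have z : DD s 0 = 0 := by funext q p; simp [DD]
        rw [z, zero_add]
        have a1 := ((b1 j t ht.1).sh s).bm hp ((cW i).DD s) (h.lip i s hs.1)
        have a2 := ((b1 j s hs.1).sh t).bm hp ((cW i).DD t) (h.lip i t ht.1)
        have := a1.add hp a2
        simp only [DL, List.sum_cons, List.sum_nil, add_zero]
        exact this.mono (by rw [hr]; linarith)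
    have Cr : r ≤ C * r := le_mul_of_one_le_left r0 hC
    have CCr : C * r ≤ C * (C * r) := le_mul_of_one_le_left (by positivity) hC
    have r1 : ∀ i, ∀ s ∈ Ioc 0 τ, LC p0 (DD s (Wp i)) (C * (C * r)) := by
      intro i s hs
      refine e2 s [] (by simp [hs.1]) (by simp; linarith [hs.2]) (C * r) ?_ ((b0 2).mono (rK.trans Cr))
        (fun i => (b1 i s hs.1).mono (rK.trans Cr)) (fun i t ht => n2 i t ht s hs) i
      intro i j
      rw [Remp, Rem_nil', Rem_nil', add_zero]
      exact ⟨⟨continuous_const, 0, fun q p => by simp⟩, by positivity, fun q0 => by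
        simp only [JJ, mul_zero, Pi.zero_apply, intervalIntegral.integral_zero, integral_zero]
        positivity⟩
    refine ⟨C * (C * r), fun i => ⟨h.pW i, by positivity, ?_, ?_, ?_, ?_, ?_⟩⟩
    · exact ((b0 i).mono (by linarith)).lb
    · exact fun s hs => ((b1 i s hs.1).mono (by linarith)).lb
    · exact fun s hs t ht => ((n2 i s hs t ht).mono CCr).lb
    · exact ((b0' i).mono (by linarith)).lb
    · exact fun s hs => (r1 i s hs).lb
  · intro ts hne hpos hsum r a1 a3 a2 m1 m2 c1 c2 i
    have r0 := (a1 0).nn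
    have hss := sum_pos' hne hpos
    have rK : r ≤ K * r := le_mul_of_one_le_left r0 hK
    have k7 : ∀ {x}, 0 ≤ x → x ≤ C * x := fun hx => le_mul_of_one_le_left hx hC
    have n0 : 0 ≤ 7 * K * r := by positivity
    have n1 : 0 ≤ C * (7 * K * r) := by positivity
    have z7 : r ≤ 7 * K * r := by linarith
    have n2 : ∀ i, ∀ s ∈ Ioc 0 τ, ∀ t ∈ Ioc 0 τ, LC p0 (DD s (DD t (DL ts (W i)))) (C * (7 * K * r)) := by
      intro i s hs t ht
      have hmem : ∀ x ∈ s :: t :: ts, 0 < x := by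
        intro x hx
        rcases List.mem_cons.mp hx with rfl | hx
        · exact hs.1
        rcases List.mem_cons.mp hx with rfl | hx
        · exact ht.1
        exact hpos x hx
      have := e1 s (t :: ts) hmem (by simp; linarith [hs.2, ht.2]) (7 * K * r) ?_ ?_ i
      · rwa [DL_cons] at this
      · intro i j
        rw [Rem2]
        have i1 := c1 i j s hs t ht
        have i2 := m1 i j (s + t) s hs t ht
        have i3 := ((a2 j s hs).sh t).bm hp ((cW i).DD t) (h.lip i t ht.1)
        have i4 := (a2 i s hs).mb hp (((cW j).DD t).sh (s + ts.sum)) (fun q p => h.lip j t ht.1 _ p)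
        have i5 := LC.flip (fun u => m1 j i u s hs t ht) ts.sum
        have i6 := ((a2 j t ht).sh s).bm hp ((cW i).DD s) (h.lip i s hs.1)
        have i7 := (a2 i t ht).mb hp (((cW j).DD s).sh (t + ts.sum)) (fun q p => h.lip j s hs.1 _ p)
        have := (((((i1.add hp i2).add hp i3).add hp i4).add hp i5).add hp i6).add hp i7
        exact this.mono (by linarith)
      · rw [DL_cons]; exact (a2 2 t ht).mono z7
    have r1 : ∀ i, ∀ s ∈ Ioc 0 τ, LC p0 (DD s (DL ts (Wp i))) (C * (C * (7 * K * r))) := by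
      intro i s hs
      refine e2 s ts ?_ (by simp; linarith [hs.2]) (C * (7 * K * r)) ?_ ((a1 2).mono (z7.trans (k7 n0)))
        (fun i => (a2 i s hs).mono (z7.trans (k7 n0))) (fun i t ht => n2 i t ht s hs) i
      · intro x hx
        rcases List.mem_cons.mp hx with rfl | hx
        · exact hs.1
        exact hpos x hx
      · intro i j
        rw [Remp1]
        have i1 := c2 i j s hs
        have i2 := m2 i j s s hs
        have i3 := (a3 i).mb hp (((cW j).DD s).sh (ts.sum)) (fun q p => h.lip j s hs.1 _ p)
        have i4 := ((a3 j).sh s).bm hp ((cW i).DD s) (h.lip i s hs.1)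
        have i5 := LC.flip (fun u => m2 j i u s hs) ts.sum
        have := (((i1.add hp i2).add hp i3).add hp i4).add hp i5
        exact this.mono (by linarith [k7 n0])
    have e : C * (C * (7 * K)) * r = C * (C * (7 * K * r)) := by ring
    have z8 : r ≤ C * (C * (7 * K * r)) := by linarith [k7 n0, k7 n1]
    rw [e]
    refine ⟨(h.pW i).DL ts, by positivity, ?_, ?_, ?_, ?_, ?_⟩
    · exact ((a1 i).mono z8).lb
    · exact fun s hs => ((a2 i s hs).mono z8).lb
    · exact fun s hs t ht => ((n2 i s hs t ht).mono (k7 n1)).lb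
    · exact ((a3 i).mono z8).lb
    · exact fun s hs => (r1 i s hs).lb
end

end

section

open MeasureTheory Filter Topology

def eG (s : ℝ) (n : ℕ) : ℝ := (n.factorial : ℝ) ^ s / ((n : ℝ) + 1) ^ 2

theorem eG_pos (s : ℝ) (n : ℕ) : 0 < eG s n := by
  have : (0:ℝ) < n.factorial := by exact_mod_cast n.factorial_pos
  unfold eG; positivity

theorem inv_sq_sum (N : ℕ) : ∑ m ∈ Finset.range (N + 1), 1 / ((m : ℝ) + 1) ^ 2 ≤ 2 - 1 / ((N:ℝ) + 1) := by
  induction N with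
  | zero => norm_num
  | succ N ih =>
    rw [Finset.sum_range_succ]
    have : 1 / (((N + 1 : ℕ) : ℝ) + 1) ^ 2 ≤ 1 / ((N : ℝ) + 1) - 1 / (((N + 1 : ℕ) : ℝ) + 1) := by
      push_cast
      rw [div_sub_div _ _ (by positivity) (by positivity), div_le_div_iff₀ (by positivity) (by positivity)]
      nlinarith
    linarith

theorem inv_sq_sum' (N : ℕ) : ∑ m ∈ Finset.range (N + 1), 1 / ((m : ℝ) + 1) ^ 2 ≤ 2 :=
  (inv_sq_sum N).trans (by have : 0 ≤ 1 / ((N:ℝ) + 1) := by positivity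
                           linarith)

theorem conv_aux {s : ℝ} (hs : 1 ≤ s) (i j r : ℕ) :
    ((i + j).choose i : ℝ) * (eG s i * eG s (j + r)) ≤
      2 * eG s (i + j + r) * (1 / ((i : ℝ) + 1) ^ 2 + 1 / ((j : ℝ) + 1) ^ 2) := by
  have f1 : (0:ℝ) < i.factorial := by exact_mod_cast i.factorial_pos
  have f2 : (0:ℝ) < (j + r).factorial := by exact_mod_cast (j + r).factorial_pos
  have f3 : (0:ℝ) < (i + j + r).factorial := by exact_mod_cast (i + j + r).factorial_pos
  have c1 : (1:ℝ) ≤ (i + j).choose i := by exact_mod_cast Nat.choose_pos (by omega)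
  have k1 : (i + j).choose i * i.factorial * (j + r).factorial ≤ (i + j + r).factorial := by
    have h1 : (i + j).choose i ≤ (i + (j + r)).choose i := Nat.choose_le_choose i (by omega)
    have h2 := Nat.choose_mul_factorial_mul_factorial (Nat.le_add_right i (j + r))
    rw [Nat.add_sub_cancel_left] at h2
    calc _ ≤ (i + (j + r)).choose i * i.factorial * (j + r).factorial := by gcongr
      _ = (i + j + r).factorial := by rw [h2, add_assoc]
  have k2 : ((i + j).choose i : ℝ) * i.factorial * (j + r).factorial ≤ (i + j + r).factorial := by
    exact_mod_cast k1
  have k3 : ((i + j).choose i : ℝ) * ((i.factorial : ℝ) ^ s * ((j + r).factorial : ℝ) ^ s) ≤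
      ((i + j + r).factorial : ℝ) ^ s := by
    calc _ ≤ ((i + j).choose i : ℝ) ^ s * ((i.factorial : ℝ) ^ s * ((j + r).factorial : ℝ) ^ s) := by
          gcongr
          exact Real.self_le_rpow_of_one_le c1 hs
      _ = (((i + j).choose i : ℝ) * i.factorial * (j + r).factorial) ^ s := by
          rw [Real.mul_rpow (by positivity) f2.le, Real.mul_rpow (by positivity) f1.le]; ring
      _ ≤ _ := by gcongr
  have k4 : 1 / (((i:ℝ) + 1) ^ 2 * (((j + r : ℕ) : ℝ) + 1) ^ 2) ≤
      2 / (((i + j + r : ℕ) : ℝ) + 1) ^ 2 * (1 / ((i : ℝ) + 1) ^ 2 + 1 / ((j : ℝ) + 1) ^ 2) := by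
    have g : 1 / (((j + r : ℕ) : ℝ) + 1) ^ 2 ≤ 1 / ((j : ℝ) + 1) ^ 2 := by
      gcongr; push_cast; linarith [(Nat.cast_nonneg r : (0:ℝ) ≤ r)]
    refine le_trans ?_ (mul_le_mul_of_nonneg_left (add_le_add_right g _) (by positivity))
    push_cast
    rw [div_add_div _ _ (by positivity) (by positivity), div_mul_div_comm,
      div_le_div_iff₀ (by positivity) (by positivity)]
    set a : ℝ := (i:ℝ) + 1 with ha
    set b : ℝ := (j:ℝ) + r + 1 with hb
    have a1 : 1 ≤ a := by rw [ha]; linarith [(Nat.cast_nonneg i : (0:ℝ) ≤ i)]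
    have b1 : 1 ≤ b := by
      rw [hb]; linarith [(Nat.cast_nonneg j : (0:ℝ) ≤ j), (Nat.cast_nonneg r : (0:ℝ) ≤ r)]
    have e : (i:ℝ) + j + r + 1 = a + b - 1 := by rw [ha, hb]; ring
    rw [e]
    have : (a + b - 1) ^ 2 ≤ 2 * (1 * b ^ 2 + a ^ 2 * 1) := by nlinarith [sq_nonneg (a - b)]
    have p : 0 ≤ a ^ 2 * b ^ 2 := by positivity
    calc _ = (a + b - 1) ^ 2 * (a ^ 2 * b ^ 2) := by ring
      _ ≤ _ := mul_le_mul_of_nonneg_right this p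
  calc _ = ((i + j).choose i : ℝ) * ((i.factorial : ℝ) ^ s * ((j + r).factorial : ℝ) ^ s) *
        (1 / (((i:ℝ) + 1) ^ 2 * (((j + r : ℕ) : ℝ) + 1) ^ 2)) := by
        unfold eG; field_simp
    _ ≤ ((i + j + r).factorial : ℝ) ^ s * (2 / (((i + j + r : ℕ) : ℝ) + 1) ^ 2
        * (1 / ((i : ℝ) + 1) ^ 2 + 1 / ((j : ℝ) + 1) ^ 2)) := by gcongr
    _ = _ := by unfold eG; ring

theorem conv_le {s : ℝ} (hs : 1 ≤ s) (N r : ℕ) :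
    ∑ ij ∈ Finset.HasAntidiagonal.antidiagonal N, (N.choose ij.1 : ℝ) * (eG s ij.1 * eG s (ij.2 + r))
      ≤ 8 * eG s (N + r) := by
  calc _ ≤ ∑ ij ∈ Finset.HasAntidiagonal.antidiagonal N, 2 * eG s (N + r) *
        (1 / ((ij.1 : ℝ) + 1) ^ 2 + 1 / ((ij.2 : ℝ) + 1) ^ 2) := by
        refine Finset.sum_le_sum fun ij hij => ?_
        rw [Finset.HasAntidiagonal.mem_antidiagonal] at hij
        rw [← hij]; exact conv_aux hs _ _ _
    _ = 2 * eG s (N + r) * (∑ m ∈ Finset.range (N + 1), 1 / ((m : ℝ) + 1) ^ 2 +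
        ∑ m ∈ Finset.range (N + 1), 1 / ((m : ℝ) + 1) ^ 2) := by
        rw [← Finset.mul_sum, Finset.sum_add_distrib]
        congr 2
        · exact Finset.Nat.sum_antidiagonal_eq_sum_range_succ_mk (fun ij => 1 / ((ij.1 : ℝ) + 1) ^ 2) N
        · rw [← Finset.Nat.sum_antidiagonal_swap]
          exact Finset.Nat.sum_antidiagonal_eq_sum_range_succ_mk (fun ij => 1 / ((ij.1 : ℝ) + 1) ^ 2) N
    _ ≤ 2 * eG s (N + r) * (2 + 2) := by
        have := eG_pos s (N + r)
        gcongr <;> exact inv_sq_sum' N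
    _ = _ := by ring

theorem rs_mono (n : ℕ) (A B A' B' : ℕ → ℝ) (hA : ∀ j, 1 ≤ j → 0 ≤ A j ∧ A j ≤ A' j)
    (hB : ∀ j, 1 ≤ j → 0 ≤ B j ∧ B j ≤ B' j) : 0 ≤ rs n A B ∧ rs n A B ≤ rs n A' B' := by
  induction n generalizing A B A' B' with
  | zero => simp [rs]
  | succ n ih =>
    cases n with
    | zero => simp [rs]
    | succ n =>
      have i1 := ih (fun j => A (j + 1)) B (fun j => A' (j + 1)) B' (fun j _ => hA _ (by omega)) hB
      have i2 := ih A (fun j => B (j + 1)) A' (fun j => B' (j + 1)) hA (fun j _ => hB _ (by omega))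
      have a1 := hA 1 le_rfl
      have b1 := hB 1 le_rfl
      have an := hA (n + 1) (by omega)
      have bn := hB (n + 1) (by omega)
      have p1 := mul_nonneg a1.1 bn.1
      have p2 := mul_nonneg an.1 b1.1
      have q1 := mul_le_mul a1.2 bn.2 bn.1 (a1.1.trans a1.2)
      have q2 := mul_le_mul an.2 b1.2 b1.1 (an.1.trans an.2)
      simp only [rs]
      exact ⟨by linarith [i1.1, i2.1], by linarith [i1.2, i2.2]⟩

section
variable {p0 d Q K δ : ℝ} {Y Uq : ℝ → ℝ → ℝ} {W Wp : Fin 4 → ℝ → ℝ → ℝ} {rh bb cc : ℝ → ℝ}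

theorem WFlow.recu (h : WFlow p0 d Q K δ Y Uq W Wp rh bb cc) : ∃ τ > 0, ∃ a1 ≥ 1, ∃ a0, ∃ C ≥ 1,
    (∀ i, XB p0 τ (W i) (Wp i) a0) ∧ (∀ i, ∀ t ∈ Ioc 0 τ, XB p0 τ (DD t (W i)) (DD t (Wp i)) a1) ∧
    ∀ k ≥ 1, ∀ A : ℕ → ℝ, A 1 = a1 → (∀ i, Fm p0 τ τ k (W i) (Wp i) A) →
    ∀ ts : List ℝ, (∀ t ∈ ts, 0 < t) → ts.sum ≤ τ → ts.length = k + 1 → ∀ i,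
      XB p0 τ (DL ts (W i)) (DL ts (Wp i)) (C * (A k + rs (k + 1) A A)) := by
  obtain ⟨τ, hτ, C, hC, ⟨a0, h0⟩, st⟩ := h.step
  have hp := h.hp
  have hK := h.hK
  have cp := cS_pos hp
  have n0 := (h0 0).nn
  have K0 : a0 ≤ K * a0 := le_mul_of_one_le_left n0 hK
  set a1 := C * (K * a0) + 1 with ha1
  have a10 : 0 ≤ a1 := by positivity
  refine ⟨τ, hτ, a1, ?_, a0, C * (1 + cS p0 * a1 + 4 * cS p0), ?_, h0, ?_, ?_⟩
  · have : 0 ≤ C * (K * a0) := by positivity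
    linarith
  · have : 0 ≤ cS p0 * a1 := by positivity
    exact one_le_mul_of_one_le_of_one_le hC (by linarith)
  · intro i t ht
    have z : LC p0 0 (K * a0) := ⟨⟨continuous_const, 0, fun q p => by simp⟩, by positivity,
      fun q0 => by
        simp only [JJ, mul_zero, Pi.zero_apply, intervalIntegral.integral_zero, integral_zero]
        positivity⟩
    have d0 : ∀ s, DD s 0 = 0 := fun s => by funext q p; simp [DD]
    have hlip : ∀ j, ∀ q p, |DD t (W j) q p| ≤ K := fun j => h.lip j t ht.1
    refine (st [t] (by simp) (by simpa using ht.1) (by simpa using ht.2) (K * a0) ?_ ?_ ?_ ?_ ?_ ?_ ?_ i).mono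
      (by linarith)
    · exact fun i => LC.mono ⟨(h0 i).pd.1.DD t, n0, (h0 i).l1 t ht⟩ K0
    · exact fun i => LC.mono ⟨(h0 i).pd.2.1.DD t, n0, (h0 i).q1 t ht⟩ K0
    · exact fun i s hs => LC.mono ⟨((h0 i).pd.1.DD t).DD s, n0, (h0 i).l2 s hs t ht⟩ K0
    · intro i j u s hs t' ht'
      exact LC.mb hp (((h0 j).pd.1.DD t).sh u) (fun q p => hlip j _ _)
        ⟨((h0 i).pd.1.DD t').DD s, n0, (h0 i).l2 s hs t' ht'⟩
    · intro i j u s hs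
      exact LC.mb hp (((h0 j).pd.1.DD t).sh u) (fun q p => hlip j _ _)
        ⟨(h0 i).pd.2.1.DD s, n0, (h0 i).q1 s hs⟩
    · intro i j s hs t' ht'
      rw [Rem_nil', d0, d0]; exact z
    · intro i j s hs
      rw [Remp, Rem_nil', Rem_nil', add_zero, d0]; exact z
  · intro k hk A hA1 hF ts hpos hsum hl i
    have hss : ∀ t ∈ ts, t ≤ τ := fun t ht =>
      (List.single_le_sum (fun x hx => (hpos x hx).le) t ht).trans hsum
    have hne : ts ≠ [] := by rintro rfl; simp at hl
    have hx1 : ∀ i, ∀ t ∈ Ioc 0 τ, XB p0 τ (DD t (W i)) (DD t (Wp i)) a1 := fun i t ht => by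
      rw [← hA1]
      exact hF i [t] (by simpa using ht.1) (by simpa using ht.2) (by simpa using hk)
    have hR : ∀ i j, XB p0 τ (Rem ts (W i) (W j)) (Remp ts (W i) (Wp i) (W j) (Wp j))
        (4 * cS p0 * rs (k + 1) A A) := fun i j =>
      XB_Rem hp hτ k τ _ _ _ _ _ _ (hF i) (hF j) ts hpos hsum hl
    have nR : 0 ≤ 4 * cS p0 * rs (k + 1) A A := (hR 0 0).nn
    have nR' : 0 ≤ rs (k + 1) A A := by
      by_contra hh
      push Not at hh
      have : 4 * cS p0 * rs (k + 1) A A < 0 := mul_neg_of_pos_of_neg (by positivity) hh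
      linarith
    match ts, hne with
    | t :: ts', _ =>
      have hl' : ts'.length = k := by simpa using hl
      have ht : t ∈ Ioc 0 τ := ⟨hpos t (by simp), hss t (by simp)⟩
      have hX : ∀ i, XB p0 τ (DL ts' (W i)) (DL ts' (Wp i)) (A k) := fun i => by
        have := hF i ts' (fun x hx => hpos x (by simp [hx])) (by
          simp only [List.sum_cons] at hsum; linarith [ht.1]) hl'.le
        rwa [hl'] at this
      have nA : 0 ≤ A k := (hX 0).nn
      have n3 : 0 ≤ cS p0 * a1 * A k := by positivity
      have n4 : 0 ≤ (1 + cS p0 * a1 + 4 * cS p0) * (A k + rs (k + 1) A A) := by positivity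
      have E : (1 + cS p0 * a1 + 4 * cS p0) * (A k + rs (k + 1) A A) = A k + rs (k + 1) A A +
        cS p0 * a1 * A k + cS p0 * a1 * rs (k + 1) A A + 4 * cS p0 * A k +
        4 * cS p0 * rs (k + 1) A A := by ring
      have n5 : 0 ≤ cS p0 * a1 * rs (k + 1) A A := by positivity
      have n6 : 0 ≤ 4 * cS p0 * A k := by positivity
      have l1 : A k ≤ (1 + cS p0 * a1 + 4 * cS p0) * (A k + rs (k + 1) A A) := by rw [E]; linarith
      have l2 : cS p0 * a1 * A k ≤ (1 + cS p0 * a1 + 4 * cS p0) * (A k + rs (k + 1) A A) := by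
        rw [E]; linarith
      have l3 : 4 * cS p0 * rs (k + 1) A A ≤
          (1 + cS p0 * a1 + 4 * cS p0) * (A k + rs (k + 1) A A) := by rw [E]; linarith
      have D0 : ∀ i, LC p0 (DL (t :: ts') (W i)) (A k) := fun i => by
        rw [DL_cons]; exact ⟨(hX i).pd.1.DD t, nA, (hX i).l1 t ht⟩
      have D0' : ∀ i, LC p0 (DL (t :: ts') (Wp i)) (A k) := fun i => by
        rw [DL_cons]; exact ⟨(hX i).pd.2.1.DD t, nA, (hX i).q1 t ht⟩
      rw [mul_assoc C]
      refine st (t :: ts') (by simp) hpos hsum _ ?_ ?_ ?_ ?_ ?_ ?_ ?_ i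
      · exact fun i => (D0 i).mono l1
      · exact fun i => (D0' i).mono l1
      · intro i s hs
        rw [DL_cons]
        exact LC.mono ⟨((hX i).pd.1.DD t).DD s, nA, (hX i).l2 s hs t ht⟩ l1
      · intro i j u s hs t' ht'
        have := hx1 i t' ht'
        refine LC.mono ⟨(this.pd.1.DD s).mul ((D0 j).c.sh u), n3, ?_⟩ l2
        have := LB.mix hp hτ (((h.pW j).DL (t :: ts')).sh u) (this.pd.1.DD s) ((D0 j).lb.sh u)
          ((D0' j).lb.sh u) (this.l1 s hs) (fun s' hs' => this.l2 s' hs' s hs)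
        rw [mul_comm]
        convert this using 1; ring
      · intro i j u s hs
        have := hx1 i s hs
        refine LC.mono ⟨this.pd.2.1.mul ((D0 j).c.sh u), n3, ?_⟩ l2
        have := LB.mix hp hτ (((h.pW j).DL (t :: ts')).sh u) this.pd.2.1 ((D0 j).lb.sh u)
          ((D0' j).lb.sh u) this.q0 (fun s' hs' => this.q1 s' hs')
        rw [mul_comm]
        convert this using 1; ring
      · intro i j s hs t' ht'
        have := hR i j
        exact LC.mono ⟨(this.pd.1.DD t').DD s, nR, this.l2 s hs t' ht'⟩ l3
      · intro i j s hs
        have := hR i j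
        exact LC.mono ⟨this.pd.2.1.DD s, nR, this.q1 s hs⟩ l3

theorem WFlow.all (h : WFlow p0 d Q K δ Y Uq W Wp rh bb cc) : ∃ τ > 0, ∃ M ≥ 1, ∃ R ≥ 1,
    ∀ ts : List ℝ, (∀ t ∈ ts, 0 < t) → ts.sum ≤ τ → ∀ i q, ∀ p ∈ Icc p0 0,
      |DL ts (W i) q p| ≤ M * R ^ ts.length * ts.length.factorial := by
  obtain ⟨τ, hτ, a1, ha1, a0, C, hC, x0, x1, st⟩ := h.recu
  have hp := h.hp
  have cp := cS_pos hp
  have n0 := (x0 0).nn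
  set m := 4 * a1 with hm
  set R := C * (4 + 8 * m) with hR
  have m4 : 4 ≤ m := by rw [hm]; linarith
  have R1 : 1 ≤ R := one_le_mul_of_one_le_of_one_le hC (by linarith)
  have R0 : 0 < R := by linarith
  set a := m / R with ha
  have a0' : 0 < a := by positivity
  set A' : ℕ → ℝ := fun j => a * R ^ j * eG 1 j with hA'
  set A : ℕ → ℝ := fun j => if j = 0 then a0 else A' j with hA
  have A'0 : ∀ j, 0 ≤ A' j := fun j => by have := eG_pos 1 j; simp only [hA']; positivity
  have A1 : A 1 = a1 := by
    simp only [hA, hA', one_ne_zero, if_false, eG, ha, hm]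
    field_simp
    norm_num
  have AA : ∀ j, 1 ≤ j → 0 ≤ A j ∧ A j ≤ A' j := fun j hj => by
    have : A j = A' j := by simp only [hA]; rw [if_neg (by omega)]
    rw [this]; exact ⟨A'0 j, le_rfl⟩
  have hrec : ∀ k ≥ 1, C * (A k + rs (k + 1) A A) ≤ A (k + 1) := by
    intro k hk
    have e1 : A k = A' k := by simp only [hA]; rw [if_neg (by omega)]
    have e2 : A (k + 1) = A' (k + 1) := by simp only [hA]; rw [if_neg (by omega)]
    have ep := eG_pos 1 (k + 1)
    have i1 : A' k ≤ a * R ^ k * (4 * eG 1 (k + 1)) := by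
      simp only [hA']
      gcongr
      simp only [eG, Real.rpow_one, Nat.factorial_succ]
      push_cast
      have f : (0:ℝ) < k.factorial := by exact_mod_cast k.factorial_pos
      rw [← mul_div_assoc, div_le_div_iff₀ (by positivity) (by positivity)]
      have k1 : (1:ℝ) ≤ k := by exact_mod_cast hk
      have : ((k:ℝ) + 1 + 1) ^ 2 ≤ 4 * (k + 1) * (k + 1) ^ 2 := by nlinarith [mul_nonneg (by linarith : (0:ℝ) ≤ k) (sq_nonneg (k + 1 : ℝ))]
      calc _ ≤ (k.factorial : ℝ) * (4 * (k + 1) * (k + 1) ^ 2) := by gcongr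
        _ = _ := by ring
    have i2 : rs (k + 1) A A ≤ a ^ 2 * R ^ (k + 1) * (8 * eG 1 (k + 1)) := by
      refine (rs_mono (k + 1) A A A' A' AA AA).2.trans ?_
      have := rs_eq k A' A'
      have p1 := mul_nonneg (A'0 0) (A'0 (k + 1))
      have p2 := mul_nonneg (A'0 (k + 1)) (A'0 0)
      have c := conv_le (le_refl (1:ℝ)) (k + 1) 0
      have e : ∑ ij ∈ Finset.HasAntidiagonal.antidiagonal (k + 1), ((k + 1).choose ij.1 : ℝ) *
          (A' ij.1 * A' ij.2) = a ^ 2 * R ^ (k + 1) *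
          ∑ ij ∈ Finset.HasAntidiagonal.antidiagonal (k + 1), ((k + 1).choose ij.1 : ℝ) *
          (eG 1 ij.1 * eG 1 (ij.2 + 0)) := by
        rw [Finset.mul_sum]
        refine Finset.sum_congr rfl fun ij hij => ?_
        rw [Finset.HasAntidiagonal.mem_antidiagonal] at hij
        rw [← hij, pow_add]; simp only [hA', add_zero]; ring
      calc rs (k + 1) A' A' ≤ _ := by linarith
        _ = _ := e
        _ ≤ _ := by gcongr
    rw [e1, e2]
    have aR : a * R = m := by rw [ha]; field_simp
    calc C * (A' k + rs (k + 1) A A) ≤ C * (a * R ^ k * (4 * eG 1 (k + 1))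
        + a ^ 2 * R ^ (k + 1) * (8 * eG 1 (k + 1))) := by gcongr
      _ = a * R ^ k * eG 1 (k + 1) * (C * (4 + 8 * (a * R))) := by ring
      _ = _ := by rw [aR, ← hR]; simp only [hA']; ring
  have F : ∀ n, ∀ i, Fm p0 τ τ n (W i) (Wp i) A := by
    intro n
    induction n with
    | zero =>
      intro i ts _ _ hl
      have : ts = [] := List.length_eq_zero_iff.mp (by omega)
      subst this
      simpa [hA, DL] using x0 i
    | succ k ih =>
      intro i ts h1 h2 hl
      rcases Nat.lt_or_ge ts.length (k + 1) with hh | hh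
      · exact ih i ts h1 h2 (by omega)
      have hl2 : ts.length = k + 1 := by omega
      rw [hl2]
      rcases Nat.eq_zero_or_pos k with rfl | hk
      · obtain ⟨t, rfl⟩ := List.length_eq_one_iff.mp hl2
        rw [zero_add, A1]
        exact x1 i t ⟨h1 t (by simp), by simpa using h2⟩
      · exact (st k hk A A1 ih ts h1 h2 hl2 i).mono (hrec k hk)
  have eG1 : ∀ n : ℕ, eG 1 n ≤ n.factorial := fun n => by
    simp only [eG, Real.rpow_one]
    refine div_le_self (by positivity) (one_le_pow₀ ?_)
    linarith [(Nat.cast_nonneg n : (0:ℝ) ≤ n)]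
  refine ⟨τ, hτ, cS p0 * (a0 + a) + 1, ?_, R, R1, ?_⟩
  · have : 0 ≤ cS p0 * (a0 + a) := by positivity
    linarith
  · intro ts h1 h2 i q p hpp
    have := (F ts.length i ts h1 h2 le_rfl).sup hp hτ q p hpp
    refine this.trans ?_
    have f : (1:ℝ) ≤ ts.length.factorial := by exact_mod_cast ts.length.factorial_pos
    have hA2 : A ts.length ≤ (a0 + a) * (R ^ ts.length * ts.length.factorial) := by
      have g : 1 ≤ R ^ ts.length * (ts.length.factorial : ℝ) :=
        one_le_mul_of_one_le_of_one_le (one_le_pow₀ R1) f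
      have g1 := le_mul_of_one_le_right n0 g
      have g2 : A' ts.length ≤ a * (R ^ ts.length * ts.length.factorial) := by
        simp only [hA']; rw [mul_assoc]; gcongr; exact eG1 _
      have g3 : 0 ≤ a * (R ^ ts.length * ts.length.factorial) := by positivity
      simp only [hA]
      split_ifs
      · rw [add_mul]; linarith
      · have g4 := mul_nonneg n0 (g.trans' zero_le_one)
        rw [add_mul]; linarith
    calc cS p0 * A ts.length ≤ cS p0 * ((a0 + a) * (R ^ ts.length * ts.length.factorial)) := by gcongr
      _ ≤ _ := by
        have : 0 ≤ R ^ ts.length * (ts.length.factorial : ℝ) := by positivity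
        linarith
end

end

section

open MeasureTheory Filter Topology

theorem taylor01 (n : ℕ) (φ : ℕ → ℝ → ℝ) (B : ℝ)
    (hd : ∀ k, ∀ t ∈ Icc (0:ℝ) 1, HasDerivWithinAt (φ k) (φ (k + 1) t) (Icc 0 1) t)
    (hB : ∀ t ∈ Icc (0:ℝ) 1, |φ n t| ≤ B) : ∀ t ∈ Icc (0:ℝ) 1,
    |φ 0 t - ∑ k ∈ Finset.range n, φ k 0 * t ^ k / k.factorial| ≤ B * t ^ n / n.factorial := by
  induction n generalizing φ with
  | zero => intro t ht; simpa using hB t ht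
  | succ n ih =>
    have ih' := ih (fun k => φ (k + 1)) (fun k => hd (k + 1)) hB
    have hs : ∀ t : ℝ, HasDerivAt (fun t => ∑ k ∈ Finset.range (n + 1), φ k 0 * t ^ k / k.factorial)
        (∑ k ∈ Finset.range n, φ (k + 1) 0 * t ^ k / k.factorial) t := by
      intro t
      have : ∀ k ∈ Finset.range (n + 1), HasDerivAt (fun t => φ k 0 * t ^ k / k.factorial)
          (φ k 0 * (k * t ^ (k - 1)) / k.factorial) t := fun k _ =>
        ((hasDerivAt_pow k t).const_mul _).div_const _
      have := HasDerivAt.fun_sum this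
      rw [Finset.sum_range_succ'] at this
      refine this.congr_deriv ?_
      simp only [Nat.cast_zero, zero_mul, mul_zero, zero_div, add_zero, Nat.add_sub_cancel]
      refine Finset.sum_congr rfl fun k _ => ?_
      rw [Nat.factorial_succ]; push_cast
      have : (k.factorial : ℝ) ≠ 0 := by exact_mod_cast k.factorial_ne_zero
      field_simp
    have hcont : ContinuousOn (fun t => φ 0 t - ∑ k ∈ Finset.range (n + 1), φ k 0 * t ^ k / k.factorial)
        (Icc 0 1) := fun t ht => ((hd 0 t ht).sub (hs t).hasDerivWithinAt).continuousWithinAt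
    have hb : ∀ t : ℝ, HasDerivAt (fun t => B * t ^ (n + 1) / (n + 1).factorial)
        (B * t ^ n / n.factorial) t := by
      intro t
      refine (((hasDerivAt_pow (n + 1) t).const_mul B).div_const ((n + 1).factorial : ℝ)).congr_deriv ?_
      rw [Nat.factorial_succ]; push_cast
      have : (n.factorial : ℝ) ≠ 0 := by exact_mod_cast n.factorial_ne_zero
      field_simp
    intro t ht
    refine image_norm_le_of_norm_deriv_right_le_deriv_boundary hcont
      (f' := fun t => φ 1 t - ∑ k ∈ Finset.range n, φ (k + 1) 0 * t ^ k / k.factorial) ?_ ?_ hb ?_ ht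
    · intro x hx
      have := (hd 0 x ⟨hx.1, hx.2.le⟩).sub (hs x).hasDerivWithinAt
      exact (this.mono_of_mem_nhdsWithin (Icc_mem_nhdsGE_of_mem hx))
    · rw [Finset.sum_range_succ']; simp
    · intro x hx; exact ih' x ⟨hx.1, hx.2.le⟩

theorem analytic1 (g : ℕ → ℝ → ℝ) {M R : ℝ} (hM : 0 ≤ M) (hR : 0 < R)
    (hd : ∀ k x, HasDerivAt (g k) (g (k + 1) x) x)
    (hB : ∀ k x, |g k x| ≤ M * R ^ k * k.factorial) : AnalyticOnNhd ℝ (g 0) univ := by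
  intro x _
  refine ⟨fun k => ContinuousMultilinearMap.mkPiRing ℝ (Fin k) (g k x / k.factorial),
    hasFPowerSeriesAt_iff.mpr ?_⟩
  have hr : (0:ℝ) < R⁻¹ := by positivity
  filter_upwards [Metric.ball_mem_nhds (0:ℝ) hr] with z hz
  have hz' : R * |z| < 1 := by
    rw [mem_ball_zero_iff, Real.norm_eq_abs] at hz
    calc R * |z| < R * R⁻¹ := by gcongr
      _ = 1 := by field_simp
  have hq0 : 0 ≤ R * |z| := by positivity
  have key : ∀ n, |g 0 (x + z) - ∑ k ∈ Finset.range n, z ^ k • (g k x / k.factorial)| ≤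
      M * (R * |z|) ^ n := by
    intro n
    have hk : ∀ k, ∀ t : ℝ, HasDerivAt (fun t => z ^ k * g k (x + t * z)) (z ^ (k + 1) * g (k + 1) (x + t * z)) t := by
      intro k t
      have h1 : HasDerivAt (fun t => x + t * z) z t := by
        simpa using ((hasDerivAt_id t).mul_const z).const_add x
      refine (((hd k (x + t * z)).comp t h1).const_mul (z ^ k)).congr_deriv ?_
      ring
    have := taylor01 n (fun k t => z ^ k * g k (x + t * z)) (|z| ^ n * (M * R ^ n * n.factorial))
      (fun k t _ => (hk k t).hasDerivWithinAt) (fun t _ => by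
        rw [abs_mul, abs_pow]; gcongr; exact hB _ _) 1 (by simp)
    have f : (n.factorial : ℝ) ≠ 0 := by exact_mod_cast n.factorial_ne_zero
    convert this using 1
    · congr 2
      · simp
      · refine Finset.sum_congr rfl fun k _ => ?_
        simp; ring
    · rw [mul_pow, one_pow]; field_simp
  have hsum : Summable fun n => z ^ n • (g n x / n.factorial) := by
    refine Summable.of_norm_bounded (g := fun n => M * (R * |z|) ^ n)
      ((summable_geometric_of_lt_one hq0 hz').mul_left M) fun n => ?_
    have f : (0:ℝ) < n.factorial := by exact_mod_cast n.factorial_pos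
    rw [norm_smul, norm_pow, Real.norm_eq_abs, Real.norm_eq_abs, abs_div, Nat.abs_cast, mul_pow]
    rw [← mul_div_assoc, div_le_iff₀ f]
    calc _ ≤ |z| ^ n * (M * R ^ n * n.factorial) := by gcongr; exact hB _ _
      _ = _ := by ring
  have : HasSum (fun n => z ^ n • (g n x / n.factorial)) (g 0 (x + z)) := by
    rw [hsum.hasSum_iff_tendsto_nat, tendsto_iff_norm_sub_tendsto_zero]
    refine squeeze_zero (fun _ => norm_nonneg _) (fun n => ?_)
      (show Tendsto (fun n => M * (R * |z|) ^ n) atTop (𝓝 0) by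
        simpa using (tendsto_pow_atTop_nhds_zero_of_lt_one hq0 hz').const_mul M)
    rw [norm_sub_rev]; exact key n
  simpa [FormalMultilinearSeries.coeff] using this

def DB (p0 τ : ℝ) (A : ℕ → ℝ) (f : ℝ → ℝ → ℝ) : Prop :=
  CB f ∧ ∀ ts : List ℝ, (∀ t ∈ ts, 0 < t) → ts.sum < τ → ∀ q, ∀ p ∈ Icc p0 0,
    |DL ts f q p| ≤ A ts.length

def QS (p0 : ℝ) (f fq : ℝ → ℝ → ℝ) : Prop :=
  ∀ p ∈ Icc p0 0, ∀ q, HasDerivAt (fun q => f q p) (fq q p) q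

def clp (p0 p : ℝ) : ℝ := max p0 (min p 0)
theorem clp_mem {p0 : ℝ} (hp : p0 ≤ 0) (p : ℝ) : clp p0 p ∈ Icc p0 0 :=
  ⟨le_max_left _ _, max_le hp (min_le_right _ _)⟩
theorem clp_eq {p0 p : ℝ} (h : p ∈ Icc p0 0) : clp p0 p = p := by
  simp [clp, h.1, h.2]
theorem clp_cont (p0 : ℝ) : Continuous (clp p0) := by unfold clp; fun_prop

theorem DB.step {p0 τ : ℝ} {A f} (hp : p0 < 0) (hτ : 0 < τ) (h : DB p0 τ A f) :
    ∃ fq, QS p0 f fq ∧ DB p0 τ (fun k => A (k + 1)) fq := by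
  obtain ⟨hc, hb⟩ := h
  set s : ℕ → ℝ := fun n => τ / 4 * (1 / 2) ^ n with hs
  have s0 : ∀ n, 0 < s n := fun n => by simp only [hs]; positivity
  have sl : Tendsto s atTop (𝓝 0) := by
    have := (tendsto_pow_atTop_nhds_zero_of_lt_one (r := (1/2:ℝ)) (by norm_num) (by norm_num)).const_mul (τ / 4)
    rwa [mul_zero] at this
  have s1 : ∀ n, s n ≤ τ / 4 := fun n => by
    have : (1 / 2 : ℝ) ^ n ≤ 1 := pow_le_one₀ (by norm_num) (by norm_num)
    simp only [hs]; nlinarith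
  have ss : ∀ n, s n = 2 * s (n + 1) := fun n => by simp only [hs, pow_succ]; ring
  set G : ℕ → ℝ → ℝ → ℝ := fun n q p => DD (s n) f q (clp p0 p) with hG
  have A2 : 0 ≤ A 2 := (abs_nonneg _).trans (hb [τ/4, τ/4] (by simp; positivity) (by simp; linarith) 0 0 ⟨hp.le, le_rfl⟩)
  have hdist : ∀ q p n, dist (G n q p) (G (n + 1) q p) ≤ A 2 * τ * (1 / 2) ^ n := by
    intro q p n
    have b := hb [s (n+1), s (n+1)] (by simp [s0]) (by simp; linarith [s1 (n + 1)]) q _ (clp_mem hp.le p)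
    have e : G n q p - G (n + 1) q p = s (n + 1) / 2 * DL [s (n+1), s (n+1)] f q (clp p0 p) := by
      have := (s0 (n + 1)).ne'
      simp only [hG, DL, DD, ss n]
      rw [show q + 2 * s (n + 1) = q + s (n + 1) + s (n + 1) by ring]
      field_simp
      ring
    rw [Real.dist_eq, e, abs_mul, abs_of_pos (by linarith [s0 (n + 1)])]
    calc _ ≤ s (n + 1) / 2 * A 2 := mul_le_mul_of_nonneg_left b (by linarith [s0 (n + 1)])
      _ ≤ (τ * (1/2) ^ n) * A 2 := by
        gcongr
        simp only [hs, pow_succ]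
        have : 0 ≤ τ * (1 / 2) ^ n := by positivity
        linarith
      _ = _ := by ring
  have hcau : ∀ q p, ∃ l, Tendsto (fun n => G n q p) atTop (𝓝 l) := fun q p =>
    cauchySeq_tendsto_of_complete (cauchySeq_of_le_geometric (1/2) (A 2 * τ) (by norm_num) (hdist q p))
  choose h hh using hcau
  have hub : ∀ q p n, dist (G n q p) (h q p) ≤ A 2 * τ * (1 / 2) ^ n / (1 - 1 / 2) := fun q p n =>
    dist_le_of_le_geometric_of_tendsto (1/2) (A 2 * τ) (by norm_num) (hdist q p) (hh q p) n
  have hun : TendstoUniformly (fun n (z : ℝ × ℝ) => G n z.1 z.2) (fun z => h z.1 z.2) atTop := by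
    rw [Metric.tendstoUniformly_iff]
    intro ε hε
    have : Tendsto (fun n : ℕ => A 2 * τ * (1 / 2 : ℝ) ^ n / (1 - 1 / 2)) atTop (𝓝 0) := by
      have := ((tendsto_pow_atTop_nhds_zero_of_lt_one (r := (1/2:ℝ)) (by norm_num) (by norm_num)).const_mul (A 2 * τ)).div_const (1 - 1/2)
      rwa [mul_zero, zero_div] at this
    filter_upwards [this.eventually (gt_mem_nhds hε)] with n hn z
    rw [dist_comm]
    exact (hub z.1 z.2 n).trans_lt hn
  have hGc : ∀ n, Continuous (fun z : ℝ × ℝ => G n z.1 z.2) := fun n =>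
    (hc.DD (s n)).1.comp (continuous_fst.prodMk ((clp_cont p0).comp continuous_snd))
  have hA1 : ∀ q p, |h q p| ≤ A 1 := by
    intro q p
    refine le_of_tendsto (hh q p).abs (Eventually.of_forall fun n => ?_)
    exact hb [s n] (by simp [s0]) (by simp; linarith [s1 n]) q _ (clp_mem hp.le p)
  refine ⟨h, ?_, ⟨hun.continuous (Frequently.of_forall hGc), A 1, hA1⟩, ?_⟩
  · intro p hpp q
    have fc := hc.cont_q p
    refine hasDerivAt_of_tendstoUniformly (l := atTop) (f := fun n q => (∫ x in q..(q + s n), f x p) / s n)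
      (f' := fun n q => G n q p) (g' := fun q => h q p) ?_ (Eventually.of_forall fun n x => ?_) (fun x => ?_) q
    · rw [Metric.tendstoUniformly_iff] at hun ⊢
      intro ε hε
      filter_upwards [hun ε hε] with n hn x using hn (x, p)
    · have i1 : ∀ y, HasDerivAt (fun u => ∫ x in (0:ℝ)..u, f x p) (f y p) y := fun y =>
        intervalIntegral.integral_hasDerivAt_right (fc.intervalIntegrable _ _)
          (fc.stronglyMeasurableAtFilter _ _) fc.continuousAt
      have e : (fun q => (∫ x in q..(q + s n), f x p) / s n) =
          fun q => ((∫ x in (0:ℝ)..(q + s n), f x p) - ∫ x in (0:ℝ)..q, f x p) / s n := by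
        funext q
        rw [intervalIntegral.integral_interval_sub_left (fc.intervalIntegrable _ _) (fc.intervalIntegrable _ _)]
      rw [e]
      simp only [hG, DD, clp_eq hpp]
      exact (((i1 (x + s n)).comp_add_const x (s n)).sub (i1 x)).div_const _
    · have i1 : HasDerivAt (fun u => ∫ y in x..u, f y p) (f x p) x :=
        intervalIntegral.integral_hasDerivAt_right (fc.intervalIntegrable _ _)
          (fc.stronglyMeasurableAtFilter _ _) fc.continuousAt
      have i2 := i1.tendsto_slope_zero.comp (tendsto_nhdsWithin_iff.mpr ⟨sl, Eventually.of_forall fun n => (s0 n).ne'⟩)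
      refine i2.congr fun n => ?_
      simp [div_eq_inv_mul]
  · intro ts hpos hsum q p hpp
    have key : ∀ (ts : List ℝ) q, Tendsto (fun n => DL ts (DD (s n) f) q p) atTop (𝓝 (DL ts h q p)) := by
      intro ts
      induction ts with
      | nil =>
        intro q
        have := hh q p
        simp only [hG, clp_eq hpp] at this
        exact this
      | cons t ts ih =>
        intro q
        rw [DL_cons]
        simp only [DL_cons, DD]
        exact ((ih _).sub (ih _)).div_const _
    refine le_of_tendsto (key ts q).abs ?_
    filter_upwards [sl.eventually (gt_mem_nhds (sub_pos.mpr hsum))] with n hn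
    have := hb (s n :: ts) (by simpa [s0] using hpos) (by simp; linarith) q p hpp
    simpa [DL] using this

theorem DB.seq {p0 τ : ℝ} {A f} (hp : p0 < 0) (hτ : 0 < τ) (h : DB p0 τ A f) :
    ∃ g : ℕ → ℝ → ℝ → ℝ, g 0 = f ∧ (∀ k, QS p0 (g k) (g (k + 1))) ∧ ∀ k, CB (g k) ∧
      ∀ q, ∀ p ∈ Icc p0 0, |g k q p| ≤ A k := by
  have st : ∀ k f, ∃ fq, DB p0 τ (fun j => A (j + k)) f → QS p0 f fq ∧ DB p0 τ (fun j => A (j + (k + 1))) fq := by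
    intro k f
    by_cases hf : DB p0 τ (fun j => A (j + k)) f
    · obtain ⟨fq, h1, h2⟩ := hf.step hp hτ
      refine ⟨fq, fun _ => ⟨h1, ?_⟩⟩
      simpa only [add_assoc, add_comm 1 k] using h2
    · exact ⟨f, fun h => absurd h hf⟩
  choose F hF using st
  set g : ℕ → ℝ → ℝ → ℝ := fun n => Nat.rec f (fun k f => F k f) n with hg
  have hD : ∀ k, DB p0 τ (fun j => A (j + k)) (g k) := by
    intro k
    induction k with
    | zero => exact h
    | succ k ih => exact (hF k _ ih).2
  refine ⟨g, rfl, fun k => (hF k _ (hD k)).1, fun k => ⟨(hD k).1, fun q p hpp => ?_⟩⟩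
  simpa [DL] using (hD k).2 [] (by simp) (by simpa using hτ) q p hpp

end

section

open MeasureTheory Filter Topology

def PS (p0 : ℝ) (f fp : ℝ → ℝ → ℝ) : Prop :=
  ∀ q, ∀ p ∈ Icc p0 0, HasDerivWithinAt (f q) (fp q p) (Icc p0 0) p

theorem PS_of_int {p0 : ℝ} {f fp : ℝ → ℝ → ℝ} (hc : CB fp)
    (h : ∀ q, ∀ p ∈ Icc p0 0, f q p = f q p0 + ∫ r in p0..p, fp q r) : PS p0 f fp := by
  intro q p hp
  have fc := hc.cont_p q
  have i1 : HasDerivAt (fun u => f q p0 + ∫ r in p0..u, fp q r) (fp q p) p :=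
    (intervalIntegral.integral_hasDerivAt_right (fc.intervalIntegrable _ _)
      (fc.stronglyMeasurableAtFilter _ _) fc.continuousAt).const_add _
  exact i1.hasDerivWithinAt.congr (fun x hx => h q x hx) (h q p hp)

theorem PD.PS {p0 f fp} (h : PD p0 f fp) : PS p0 f fp := by
  refine PS_of_int h.2.1 fun q p hp => ?_
  rw [intervalIntegral.integral_eq_sub_of_hasDerivAt_of_le hp.1 (h.1.cont_p q).continuousOn
    (fun x hx => h.2.2 q x ⟨hx.1, hx.2.trans_le hp.2⟩) (h.2.1.ii q _ _)]
  ring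

theorem QD.QS {p0 f fq} (hp0 : p0 < 0) (hf : CB f) (hq : CB fq) (h : QD p0 f fq) : QS p0 f fq := by
  have key : ∀ p ∈ Icc p0 0, ∀ q, f q p = f 0 p + ∫ r in (0:ℝ)..q, fq r p := by
    intro p hp q
    rw [← closure_Ioo hp0.ne] at hp
    refine closure_minimal (s := Ioo p0 0) (t := {p | f q p = f 0 p + ∫ r in (0:ℝ)..q, fq r p})
      (fun p hp => ?_) (isClosed_eq (hf.cont_p q) ((hf.cont_p 0).add ?_)) hp
    · show f q p = _
      rw [intervalIntegral.integral_eq_sub_of_hasDerivAt (fun x _ => h p hp x)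
        ((hq.cont_q p).intervalIntegrable _ _)]
      ring
    · apply intervalIntegral.continuous_parametric_intervalIntegral_of_continuous'
      exact hq.1.comp (by fun_prop : Continuous (fun z : ℝ × ℝ => ((z.2, z.1) : ℝ × ℝ)))
  intro p hp q
  have fc := hq.cont_q p
  have i1 : HasDerivAt (fun u => f 0 p + ∫ r in (0:ℝ)..u, fq r p) (fq q p) q :=
    (intervalIntegral.integral_hasDerivAt_right (fc.intervalIntegrable _ _)
      (fc.stronglyMeasurableAtFilter _ _) fc.continuousAt).const_add _
  exact i1.congr_of_eventuallyEq (Eventually.of_forall fun x => key p hp x)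

theorem swap_pq {p0 : ℝ} {f fp fq fpq : ℝ → ℝ → ℝ} (hf : CB f) (hfp : CB fp) (hfpq : CB fpq)
    (h1 : PS p0 f fp) (h2 : QS p0 f fq) (h3 : QS p0 fp fpq) : PS p0 fq fpq := by
  refine PS_of_int hfpq fun q p hp => ?_
  obtain ⟨K, hK⟩ := hfpq.2
  have hp0 : p0 ∈ Icc p0 0 := ⟨le_rfl, hp.1.trans hp.2⟩
  have e : ∀ q, f q p = f q p0 + ∫ r in p0..p, fp q r := fun q => by
    rw [intervalIntegral.integral_eq_sub_of_hasDerivAt_of_le hp.1 (hf.cont_p q).continuousOn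
      (fun x hx => ((h1 q x ⟨hx.1.le, hx.2.le.trans hp.2⟩).hasDerivAt
        (Icc_mem_nhds hx.1 (hx.2.trans_le hp.2)))) (hfp.ii q _ _)]
    ring
  have i := (intervalIntegral.hasDerivAt_integral_of_dominated_loc_of_deriv_le (μ := volume)
    (a := p0) (b := p) (F := fp) (F' := fpq) (x₀ := q) (s := univ) (bound := fun _ => K) univ_mem
    (Eventually.of_forall fun x => (hfp.cont_p x).aestronglyMeasurable) (hfp.ii q _ _)
    (hfpq.cont_p q).aestronglyMeasurable (Eventually.of_forall fun t _ x _ => hK x t)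
    intervalIntegrable_const (Eventually.of_forall fun t ht x _ => h3 t (by
      rw [uIoc_of_le hp.1] at ht; exact ⟨ht.1.le, ht.2.trans hp.2⟩) x)).2
  have j := ((h2 p0 hp0 q).add i).congr_of_eventuallyEq (Eventually.of_forall fun x => e x)
  exact (h2 p hp q).unique j

theorem QS.add {p0 f fq g gq} (h : QS p0 f fq) (h' : QS p0 g gq) : QS p0 (f + g) (fq + gq) :=
  fun p hp q => (h p hp q).add (h' p hp q)
theorem QS.mul {p0 f fq g gq} (h : QS p0 f fq) (h' : QS p0 g gq) : QS p0 (f * g) (fq * g + f * gq) :=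
  fun p hp q => (h p hp q).mul (h' p hp q)
theorem PS.add {p0 f fq g gq} (h : PS p0 f fq) (h' : PS p0 g gq) : PS p0 (f + g) (fq + gq) :=
  fun q p hp => (h q p hp).add (h' q p hp)
theorem PS.mul {p0 f fq g gq} (h : PS p0 f fq) (h' : PS p0 g gq) : PS p0 (f * g) (fq * g + f * gq) :=
  fun q p hp => (h q p hp).mul (h' q p hp)
theorem QS.neg {p0 f fq} (h : QS p0 f fq) : QS p0 (-f) (-fq) := fun p hp q => (h p hp q).neg
theorem PS.neg {p0 f fq} (h : PS p0 f fq) : PS p0 (-f) (-fq) := fun q p hp => (h q p hp).neg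

/-- clamped in p -/
def Cl (p0 : ℝ) (f : ℝ → ℝ → ℝ) : Prop := ∀ q p, f q p = f q (clp p0 p)

def Bs (p0 : ℝ) (F : ℝ → ℝ → ℝ) (M : ℝ) : Prop := CB F ∧ Cl p0 F ∧ ∀ q p, |F q p| ≤ M

theorem QS.uniq {p0 : ℝ} (hp : p0 ≤ 0) {f a b : ℝ → ℝ → ℝ} (h : QS p0 f a) (h' : QS p0 f b) (ha : Cl p0 a) (hb : Cl p0 b) :
    a = b := by
  funext q p
  rw [ha, hb]
  exact (h _ (clp_mem hp p) q).unique (h' _ (clp_mem hp p) q)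
theorem PS.uniq {p0 : ℝ} (hp : p0 < 0) {f a b : ℝ → ℝ → ℝ} (h : PS p0 f a) (h' : PS p0 f b) (ha : Cl p0 a) (hb : Cl p0 b) :
    a = b := by
  funext q p
  rw [ha, hb]
  have m := clp_mem hp.le p
  exact (uniqueDiffOn_Icc hp _ m).eq_deriv _ (h q _ m) (h' q _ m)

def Gv (p0 R S : ℝ) : ℕ → ℕ → (ℝ → ℝ → ℝ) → (ℕ → ℝ) → Prop
  | 0, _, F, B => Bs p0 F (B 0)
  | n + 1, b, F, B => Bs p0 F (B 0) ∧
      (∃ Fq, QS p0 F Fq ∧ Gv p0 R S n b Fq (fun k => R * B (k + 1))) ∧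
      (1 ≤ b → ∃ Fp, PS p0 F Fp ∧ Gv p0 R S n (b - 1) Fp (fun k => S * B (k + 1)))

theorem Gv.base {p0 R S n b F B} (h : Gv p0 R S n b F B) : Bs p0 F (B 0) := by
  cases n with
  | zero => exact h
  | succ n => exact h.1

theorem Gv.mono {p0 R S : ℝ} (hR : 0 ≤ R) (hS : 0 ≤ S) {n b F B B'} (h : Gv p0 R S n b F B)
    (hB : ∀ k, B k ≤ B' k) : Gv p0 R S n b F B' := by
  induction n generalizing b F B B' with
  | zero => exact ⟨h.1, h.2.1, fun q p => (h.2.2 q p).trans (hB 0)⟩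
  | succ n ih =>
    obtain ⟨h0, ⟨Fq, hq, h1⟩, h2⟩ := h
    refine ⟨⟨h0.1, h0.2.1, fun q p => (h0.2.2 q p).trans (hB 0)⟩, ⟨Fq, hq, ih h1 fun k => ?_⟩, fun hb => ?_⟩
    · exact mul_le_mul_of_nonneg_left (hB _) hR
    · obtain ⟨Fp, hp, h3⟩ := h2 hb
      exact ⟨Fp, hp, ih h3 fun k => mul_le_mul_of_nonneg_left (hB _) hS⟩

theorem Gv.down {p0 R S n b F B} (h : Gv p0 R S (n + 1) b F B) : Gv p0 R S n b F B := by
  induction n generalizing b F B with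
  | zero => exact h.1
  | succ n ih =>
    obtain ⟨h0, ⟨Fq, hq, h1⟩, h2⟩ := h
    refine ⟨h0, ⟨Fq, hq, ih h1⟩, fun hb => ?_⟩
    obtain ⟨Fp, hp, h3⟩ := h2 hb
    exact ⟨Fp, hp, ih h3⟩

theorem Gv.add {p0 R S n b F B G A} (h : Gv p0 R S n b F B) (h' : Gv p0 R S n b G A) :
    Gv p0 R S n b (F + G) (B + A) := by
  have hb : Bs p0 (F + G) ((B + A) 0) := by
    have a := h.base
    have b := h'.base
    exact ⟨a.1.add b.1, fun q p => by simp only [Pi.add_apply, ← a.2.1 q p, ← b.2.1 q p],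
      fun q p => (abs_add_le _ _).trans (add_le_add (a.2.2 q p) (b.2.2 q p))⟩
  induction n generalizing b F B G A with
  | zero => exact hb
  | succ n ih =>
    obtain ⟨h0, ⟨Fq, hq, h1⟩, h2⟩ := h
    obtain ⟨h0', ⟨Gq, hq', h1'⟩, h2'⟩ := h'
    have hb' : ∀ {b F B G A}, Gv p0 R S n b F B → Gv p0 R S n b G A → Bs p0 (F + G) ((B + A) 0) := by
      intro _ _ _ _ _ h h'
      have a := h.base
      have b := h'.base
      exact ⟨a.1.add b.1, fun q p => by simp only [Pi.add_apply, ← a.2.1 q p, ← b.2.1 q p],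
        fun q p => (abs_add_le _ _).trans (add_le_add (a.2.2 q p) (b.2.2 q p))⟩
    refine ⟨hb, ⟨Fq + Gq, hq.add hq', ?_⟩, fun hb => ?_⟩
    · have := ih h1 h1' (hb' h1 h1')
      convert this using 2
      simp only [Pi.add_apply]; ring
    · obtain ⟨Fp, hp, h3⟩ := h2 hb
      obtain ⟨Gp, hp', h3'⟩ := h2' hb
      refine ⟨Fp + Gp, hp.add hp', ?_⟩
      have := ih h3 h3' (hb' h3 h3')
      convert this using 2
      simp only [Pi.add_apply]; ring

theorem Gv.neg {p0 R S n b F B} (h : Gv p0 R S n b F B) : Gv p0 R S n b (-F) B := by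
  have hb : ∀ {F M}, Bs p0 F M → Bs p0 (-F) M := by
    intro F M a
    exact ⟨a.1.neg, fun q p => by simp only [Pi.neg_apply, ← a.2.1 q p], fun q p => by
      simpa using a.2.2 q p⟩
  induction n generalizing b F B with
  | zero => exact hb h
  | succ n ih =>
    obtain ⟨h0, ⟨Fq, hq, h1⟩, h2⟩ := h
    refine ⟨hb h0, ⟨-Fq, hq.neg, ih h1⟩, fun hb => ?_⟩
    obtain ⟨Fp, hp, h3⟩ := h2 hb
    exact ⟨-Fp, hp.neg, ih h3⟩

theorem Gv.sub {p0 R S n b F B G A} (h : Gv p0 R S n b F B) (h' : Gv p0 R S n b G A) :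
    Gv p0 R S n b (F - G) (B + A) := by
  rw [sub_eq_add_neg]; exact h.add h'.neg

def cv (A B : ℕ → ℝ) (k : ℕ) : ℝ :=
  ∑ ij ∈ Finset.HasAntidiagonal.antidiagonal k, (k.choose ij.1 : ℝ) * (A ij.1 * B ij.2)

theorem cv_succ (A B : ℕ → ℝ) (k : ℕ) :
    cv A B (k + 1) = cv (fun j => A (j + 1)) B k + cv A (fun j => B (j + 1)) k := by
  unfold cv
  rw [Finset.sum_antidiagonal_choose_succ_mul (fun i j => A i * B j), add_comm]
  congr 1
  refine Finset.sum_congr rfl fun ij h => ?_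
  rw [Finset.HasAntidiagonal.mem_antidiagonal] at h
  rw [← Nat.choose_symm_of_eq_add h.symm]

theorem cv_smul (A B : ℕ → ℝ) (c : ℝ) (k : ℕ) : cv (fun j => c * A j) B k = c * cv A B k ∧
    cv A (fun j => c * B j) k = c * cv A B k := by
  unfold cv
  constructor <;>
  · rw [Finset.mul_sum]
    exact Finset.sum_congr rfl fun _ _ => by ring

theorem Gv.mul {p0 R S n b F B G A} (h : Gv p0 R S n b F A) (h' : Gv p0 R S n b G B) :
    Gv p0 R S n b (F * G) (cv A B) := by
  have hb : ∀ {n b F B G A}, Gv p0 R S n b F A → Gv p0 R S n b G B → Bs p0 (F * G) (cv A B 0) := by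
    intro _ _ _ _ _ _ h h'
    have a := h.base
    have b := h'.base
    refine ⟨a.1.mul b.1, fun q p => by simp only [Pi.mul_apply, ← a.2.1 q p, ← b.2.1 q p],
      fun q p => ?_⟩
    simp only [cv, Finset.Nat.antidiagonal_zero, Finset.sum_singleton, Nat.choose_self, Nat.cast_one, one_mul,
      Pi.mul_apply, abs_mul]
    exact mul_le_mul (a.2.2 q p) (b.2.2 q p) (abs_nonneg _) ((abs_nonneg _).trans (a.2.2 q p))
  induction n generalizing b F B G A with
  | zero => exact hb h h'
  | succ n ih =>
    have hd := h.down
    have hd' := h'.down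
    refine ⟨hb h h', ?_, fun hb => ?_⟩
    · obtain ⟨h0, ⟨Fq, hq, h1⟩, h2⟩ := h
      obtain ⟨h0', ⟨Gq, hq', h1'⟩, h2'⟩ := h'
      refine ⟨_, hq.mul hq', ?_⟩
      have := (ih h1 hd').add (ih hd h1')
      convert this using 2 with k
      rw [cv_succ, Pi.add_apply, (cv_smul _ _ _ _).1, (cv_smul _ _ _ _).2]; ring
    · obtain ⟨Fp, hp, h3⟩ := h.2.2 hb
      obtain ⟨Gp, hp', h3'⟩ := h'.2.2 hb
      refine ⟨_, hp.mul hp', ?_⟩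
      have lo : ∀ {n b F B}, Gv p0 R S n b F B → Gv p0 R S n (b - 1) F B := by
        intro n
        induction n with
        | zero => intro b F B h; exact h
        | succ n ih =>
          intro b F B h
          obtain ⟨h0, ⟨Fq, hq, h1⟩, h2⟩ := h
          refine ⟨h0, ⟨Fq, hq, ih h1⟩, fun hb => ?_⟩
          obtain ⟨Fp, hp, h3⟩ := h2 (by omega)
          exact ⟨Fp, hp, ih h3⟩
      have := (ih h3 (lo hd')).add (ih (lo hd) h3')
      convert this using 2 with k
      rw [cv_succ, Pi.add_apply, (cv_smul _ _ _ _).1, (cv_smul _ _ _ _).2]; ring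

theorem Gv.up {p0 R S : ℝ} (hp0 : p0 < 0) {b : ℕ} {F Fp : ℝ → ℝ → ℝ} {B : ℕ → ℝ}
    (h : ∀ n, Gv p0 R S n b F B) (hF : PS p0 F Fp)
    (hp : ∀ n, Gv p0 R S n b Fp (fun k => S * B (k + 1))) (n : ℕ) : Gv p0 R S n (b + 1) F B := by
  have qd : ∀ {F : ℝ → ℝ → ℝ} {B : ℕ → ℝ}, (∀ n, Gv p0 R S n b F B) → ∃ Fq, QS p0 F Fq ∧ ∀ n, Gv p0 R S n b Fq (fun k => R * B (k + 1)) := by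
    intro F B h
    obtain ⟨-, ⟨Fq, hq, h1⟩, -⟩ := h 1
    refine ⟨Fq, hq, fun n => ?_⟩
    obtain ⟨-, ⟨Fq', hq', h1'⟩, -⟩ := h (n + 1)
    rwa [hq.uniq hp0.le hq' h1.base.2.1 h1'.base.2.1]
  induction n generalizing F Fp B with
  | zero => exact h 0
  | succ n ih =>
    obtain ⟨Fq, hq, h1⟩ := qd h
    obtain ⟨Fpq, hpq, h2⟩ := qd hp
    refine ⟨(h 0).base, ⟨Fq, hq, ih h1 (swap_pq (h 0).base.1 (hp 0).base.1 (h2 0).base.1 hF hq hpq)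
      fun n => ?_⟩, fun _ => ⟨Fp, hF, hp n⟩⟩
    convert h2 n using 2
    ring

end

section

open MeasureTheory Filter Topology

def cl (p0 : ℝ) (f : ℝ → ℝ → ℝ) : ℝ → ℝ → ℝ := fun q p => f q (clp p0 p)

theorem CB.cl {f} (h : CB f) (p0 : ℝ) : CB (cl p0 f) := by
  obtain ⟨hc, K, hK⟩ := h
  exact ⟨hc.comp (continuous_fst.prodMk ((clp_cont p0).comp continuous_snd)), K, fun q p => hK _ _⟩
theorem Cl_cl {p0 : ℝ} (hp : p0 ≤ 0) (f) : Cl p0 (cl p0 f) := fun q p => by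
  simp only [cl, clp_eq (clp_mem hp p)]
theorem QS.cl {p0 f g} (h : QS p0 f g) : QS p0 (cl p0 f) (cl p0 g) := fun p hp q => by
  simpa only [_root_.cl, clp_eq hp] using h p hp q
theorem PS.cl {p0 f g} (h : PS p0 f g) : PS p0 (cl p0 f) (cl p0 g) := fun q p hp => by
  have := h q p hp
  simp only [_root_.cl, clp_eq hp]
  exact this.congr (fun x hx => by simp only [_root_.cl, clp_eq hx]) (by simp only [_root_.cl, clp_eq hp])

theorem ext_ioo {p0 : ℝ} (hp0 : p0 < 0) {f g : ℝ → ℝ → ℝ} (hf : CB f) (hg : CB g) (cf : Cl p0 f) (cg : Cl p0 g)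
    (h : ∀ q, ∀ p ∈ Ioo p0 0, f q p = g q p) : f = g := by
  funext q p
  rw [cf, cg]
  have m := clp_mem hp0.le p
  rw [← closure_Ioo hp0.ne] at m
  exact closure_minimal (s := Ioo p0 0) (t := {p | f q p = g q p}) (fun x hx => h q x hx)
    (isClosed_eq (hf.cont_p q) (hg.cont_p q)) m

theorem Gv.of_seq {p0 R S : ℝ} (g : ℕ → ℝ → ℝ → ℝ) (B : ℕ → ℝ) (hq : ∀ k, QS p0 (g k) (g (k + 1)))
    (hB : ∀ k, Bs p0 (g k) (R ^ k * B k)) (n : ℕ) : Gv p0 R S n 0 (g 0) B := by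
  have : ∀ n j, Gv p0 R S n 0 (g j) (fun k => R ^ j * B (k + j)) := by
    intro n
    induction n with
    | zero => intro j; simpa [Gv] using hB j
    | succ n ih =>
      intro j
      refine ⟨by simpa using hB j, ⟨g (j + 1), hq j, ?_⟩, fun h => by omega⟩
      convert ih (j + 1) using 2 with k
      rw [show k + (j + 1) = k + 1 + j by ring]; ring
  simpa using this n 0

theorem Gv.zero {p0 R S : ℝ} (hR : 0 ≤ R) (hS : 0 ≤ S) (n b : ℕ) (B : ℕ → ℝ) (hB : ∀ k, 0 ≤ B k) :
    Gv p0 R S n b 0 B := by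
  have hb : ∀ M, 0 ≤ M → Bs p0 (0 : ℝ → ℝ → ℝ) M := fun M h => ⟨CB.cst 0, fun _ _ => rfl, fun _ _ => by simpa using h⟩
  induction n generalizing b B with
  | zero => exact hb _ (hB 0)
  | succ n ih => exact ⟨hb _ (hB 0), ⟨0, fun _ _ _ => hasDerivAt_const _ _, ih _ _ fun k => mul_nonneg hR (hB _)⟩,
      fun _ => ⟨0, fun _ _ _ => hasDerivWithinAt_const _ _ _, ih _ _ fun k => mul_nonneg hS (hB _)⟩⟩

/-- functions of p alone -/
theorem Gv.of_p {p0 R S : ℝ} (hp0 : p0 < 0) (hR : 0 ≤ R) (hS : 0 < S) (h : ℕ → ℝ → ℝ) (B : ℕ → ℝ)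
    (hd : ∀ k, ∀ p ∈ Icc p0 0, HasDerivWithinAt (h k) (h (k + 1) p) (Icc p0 0) p)
    (hB : ∀ k, ∀ p ∈ Icc p0 0, |h k p| ≤ S ^ k * B k) (n b : ℕ) :
    Gv p0 R S n b (fun _ p => h 0 (clp p0 p)) B := by
  have B0 : ∀ k, 0 ≤ B k := fun k => by
    have := (abs_nonneg _).trans (hB k 0 ⟨hp0.le, le_rfl⟩)
    exact nonneg_of_mul_nonneg_right this (by positivity)
  have hb : ∀ k, Bs p0 (fun _ p => h k (clp p0 p)) (S ^ k * B k) := fun k => by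
    have hc : Continuous (fun p => h k (clp p0 p)) := by
      have : ContinuousOn (h k) (Icc p0 0) := fun x hx => (hd k x hx).continuousWithinAt
      exact this.comp_continuous (clp_cont p0) (fun p => clp_mem hp0.le p)
    exact ⟨⟨hc.comp continuous_snd, _, fun q p => hB k _ (clp_mem hp0.le p)⟩,
      fun q p => by simp only [clp_eq (clp_mem hp0.le p)], fun q p => hB k _ (clp_mem hp0.le p)⟩
  have : ∀ n b j, Gv p0 R S n b (fun _ p => h j (clp p0 p)) (fun k => S ^ j * B (k + j)) := by
    intro n
    induction n with
    | zero => intro b j; simpa [Gv] using hb j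
    | succ n ih =>
      intro b j
      refine ⟨by simpa using hb j, ⟨0, fun _ _ _ => hasDerivAt_const _ _,
        Gv.zero hR hS.le _ _ _ fun k => by have := B0 (k + 1 + j); positivity⟩,
        fun _ => ⟨fun _ p => h (j + 1) (clp p0 p), fun q p hp => ?_, ?_⟩⟩
      · simp only [clp_eq hp]
        exact (hd j p hp).congr (fun x hx => by simp only [clp_eq hx]) (by simp only [clp_eq hp])
      · convert ih (b - 1) (j + 1) using 2 with k
        rw [show k + (j + 1) = k + 1 + j by ring]; ring
  simpa using this n b 0

theorem Gv.wt {p0 R R' S S' : ℝ} (h0 : 0 ≤ R) (h1 : R ≤ R') (h2 : 0 ≤ S) (h3 : S ≤ S') {n b F B} (hB : ∀ k, 0 ≤ B k)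
    (h : Gv p0 R S n b F B) : Gv p0 R' S' n b F B := by
  have h0' := h0.trans h1
  have h2' := h2.trans h3
  induction n generalizing b F B with
  | zero => exact h
  | succ n ih =>
    obtain ⟨a, ⟨Fq, hq, h4⟩, h5⟩ := h
    refine ⟨a, ⟨Fq, hq, ?_⟩, fun hb => ?_⟩
    · exact ih (fun k => mul_nonneg h0' (hB _)) (h4.mono h0 h2 fun k => by have := hB (k+1); gcongr)
    · obtain ⟨Fp, hp, h6⟩ := h5 hb
      exact ⟨Fp, hp, ih (fun k => mul_nonneg h2' (hB _)) (h6.mono h0 h2 fun k => by have := hB (k+1); gcongr)⟩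

theorem eG_succ {s : ℝ} (hs : 0 ≤ s) (k : ℕ) : eG s k ≤ 4 * eG s (k + 1) := by
  unfold eG
  have f : (0:ℝ) < k.factorial := by exact_mod_cast k.factorial_pos
  have f2 : (k.factorial : ℝ) ^ s ≤ ((k + 1).factorial : ℝ) ^ s := by
    gcongr; omega
  have f3 : (0:ℝ) < (k.factorial : ℝ) ^ s := by positivity
  rw [← mul_div_assoc, div_le_div_iff₀ (by positivity) (by positivity)]
  have k0 : (0:ℝ) ≤ k := by positivity
  have : (((k + 1 : ℕ) : ℝ) + 1) ^ 2 ≤ 4 * ((k:ℝ) + 1) ^ 2 := by push_cast; nlinarith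
  calc _ ≤ ((k + 1).factorial : ℝ) ^ s * (4 * ((k:ℝ) + 1) ^ 2) := by gcongr
    _ = _ := by ring

/-- Gevrey-type bound `a * eG s (k+r)`. -/
def Gs (p0 R S s : ℝ) (n b r : ℕ) (F : ℝ → ℝ → ℝ) (a : ℝ) : Prop :=
  Gv p0 R S n b F (fun k => a * eG s (k + r))

theorem Gs.le {p0 R S s : ℝ} (hR : 0 ≤ R) (hS : 0 ≤ S) {n b r F a a'} (h : Gs p0 R S s n b r F a) (haa : a ≤ a') :
    Gs p0 R S s n b r F a' :=
  Gv.mono hR hS h fun k => mul_le_mul_of_nonneg_right haa (eG_pos _ _).le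

theorem Gs.lift {p0 R S s : ℝ} (hR : 0 ≤ R) (hS : 0 ≤ S) (hs : 1 ≤ s) {n b F a} (h : Gs p0 R S s n b 0 F a) (ha : 0 ≤ a) :
    Gs p0 R S s n b 1 F (4 * a) :=
  Gv.mono hR hS h fun k => by
    have := mul_le_mul_of_nonneg_left (eG_succ (by linarith : 0 ≤ s) k) ha
    simp only [add_zero]; linarith

theorem Gs.add {p0 R S s : ℝ} {n b r F G a c} (h : Gs p0 R S s n b r F a) (h' : Gs p0 R S s n b r G c) :
    Gs p0 R S s n b r (F + G) (a + c) := by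
  have := Gv.add h h'
  unfold Gs; convert this using 2; simp only [Pi.add_apply]; ring
theorem Gs.neg {p0 R S s : ℝ} {n b r F a} (h : Gs p0 R S s n b r F a) : Gs p0 R S s n b r (-F) a := Gv.neg h
theorem Gs.sub {p0 R S s : ℝ} {n b r F G a c} (h : Gs p0 R S s n b r F a) (h' : Gs p0 R S s n b r G c) :
    Gs p0 R S s n b r (F - G) (a + c) := by
  rw [sub_eq_add_neg]; exact h.add h'.neg
theorem Gs.mul {p0 R S s : ℝ} (hR : 0 ≤ R) (hS : 0 ≤ S) (hs : 1 ≤ s) {n b r F G a c} (ha : 0 ≤ a) (hc : 0 ≤ c)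
    (h : Gs p0 R S s n b 0 F a) (h' : Gs p0 R S s n b r G c) :
    Gs p0 R S s n b r (F * G) (8 * a * c) := by
  refine Gv.mono hR hS (Gv.mul h h') fun k => ?_
  have := mul_le_mul_of_nonneg_left (conv_le hs k r) (mul_nonneg ha hc)
  calc _ = _ := ?_
    _ ≤ _ := this
    _ = _ := by ring
  unfold cv
  rw [Finset.mul_sum]
  exact Finset.sum_congr rfl fun _ _ => by simp only [add_zero]; ring
theorem Gs.qd {p0 R S s : ℝ} {n b F a} (h : Gs p0 R S s (n + 1) b 0 F a) :
    ∃ Fq, QS p0 F Fq ∧ Gs p0 R S s n b 1 Fq (R * a) := by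
  obtain ⟨-, ⟨Fq, hq, h1⟩, -⟩ := h
  refine ⟨Fq, hq, ?_⟩
  unfold Gs; convert h1 using 2; simp only [add_zero]; ring
theorem Gs.qd' {p0 R S s : ℝ} {n b F Fq a} (hp : p0 ≤ 0) (h : Gs p0 R S s (n + 1) b 0 F a) (hq : QS p0 F Fq) (hc : Cl p0 Fq) :
    Gs p0 R S s n b 1 Fq (R * a) := by
  obtain ⟨Fq', h1, h2⟩ := h.qd
  rwa [hq.uniq hp h1 hc h2.base.2.1]
theorem Gs.bs {p0 R S s : ℝ} {n b F a} (h : Gs p0 R S s n b 0 F a) : Bs p0 F a := by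
  have := h.base
  simpa [eG] using this

end

section

open MeasureTheory Filter Topology

section
variable {p0 d Q K δ : ℝ} {Y Uq : ℝ → ℝ → ℝ} {W Wp : Fin 4 → ℝ → ℝ → ℝ} {rh bb cc : ℝ → ℝ}

theorem WFlow.seq (h : WFlow p0 d Q K δ Y Uq W Wp rh bb cc) : ∃ M ≥ 1, ∃ R ≥ 1, ∀ i,
    ∃ g : ℕ → ℝ → ℝ → ℝ, g 0 = cl p0 (W i) ∧ (∀ k, QS p0 (g k) (g (k + 1))) ∧
      ∀ k, Bs p0 (g k) (M * R ^ k * k.factorial) := by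
  obtain ⟨τ, hτ, M, hM, R, hR, hb⟩ := h.all
  refine ⟨M, hM, R, hR, fun i => ?_⟩
  obtain ⟨g, g0, g1, g2⟩ := DB.seq (A := fun k => M * R ^ k * k.factorial) (f := W i) h.hp hτ
    ⟨(h.pW i).1, fun ts h1 h2 q p hp => hb ts h1 h2.le i q p hp⟩
  exact ⟨fun k => cl p0 (g k), congrArg (cl p0) g0, fun k => (g1 k).cl, fun k => ⟨(g2 k).1.cl p0, Cl_cl h.hp.le _,
    fun q p => (g2 k).2 q _ (clp_mem h.hp.le p)⟩⟩

theorem WFlow.anal (h : WFlow p0 d Q K δ Y Uq W Wp rh bb cc) {p : ℝ} (hp : p ∈ Icc p0 0) :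
    AnalyticOnNhd ℝ (fun q => Y q p) univ := by
  obtain ⟨M, hM, R, hR, hg⟩ := h.seq
  obtain ⟨g, g0, g1, g2⟩ := hg 2
  obtain ⟨L, hL⟩ := h.pY.1.2
  have L0 : 0 ≤ L := (abs_nonneg _).trans (hL 0 0)
  have hY := h.qY.QS h.hp h.pY.1 (h.pW 2).1
  refine analytic1 (fun k => Nat.casesOn k (fun q => Y q p) (fun k q => g k q p)) (M := M + L) (R := R)
    (by linarith) (by linarith) ?_ ?_
  · intro k x
    cases k with
    | zero =>
      show HasDerivAt (fun q => Y q p) (g 0 x p) x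
      rw [g0]; simpa only [cl, clp_eq hp] using hY p hp x
    | succ k => exact g1 k p hp x
  · intro k x
    cases k with
    | zero => simpa using (hL x p).trans (by linarith)
    | succ k =>
      refine ((g2 k).2.2 x p).trans ?_
      have f1 : (k.factorial : ℝ) ≤ (k + 1).factorial := by exact_mod_cast Nat.factorial_le (Nat.le_succ k)
      have f2 : R ^ k ≤ R ^ (k + 1) := pow_le_pow_right₀ hR (Nat.le_succ k)
      have f3 : M ≤ M + L := by linarith
      have f4 : (0:ℝ) ≤ k.factorial := by positivity
      gcongr

theorem fact_le {s : ℝ} (hs : 1 ≤ s) (k : ℕ) : (k.factorial : ℝ) ≤ 4 ^ k * eG s k := by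
  unfold eG
  have f : (1:ℝ) ≤ k.factorial := by exact_mod_cast k.factorial_pos
  have f2 : (k.factorial : ℝ) ≤ (k.factorial : ℝ) ^ s := Real.self_le_rpow_of_one_le f hs
  have : ((k:ℝ) + 1) ^ 2 ≤ 4 ^ k := by
    have : (k + 1) ≤ 2 ^ k := Nat.lt_two_pow_self
    have : ((k:ℝ) + 1) ≤ 2 ^ k := by exact_mod_cast this
    calc _ ≤ ((2:ℝ) ^ k) ^ 2 := by gcongr
      _ = _ := by rw [← pow_mul, mul_comm, pow_mul]; norm_num
  rw [← mul_div_assoc, le_div_iff₀ (by positivity)]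
  calc _ ≤ (k.factorial : ℝ) ^ s * 4 ^ k := by gcongr
    _ = _ := by ring

theorem gev_main {s c R S t : ℝ} (hs : 1 ≤ s) (hp0 : p0 < 0) (c1 : 1 ≤ c) (R0' : 0 ≤ R) (ht : t = R * c + 36 * c ^ 2)
    (hSS : 8192 * c ^ 4 * t + 4 ≤ S) {U V G kk Yc T A B g1 h1 Up Vp Gp : ℝ → ℝ → ℝ}
    (W2 : ∀ n, Gs p0 R S s n 0 0 U c ∧ Gs p0 R S s n 0 0 V c ∧ Gs p0 R S s n 0 0 G c ∧
      Gs p0 R S s n 0 0 kk c ∧ Gs p0 R S s n 0 0 Yc c)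
    (qU : QS p0 U g1) (qV : QS p0 V h1) (kg : Cl p0 g1) (kh : Cl p0 h1) (hT : T = g1 - (A * Yc + B))
    (CC : ∀ n b, Gs p0 R S s n b 0 A c) (BB : ∀ n b, Gs p0 R S s n b 0 B c)
    (eU : Up = kk * (U * T + -(V * h1))) (eV : Vp = kk * (V * T + U * h1)) (eGa : Gp = -(G * (G * Vp)))
    (psU : PS p0 U Up) (psV : PS p0 V Vp) (psG : PS p0 G Gp) (psY : PS p0 Yc G)
    (psK : PS p0 kk (-(kk * (kk * (T + T))))) :
    ∀ b, ∀ n, Gs p0 R S s n b 0 U c ∧ Gs p0 R S s n b 0 V c ∧ Gs p0 R S s n b 0 G c ∧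
      Gs p0 R S s n b 0 kk c ∧ Gs p0 R S s n b 0 Yc c := by
  have le0 := hp0.le
  have cp : 0 < c := by linarith
  have t0 : 0 ≤ t := by rw [ht]; positivity
  have Sp : 0 ≤ S := by have : 0 ≤ 8192 * c ^ 4 * t := by positivity
                        linarith
  have eG0 : ∀ k, 0 ≤ eG s k := fun k => (eG_pos s k).le
  intro b
  induction b with
  | zero => exact W2
  | succ b ih =>
    have mulc : ∀ {n F G r a e}, Gs p0 R S s n b 0 F a → Gs p0 R S s n b r G e → 0 ≤ a → 0 ≤ e →
      Gs p0 R S s n b r (F * G) (8 * a * e) := fun h1 h2 h3 h4 => Gs.mul R0' Sp hs h3 h4 h1 h2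
    have hTn : ∀ n, Gs p0 R S s n b 1 T t := by
      intro n
      have a1 := (ih (n + 1)).1.qd' le0 qU kg
      have a2 := ((mulc (CC n b) (ih n).2.2.2.2 cp.le cp.le).add (BB n b)).lift R0' Sp hs (by positivity)
      rw [hT]
      refine (a1.sub a2).le R0' Sp ?_
      rw [ht]; nlinarith only [cp, c1]
    have hQn : ∀ n, Gs p0 R S s n b 1 h1 t := fun n =>
      ((ih (n + 1)).2.1.qd' le0 qV kh).le R0' Sp (by rw [ht]; nlinarith only [sq_nonneg c])
    have hVp : ∀ n, Gs p0 R S s n b 1 Vp (128 * c ^ 2 * t) := by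
      intro n
      obtain ⟨i1, i2, i3, i4, i5⟩ := ih n
      rw [eV]
      refine (mulc i4 ((mulc i2 (hTn n) cp.le t0).add (mulc i1 (hQn n) cp.le t0)) cp.le (by positivity)).le R0' Sp (le_of_eq ?_)
      ring
    have hUp : ∀ n, Gs p0 R S s n b 1 Up (128 * c ^ 2 * t) := by
      intro n
      obtain ⟨i1, i2, i3, i4, i5⟩ := ih n
      rw [eU]
      refine (mulc i4 ((mulc i1 (hTn n) cp.le t0).add (mulc i2 (hQn n) cp.le t0).neg) cp.le (by positivity)).le R0' Sp (le_of_eq ?_)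
      ring
    have hGp : ∀ n, Gs p0 R S s n b 1 Gp (8192 * c ^ 4 * t) := by
      intro n
      obtain ⟨i1, i2, i3, i4, i5⟩ := ih n
      rw [eGa]
      refine (mulc i3 (mulc i3 (hVp n) cp.le (by positivity)) cp.le (by positivity)).neg.le R0' Sp (le_of_eq ?_)
      ring
    have hKp : ∀ n, Gs p0 R S s n b 1 (-(kk * (kk * (T + T)))) (128 * c ^ 2 * t) := by
      intro n
      obtain ⟨i1, i2, i3, i4, i5⟩ := ih n
      refine (mulc i4 (mulc i4 ((hTn n).add (hTn n)) cp.le (by positivity)) cp.le (by positivity)).neg.le R0' Sp (le_of_eq ?_)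
      ring
    have SC : 8192 * c ^ 4 * t ≤ S * c := by
      have : S ≤ S * c := le_mul_of_one_le_right Sp c1
      have : 8192 * c ^ 4 * t ≤ S := by linarith only [hSS]
      linarith
    have SC' : 128 * c ^ 2 * t ≤ S * c := by
      have : c ^ 2 ≤ c ^ 4 := pow_le_pow_right₀ c1 (by norm_num)
      have : c ^ 2 * t ≤ c ^ 4 * t := by gcongr
      have : 0 ≤ c ^ 2 * t := by positivity
      linarith
    have fin : ∀ {F Fp : ℝ → ℝ → ℝ} {a}, (∀ n, Gs p0 R S s n b 0 F c) → PS p0 F Fp →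
        (∀ n, Gs p0 R S s n b 1 Fp a) → a ≤ S * c → ∀ n, Gs p0 R S s n (b + 1) 0 F c := by
      intro F Fp a i1 i2 i3 i4 n
      refine Gv.up hp0 i1 i2 (fun n => Gv.mono R0' Sp (i3 n) fun k => ?_) n
      have := mul_le_mul_of_nonneg_right i4 (eG0 (k + 1))
      simp only [add_zero]; linarith
    intro n
    refine ⟨fin (fun n => (ih n).1) psU hUp SC' n, fin (fun n => (ih n).2.1) psV hVp SC' n,
      fin (fun n => (ih n).2.2.1) psG hGp SC n, fin (fun n => (ih n).2.2.2.1) psK hKp SC' n,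
      fin (fun n => (ih n).2.2.2.2) psY (fun n => (ih n).2.2.1.lift R0' Sp hs cp.le) ?_ n⟩
    have : 0 ≤ 8192 * c ^ 4 * t := by positivity
    have : 4 ≤ S := by linarith
    gcongr

set_option maxHeartbeats 1000000 in
theorem WFlow.gev (h : WFlow p0 d Q K δ Y Uq W Wp rh bb cc) {s : ℝ} (hs : 1 ≤ s)
    (hb hc : ℕ → ℝ → ℝ) (hb0 : ∀ p ∈ Icc p0 0, hb 0 p = bb p) (hc0 : ∀ p ∈ Icc p0 0, hc 0 p = cc p)
    (hbd : ∀ k, ∀ p ∈ Icc p0 0, HasDerivWithinAt (hb k) (hb (k + 1) p) (Icc p0 0) p)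
    (hcd : ∀ k, ∀ p ∈ Icc p0 0, HasDerivWithinAt (hc k) (hc (k + 1) p) (Icc p0 0) p)
    {c0 S0 : ℝ} (hS0 : 0 < S0)
    (hbB : ∀ k, ∀ p ∈ Icc p0 0, |hb k p| ≤ S0 ^ k * (c0 * eG s k))
    (hcB : ∀ k, ∀ p ∈ Icc p0 0, |hc k p| ≤ S0 ^ k * (c0 * eG s k)) :
    ∃ c R S : ℝ, 1 ≤ c ∧ 1 ≤ R ∧ 1 ≤ S ∧ ∀ n b, Gs p0 R S s n b 0 (cl p0 (W 0)) c ∧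
      Gs p0 R S s n b 0 (cl p0 (W 1)) c := by
  obtain ⟨M, hM, R0, hR0, hg⟩ := h.seq
  have hp0 := h.hp
  have le0 := hp0.le
  have W1 : ∀ S i n, Gs p0 (4 * R0) S s n 0 0 (cl p0 (W i)) M := by
    intro S i n
    obtain ⟨g, g0, g1, g2⟩ := hg i
    rw [← g0]
    refine Gv.of_seq g _ g1 (fun k => ⟨(g2 k).1, (g2 k).2.1, fun q p => ((g2 k).2.2 q p).trans ?_⟩) n
    calc M * R0 ^ k * k.factorial ≤ M * R0 ^ k * (4 ^ k * eG s k) := by gcongr; exact fact_le hs k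
      _ = _ := by rw [mul_pow]; simp only [add_zero]; ring
  obtain ⟨L, hL⟩ := h.pY.1.2
  have L0 : 0 ≤ L := (abs_nonneg _).trans (hL 0 0)
  have c00 : 0 ≤ c0 := by
    have := (abs_nonneg _).trans (hbB 0 0 ⟨le0, le_rfl⟩)
    have e := eG_pos s 0
    rw [pow_zero, one_mul] at this
    exact nonneg_of_mul_nonneg_left this e
  obtain ⟨kk, hkk⟩ : ∃ f : ℝ → ℝ → ℝ, f = fun q p => (W 0 q (clp p0 p) ^ 2 + W 1 q (clp p0 p) ^ 2)⁻¹ := ⟨_, rfl⟩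
  have hδ := h.hδ
  have Npos : ∀ q p, δ ^ 2 ≤ W 0 q (clp p0 p) ^ 2 + W 1 q (clp p0 p) ^ 2 := fun q p => by
    have := h.Vpos q (clp p0 p)
    nlinarith [sq_nonneg (W 0 q (clp p0 p))]
  have Npos' : ∀ q p, 0 < W 0 q (clp p0 p) ^ 2 + W 1 q (clp p0 p) ^ 2 := fun q p => lt_of_lt_of_le (by positivity) (Npos q p)
  have kcb : Bs p0 kk (δ ^ 2)⁻¹ := by
    have c1 := ((h.pW 0).1.cl p0).1
    have c2 := ((h.pW 1).1.cl p0).1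
    have bd : ∀ q p, |kk q p| ≤ (δ ^ 2)⁻¹ := fun q p => by
      simp only [hkk]
      rw [abs_of_pos (inv_pos.mpr (Npos' q p))]
      exact inv_anti₀ (by positivity) (Npos q p)
    refine ⟨⟨by subst hkk; exact ((c1.pow 2).add (c2.pow 2)).inv₀ (fun z => (Npos' z.1 z.2).ne'), _, bd⟩,
      fun q p => by simp only [hkk, clp_eq (clp_mem le0 p)], bd⟩
  -- constants
  obtain ⟨c, hcc⟩ : ∃ x : ℝ, x = M + L + c0 + (δ ^ 2)⁻¹ := ⟨_, rfl⟩
  have d0 : 0 ≤ (δ ^ 2)⁻¹ := by positivity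
  have c1 : 1 ≤ c := by rw [hcc]; linarith
  have cp : 0 < c := by linarith
  obtain ⟨R1, hR1⟩ : ∃ x : ℝ, x = 4 * R0 := ⟨_, rfl⟩
  obtain ⟨R, hRR⟩ : ∃ x : ℝ, x = R1 + 64 * c * (4 * (8 * M * (R1 * M))) := ⟨_, rfl⟩
  rw [← hR1] at W1
  have M0 : 0 ≤ M := by linarith
  have R10 : 4 ≤ R1 := by rw [hR1]; linarith
  have R1p : 0 ≤ R1 := by linarith
  have RR : R1 ≤ R := by
    have : 0 ≤ 64 * c * (4 * (8 * M * (R1 * M))) := by positivity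
    rw [hRR]; linarith
  have R0' : 0 ≤ R := by linarith
  obtain ⟨t, ht⟩ : ∃ x : ℝ, x = R * c + 36 * c ^ 2 := ⟨_, rfl⟩
  have t0 : 0 ≤ t := by rw [ht]; positivity
  obtain ⟨S, hSS⟩ : ∃ x : ℝ, x = S0 + 8192 * c ^ 4 * t + 4 := ⟨_, rfl⟩
  have n1 : 0 ≤ 8192 * c ^ 4 * t := by positivity
  have Sp : 0 ≤ S := by rw [hSS]; linarith
  have eG0 : ∀ k, 0 ≤ eG s k := fun k => (eG_pos s k).le
  -- b = 0
  have W2 : ∀ i n, Gs p0 R S s n 0 0 (cl p0 (W i)) c := fun i n =>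
    (Gv.wt R1p RR Sp le_rfl (fun k => mul_nonneg M0 (eG0 _)) (W1 S i n)).mono R0' Sp fun k =>
      mul_le_mul_of_nonneg_right (by rw [hcc]; linarith) (eG0 _)
  have hYq := (h.qY.QS hp0 h.pY.1 (h.pW 2).1).cl
  have Y2 : ∀ n, Gs p0 R S s n 0 0 (cl p0 Y) c := by
    have bs : Bs p0 (cl p0 Y) ((fun k => c * eG s (k + 0)) 0) := ⟨h.pY.1.cl p0, Cl_cl le0 _, fun q p => (hL _ _).trans (by
      simp [eG]; rw [hcc]; linarith)⟩
    intro n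
    cases n with
    | zero => exact bs
    | succ n =>
      refine ⟨bs, ⟨_, hYq, ?_⟩, fun h => by omega⟩
      refine Gv.mono R0' Sp ((W2 2 n).lift R0' Sp hs cp.le) fun k => ?_
      have := mul_le_mul_of_nonneg_right (show 4 * c ≤ R * c by gcongr; linarith) (eG0 (k + 1))
      simp only [add_zero]; linarith
  obtain ⟨g, g0, g1, g2⟩ := hg 0
  obtain ⟨g', g0', g1', g2'⟩ := hg 1
  have qU : QS p0 (cl p0 (W 0)) (g 1) := by rw [← g0]; exact g1 0
  have qV : QS p0 (cl p0 (W 1)) (g' 1) := by rw [← g0']; exact g1' 0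
  have K2 : ∀ n, Gs p0 R S s n 0 0 kk c := by
    have bs : Bs p0 kk ((fun k => c * eG s (k + 0)) 0) := ⟨kcb.1, kcb.2.1, fun q p => (kcb.2.2 _ _).trans (by
      simp [eG]; rw [hcc]; linarith)⟩
    intro n
    induction n with
    | zero => exact bs
    | succ n ih =>
      set P := cl p0 (W 0) * g 1 + cl p0 (W 1) * g' 1 with hP
      have hPb : Gs p0 R S s n 0 1 (P + P) (4 * (8 * M * (R1 * M))) := by
        have a1 := Gs.mul R1p Sp hs M0 (by positivity) (W1 S 0 n) ((W1 S 0 (n + 1)).qd' le0 qU (g2 1).2.1)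
        have a2 := Gs.mul R1p Sp hs M0 (by positivity) (W1 S 1 n) ((W1 S 1 (n + 1)).qd' le0 qV (g2' 1).2.1)
        have a3 := (a1.add a2).add (a1.add a2)
        refine Gv.wt R1p RR Sp le_rfl (fun k => mul_nonneg (by positivity) (eG0 _)) (a3.le R1p Sp (le_of_eq ?_))
        ring
      refine ⟨bs, ⟨-(kk * (kk * (P + P))), ?_, ?_⟩, fun h => by omega⟩
      · intro p hp q
        have e1 := qU p hp q
        have e2 := qV p hp q
        simp only [cl, clp_eq hp] at e1 e2
        have e3 := ((e1.pow 2).add (e2.pow 2)).inv (by have := (Npos' q p).ne'; simpa only [clp_eq hp, Pi.add_apply, Pi.pow_apply] using this)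
        simp only [hkk, clp_eq hp]
        refine e3.congr_deriv ?_
        simp only [hP, cl, clp_eq hp, Pi.neg_apply, Pi.mul_apply, Pi.add_apply, Pi.pow_apply]
        have := (Npos' q p).ne'
        simp only [clp_eq hp] at this
        field_simp
        ring
      · have b1 := (Gs.mul R0' Sp hs cp.le (by positivity) ih (Gs.mul R0' Sp hs cp.le (by positivity) ih hPb)).neg
        refine Gv.mono R0' Sp b1 fun k => ?_
        have : 8 * c * (8 * c * (4 * (8 * M * (R1 * M)))) ≤ R * c := by
          have : 64 * c * (4 * (8 * M * (R1 * M))) ≤ R := by rw [hRR]; linarith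
          calc _ = (64 * c * (4 * (8 * M * (R1 * M)))) * c := by ring
            _ ≤ _ := by gcongr
        have := mul_le_mul_of_nonneg_right this (eG0 (k + 1))
        simp only [add_zero]; linarith
  have CC : ∀ n b, Gs p0 R S s n b 0 (fun _ p => hc 0 (clp p0 p)) c := fun n b =>
    Gv.of_p hp0 R0' (by rw [hSS]; linarith) hc _ hcd (fun k p hp => (hcB k p hp).trans (by
      have := eG0 k
      simp only [add_zero]
      gcongr <;> [(rw [hSS]; linarith); (rw [hcc]; linarith)])) n b
  have BB : ∀ n b, Gs p0 R S s n b 0 (fun _ p => hb 0 (clp p0 p)) c := fun n b =>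
    Gv.of_p hp0 R0' (by rw [hSS]; linarith) hb _ hbd (fun k p hp => (hbB k p hp).trans (by
      have := eG0 k
      simp only [add_zero]
      gcongr <;> [(rw [hSS]; linarith); (rw [hcc]; linarith)])) n b
  set U := cl p0 (W 0) with hU
  set V := cl p0 (W 1) with hV
  set G := cl p0 (W 3) with hG
  set Yc := cl p0 Y with hYc
  set T := g 1 - ((fun _ p => hc 0 (clp p0 p)) * Yc + fun _ p => hb 0 (clp p0 p)) with hT
  -- pointwise identities on the open strip
  have clW : ∀ {f : ℝ → ℝ → ℝ} {q p : ℝ}, p ∈ Ioo p0 0 → cl p0 f q p = f q p := fun hp => by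
    simp only [cl, clp_eq (Ioo_subset_Icc_self hp)]
  have pT : ∀ q, ∀ p ∈ Ioo p0 0, W 0 q p * Wp 0 q p + W 1 q p * Wp 1 q p = T q p := by
    intro q p hp
    have hp' := Ioo_subset_Icc_self hp
    have e : g 1 q p = Uq q p := by
      have := qU p hp' q
      simp only [hU, cl, clp_eq hp'] at this
      exact this.unique (h.qU p hp q)
    rw [h.eq2 q p hp, hT]
    simp only [Pi.sub_apply, Pi.add_apply, Pi.mul_apply, clp_eq hp', hb0 p hp', hc0 p hp', hYc, clW hp, e]
  have pV : ∀ q, ∀ p ∈ Ioo p0 0, W 1 q p * Wp 0 q p - W 0 q p * Wp 1 q p = - g' 1 q p := by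
    intro q p hp
    have hp' := Ioo_subset_Icc_self hp
    have v0 : 0 < W 1 q p := hδ.trans_le (h.Vpos q p)
    have a1 : ∀ q p, W 2 q p * W 1 q p = W 0 q p := fun q p => congrFun (congrFun h.alV q) p
    have a2 : ∀ q p, W 3 q p * W 1 q p = 1 := fun q p => congrFun (congrFun h.gaV q) p
    have b1 : Wp 2 q p * W 1 q p + W 2 q p * Wp 1 q p = Wp 0 q p := by
      have := ((h.pW 2).2.2 q p hp).mul ((h.pW 1).2.2 q p hp)
      have e : W 2 q * W 1 q = W 0 q := funext fun p => a1 q p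
      rw [e] at this
      exact this.unique ((h.pW 0).2.2 q p hp)
    have b2 : Wp 2 q p * W 1 q p + W 3 q p * g' 1 q p = 0 := by
      have := qV p hp' q
      simp only [hV, cl, clp_eq hp'] at this
      have := (h.qga p hp q).mul this
      have e : (fun q => W 3 q p) * (fun q => W 1 q p) = fun _ => 1 := funext fun q => a2 q p
      rw [e] at this
      exact this.unique (hasDerivAt_const _ _)
    have a1' := a1 q p
    have a2' := a2 q p
    linear_combination (-W 1 q p) * b1 + (W 1 q p) * b2 + Wp 1 q p * a1' - g' 1 q p * a2'
  have pG : ∀ q, ∀ p ∈ Ioo p0 0, Wp 3 q p = -(W 3 q p * (W 3 q p * Wp 1 q p)) := by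
    intro q p hp
    have v0 : 0 < W 1 q p := hδ.trans_le (h.Vpos q p)
    have a2 : ∀ q p, W 3 q p * W 1 q p = 1 := fun q p => congrFun (congrFun h.gaV q) p
    have := ((h.pW 3).2.2 q p hp).mul ((h.pW 1).2.2 q p hp)
    have e : W 3 q * W 1 q = fun _ => 1 := funext fun p => a2 q p
    rw [e] at this
    have := this.unique (hasDerivAt_const _ _)
    have a2' := a2 q p
    linear_combination (W 3 q p) * this - Wp 3 q p * a2'
  have kN : ∀ q, ∀ p ∈ Ioo p0 0, kk q p * (W 0 q p ^ 2 + W 1 q p ^ 2) = 1 := fun q p hp => by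
    have := (Npos' q p).ne'
    simp only [clp_eq (Ioo_subset_Icc_self hp)] at this
    simp only [hkk, clp_eq (Ioo_subset_Icc_self hp)]
    field_simp
  have bU := (W2 0 0).bs
  have bV := (W2 1 0).bs
  have bG := (W2 3 0).bs
  have bT : CB T ∧ Cl p0 T := by
    refine ⟨(g2 1).1.sub (((CC 0 0).bs.1.mul (Y2 0).bs.1).add (BB 0 0).bs.1), fun q p => ?_⟩
    simp only [hT, Pi.sub_apply, Pi.add_apply, Pi.mul_apply]
    rw [(g2 1).2.1 q p, (Y2 0).bs.2.1 q p, clp_eq (clp_mem le0 p)]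
  have cmul : ∀ {f g : ℝ → ℝ → ℝ}, CB f ∧ Cl p0 f → CB g ∧ Cl p0 g → CB (f * g) ∧ Cl p0 (f * g) := fun hf hg =>
    ⟨hf.1.mul hg.1, fun q p => by simp only [Pi.mul_apply, ← hf.2 q p, ← hg.2 q p]⟩
  have cadd : ∀ {f g : ℝ → ℝ → ℝ}, CB f ∧ Cl p0 f → CB g ∧ Cl p0 g → CB (f + g) ∧ Cl p0 (f + g) := fun hf hg =>
    ⟨hf.1.add hg.1, fun q p => by simp only [Pi.add_apply, ← hf.2 q p, ← hg.2 q p]⟩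
  have cneg : ∀ {f : ℝ → ℝ → ℝ}, CB f ∧ Cl p0 f → CB (-f) ∧ Cl p0 (-f) := fun hf =>
    ⟨hf.1.neg, fun q p => by simp only [Pi.neg_apply, ← hf.2 q p]⟩
  have kU : CB U ∧ Cl p0 U := ⟨bU.1, bU.2.1⟩
  have kV : CB V ∧ Cl p0 V := ⟨bV.1, bV.2.1⟩
  have kG : CB G ∧ Cl p0 G := ⟨bG.1, bG.2.1⟩
  have kK : CB kk ∧ Cl p0 kk := ⟨kcb.1, kcb.2.1⟩
  have kQ : CB (g' 1) ∧ Cl p0 (g' 1) := ⟨(g2' 1).1, (g2' 1).2.1⟩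
  have eU : cl p0 (Wp 0) = kk * (U * T + -(V * g' 1)) := by
    have r := cmul kK (cadd (cmul kU bT) (cneg (cmul kV kQ)))
    refine ext_ioo hp0 ((h.pW 0).2.1.cl p0) r.1 (Cl_cl le0 _) r.2 fun q p hp => ?_
    simp only [Pi.mul_apply, Pi.add_apply, Pi.neg_apply, hU, hV, clW hp]
    linear_combination (-Wp 0 q p) * kN q p hp + kk q p * W 0 q p * pT q p hp + kk q p * W 1 q p * pV q p hp
  have eV : cl p0 (Wp 1) = kk * (V * T + U * g' 1) := by
    have r := cmul kK (cadd (cmul kV bT) (cmul kU kQ))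
    refine ext_ioo hp0 ((h.pW 1).2.1.cl p0) r.1 (Cl_cl le0 _) r.2 fun q p hp => ?_
    simp only [Pi.mul_apply, Pi.add_apply, Pi.neg_apply, hU, hV, clW hp]
    linear_combination (-Wp 1 q p) * kN q p hp + kk q p * W 1 q p * pT q p hp - kk q p * W 0 q p * pV q p hp
  have eGa : cl p0 (Wp 3) = -(G * (G * cl p0 (Wp 1))) := by
    have r := cneg (cmul kG (cmul kG ⟨(h.pW 1).2.1.cl p0, Cl_cl le0 _⟩))
    refine ext_ioo hp0 ((h.pW 3).2.1.cl p0) r.1 (Cl_cl le0 _) r.2 fun q p hp => ?_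
    simp only [Pi.mul_apply, Pi.neg_apply, hG, clW hp]
    exact pG q p hp
  have psU := (h.pW 0).PS.cl
  have psV := (h.pW 1).PS.cl
  have psG := (h.pW 3).PS.cl
  have psY := h.pY.PS.cl
  have psK : PS p0 kk (-(kk * (kk * (T + T)))) := by
    intro q p hp
    have e1 := psU q p hp
    have e2 := psV q p hp
    have e3 := ((e1.pow 2).add (e2.pow 2)).inv (by have := (Npos' q p).ne'; simpa only [hU, hV, cl, Pi.add_apply, Pi.pow_apply] using this)
    have ek : kk q = (U q ^ 2 + V q ^ 2)⁻¹ := by subst hkk; rfl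
    rw [ek]
    refine (HasDerivWithinAt.congr_deriv e3 ?_)
    have e4 : U * cl p0 (Wp 0) + V * cl p0 (Wp 1) = T := by
      have r := cadd (cmul kU ⟨(h.pW 0).2.1.cl p0, Cl_cl le0 _⟩) (cmul kV ⟨(h.pW 1).2.1.cl p0, Cl_cl le0 _⟩)
      refine ext_ioo hp0 r.1 bT.1 r.2 bT.2 fun q p hp => ?_
      simp only [Pi.mul_apply, Pi.add_apply, hU, hV, clW hp]
      exact pT q p hp
    rw [← e4]
    have := (Npos' q p).ne'
    simp only [hkk, Pi.mul_apply, Pi.add_apply, Pi.neg_apply, Pi.pow_apply, hU, hV, cl]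
    field_simp
    ring
  have main := gev_main hs hp0 c1 R0' ht (by rw [hSS]; linarith) (fun n => ⟨W2 0 n, W2 1 n, W2 3 n, K2 n, Y2 n⟩)
    qU qV (g2 1).2.1 (g2' 1).2.1 hT CC BB eU eV eGa psU psV psG psY psK
  exact ⟨c, R, S, c1, by linarith, by rw [hSS]; linarith, fun n b => ⟨(main b n).1, (main b n).2.1⟩⟩
end

end

section

open MeasureTheory Filter Topology

theorem comp_hd {p0 : ℝ} {F Fq Fp : ℝ → ℝ → ℝ} (hq : QS p0 F Fq) (hp : PS p0 F Fp)
    (hc : Continuous fun z : ℝ × ℝ => Fq z.1 z.2) {P : ℝ × ℝ → ℝ} {D : Set (ℝ × ℝ)} (hP : MapsTo P D (Icc p0 0))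
    {z : ℝ × ℝ} (hz : z ∈ D) {P' : ℝ × ℝ →L[ℝ] ℝ} (hd : HasFDerivWithinAt P P' D z) :
    HasFDerivWithinAt (fun z : ℝ × ℝ => F z.1 (P z))
      (Fq z.1 (P z) • ContinuousLinearMap.fst ℝ ℝ ℝ + Fp z.1 (P z) • P') D z := by
  have hB : HasFDerivWithinAt (fun w => F z.1 (P w)) (Fp z.1 (P z) • P') D z :=
    (hp z.1 (P z) (hP hz)).comp_hasFDerivWithinAt z hd hP
  have hA : HasFDerivWithinAt (fun w => F w.1 (P w) - F z.1 (P w)) (Fq z.1 (P z) • ContinuousLinearMap.fst ℝ ℝ ℝ) D z := by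
    rw [hasFDerivWithinAt_iff_isLittleO, Asymptotics.isLittleO_iff]
    intro ε hε
    have h1 := Metric.continuous_iff.mp hc (z.1, P z) ε hε
    obtain ⟨r, hr, h2⟩ := h1
    have e1 : ∀ᶠ w in 𝓝[D] z, |P w - P z| < r := by
      have := hd.continuousWithinAt.tendsto (Metric.ball_mem_nhds _ hr)
      filter_upwards [this] with w hw
      simpa [Real.dist_eq] using hw
    have e2 : ∀ᶠ w in 𝓝[D] z, |w.1 - z.1| < r := by
      have := (continuous_fst.continuousAt (x := z)).continuousWithinAt (s := D) (Metric.ball_mem_nhds _ hr)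
      filter_upwards [this] with w hw
      simpa [Real.dist_eq] using hw
    filter_upwards [e1, e2, self_mem_nhdsWithin] with w h3 h4 h5
    have := (convex_ball z.1 r).norm_image_sub_le_of_norm_hasDerivWithin_le (C := ε)
      (f := fun t => F t (P w) - t * Fq z.1 (P z)) (f' := fun t => Fq t (P w) - 1 * Fq z.1 (P z))
      (fun t ht => ((hq _ (hP h5) t).sub ((hasDerivAt_id t).mul_const _)).hasDerivWithinAt)
      (fun t ht => by
        have := h2 (t, P w) (by
          rw [Prod.dist_eq, max_lt_iff]; exact ⟨ht, h3⟩)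
        rw [one_mul]; exact this.le) (Metric.mem_ball_self hr) (show w.1 ∈ Metric.ball z.1 r from h4)
    have h6 : ‖w.1 - z.1‖ ≤ ‖w - z‖ := norm_fst_le (w - z)
    calc _ = _ := ?_
      _ ≤ _ := this
      _ ≤ _ := by gcongr
    congr 1
    simp; ring
  have := hA.add hB
  refine this.congr_of_eventuallyEq (Eventually.of_forall fun w => ?_) ?_ <;> simp

theorem Gs.qd2 {p0 R S s : ℝ} {r F a} (hp : p0 ≤ 0) (h : ∀ n b, Gs p0 R S s n b r F a) :
    ∃ Fq, QS p0 F Fq ∧ ∀ n b, Gs p0 R S s n b (r + 1) Fq (R * a) := by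
  have key : ∀ n b, ∃ Fq, QS p0 F Fq ∧ Gs p0 R S s n b (r + 1) Fq (R * a) := fun n b => by
    obtain ⟨-, ⟨Fq, hq, h1⟩, -⟩ := h (n + 1) b
    refine ⟨Fq, hq, ?_⟩
    unfold Gs; convert h1 using 2 with k
    rw [mul_assoc, show k + (r + 1) = k + 1 + r by ring]
  obtain ⟨Fq, h1, h2⟩ := key 0 0
  refine ⟨Fq, h1, fun n b => ?_⟩
  obtain ⟨F', h3, h4⟩ := key n b
  rwa [h1.uniq hp h3 h2.base.2.1 h4.base.2.1]
theorem Gs.pd2 {p0 R S s : ℝ} {r F a} (hp : p0 < 0) (h : ∀ n b, Gs p0 R S s n b r F a) :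
    ∃ Fp, PS p0 F Fp ∧ ∀ n b, Gs p0 R S s n b (r + 1) Fp (S * a) := by
  have key : ∀ n b, ∃ Fp, PS p0 F Fp ∧ Gs p0 R S s n b (r + 1) Fp (S * a) := fun n b => by
    obtain ⟨-, -, h1⟩ := h (n + 1) (b + 1)
    obtain ⟨Fp, hq, h1⟩ := h1 (by omega)
    rw [Nat.add_sub_cancel] at h1
    refine ⟨Fp, hq, ?_⟩
    unfold Gs; convert h1 using 2 with k
    rw [mul_assoc, show k + (r + 1) = k + 1 + r by ring]
  obtain ⟨Fq, h1, h2⟩ := key 0 0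
  refine ⟨Fq, h1, fun n b => ?_⟩
  obtain ⟨F', h3, h4⟩ := key n b
  rwa [h1.uniq hp h3 h2.base.2.1 h4.base.2.1]

theorem words {p0 R S s c : ℝ} (hs : 1 ≤ s) (hp0 : p0 < 0) (hR : 0 ≤ R) (hS : 0 ≤ S) (hc : 0 ≤ c)
    {U V : ℝ → ℝ → ℝ} (hU : ∀ n b, Gs p0 R S s n b 0 U c) (hV : ∀ n b, Gs p0 R S s n b 0 V c)
    {P : ℝ × ℝ → ℝ} {D : Set (ℝ × ℝ)} (hD : UniqueDiffOn ℝ D) (hP : MapsTo P D (Icc p0 0))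
    (hd : ∀ z ∈ D, HasFDerivWithinAt P ((-U z.1 (P z)) • ContinuousLinearMap.fst ℝ ℝ ℝ
      + V z.1 (P z) • ContinuousLinearMap.snd ℝ ℝ ℝ) D z) (m : ℕ) :
    ∀ (F : ℝ → ℝ → ℝ) (r : ℕ) (a : ℝ), 0 ≤ a → (∀ n b, Gs p0 R S s n b r F a) →
      ContDiffOn ℝ m (fun z => F z.1 (P z)) D ∧ ∀ v : Fin m → ℝ × ℝ, ∀ z ∈ D,
      |iteratedFDerivWithin ℝ m (fun z => F z.1 (P z)) D z v| ≤ a * (R + 8 * c * S) ^ m * eG s (r + m) * ∏ i, (|(v i).1| + |(v i).2|) := by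
  induction m with
  | zero =>
    intro F r a ha h
    refine ⟨?_, fun v z hz => ?_⟩
    · rw [Nat.cast_zero, contDiffOn_zero]
      have h1 := (h 0 0).base.1.1
      have h2 : ContinuousOn P D := fun z hz => (hd z hz).continuousWithinAt
      exact h1.comp_continuousOn (continuous_fst.continuousOn.prodMk h2)
    · simpa using (h 0 0).base.2.2 z.1 (P z)
  | succ m ih =>
    intro F r a ha h
    obtain ⟨Fq, hq, hq'⟩ := Gs.qd2 hp0.le h
    obtain ⟨Fp, hp, hp'⟩ := Gs.pd2 hp0 h
    have hX : ∀ n b, Gs p0 R S s n b (r + 1) (Fq - U * Fp) ((R + 8 * c * S) * a) := fun n b => by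
      refine ((hq' n b).sub (Gs.mul hR hS hs hc (by positivity) (hU n b) (hp' n b))).le hR hS (le_of_eq ?_)
      ring
    have hZ : ∀ n b, Gs p0 R S s n b (r + 1) (V * Fp) ((R + 8 * c * S) * a) := fun n b => by
      refine (Gs.mul hR hS hs hc (by positivity) (hV n b) (hp' n b)).le hR hS ?_
      have : 0 ≤ R * a := by positivity
      linarith
    obtain ⟨x1, x2⟩ := ih _ _ _ (by positivity) hX
    obtain ⟨y1, y2⟩ := ih _ _ _ (by positivity) hZ
    have hdf : ∀ z ∈ D, HasFDerivWithinAt (fun z => F z.1 (P z))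
        ((Fq - U * Fp) z.1 (P z) • ContinuousLinearMap.fst ℝ ℝ ℝ + (V * Fp) z.1 (P z) • ContinuousLinearMap.snd ℝ ℝ ℝ) D z := by
      intro z hz
      refine (comp_hd hq hp (hq' 0 0).base.1.1 hP hz (hd z hz)).congr_fderiv ?_
      ext <;> simp <;> ring
    have hfd : EqOn (fderivWithin ℝ (fun z => F z.1 (P z)) D) (fun z =>
        (Fq - U * Fp) z.1 (P z) • ContinuousLinearMap.fst ℝ ℝ ℝ + (V * Fp) z.1 (P z) • ContinuousLinearMap.snd ℝ ℝ ℝ) D :=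
      fun z hz => (hdf z hz).fderivWithin (hD z hz)
    have hcd : ContDiffOn ℝ m (fderivWithin ℝ (fun z => F z.1 (P z)) D) D :=
      ((x1.smul contDiffOn_const).add (y1.smul contDiffOn_const)).congr hfd
    refine ⟨?_, fun v z hz => ?_⟩
    · rw [Nat.cast_succ, contDiffOn_succ_iff_fderivWithin hD]
      exact ⟨fun z hz => (hdf z hz).differentiableWithinAt, by simp, hcd⟩
    · rw [iteratedFDerivWithin_succ_apply_right hD hz]
      have e := fun w => congrArg (fun L => L (Fin.init v)) ((ContinuousLinearMap.apply ℝ ℝ w).iteratedFDerivWithin_comp_left (i := m)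
        (hcd z hz) hD hz le_rfl)
      simp only [ContinuousLinearMap.compContinuousMultilinearMap_coe, Function.comp_apply, ContinuousLinearMap.apply_apply] at e
      have t1 : EqOn ((ContinuousLinearMap.apply ℝ ℝ ((1, 0) : ℝ × ℝ)) ∘ fderivWithin ℝ (fun z => F z.1 (P z)) D)
          (fun z => (Fq - U * Fp) z.1 (P z)) D := fun w hw => by
        simp only [Function.comp_apply, hfd hw]; simp
      have t2 : EqOn ((ContinuousLinearMap.apply ℝ ℝ ((0, 1) : ℝ × ℝ)) ∘ fderivWithin ℝ (fun z => F z.1 (P z)) D)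
          (fun z => (V * Fp) z.1 (P z)) D := fun w hw => by
        simp only [Function.comp_apply, hfd hw]; simp
      have u1 := x2 (Fin.init v) z hz
      have u2 := y2 (Fin.init v) z hz
      rw [← iteratedFDerivWithin_congr t1 hz, e] at u1
      rw [← iteratedFDerivWithin_congr t2 hz, e] at u2
      rw [show r + 1 + m = r + (m + 1) by ring] at u1 u2
      rw [Fin.prod_univ_castSucc]
      change |_| ≤ (R + 8 * c * S) * a * (R + 8 * c * S) ^ m * eG s (r + (m + 1)) * ∏ i : Fin m, (|(v i.castSucc).1| + |(v i.castSucc).2|) at u1 u2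
      generalize (∏ i : Fin m, (|(v i.castSucc).1| + |(v i.castSucc).2|)) = π at *
      generalize iteratedFDerivWithin ℝ m (fun y => fderivWithin ℝ (fun z => F z.1 (P z)) D y) D z (Fin.init v) = L at *
      generalize v (Fin.last m) = w
      have ew : w = w.1 • ((1, 0) : ℝ × ℝ) + w.2 • ((0, 1) : ℝ × ℝ) := by ext <;> simp
      have : L w = w.1 * L (1, 0) + w.2 * L (0, 1) := by
        conv_lhs => rw [ew]
        rw [map_add, map_smul, map_smul]; rfl
      rw [this]
      refine (abs_add_le _ _).trans ?_
      rw [abs_mul, abs_mul]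
      have := mul_le_mul_of_nonneg_left u1 (abs_nonneg w.1)
      have := mul_le_mul_of_nonneg_left u2 (abs_nonneg w.2)
      rw [pow_succ]
      linarith

theorem anal2 {D : Set (ℝ × ℝ)} {f : ℝ × ℝ → ℝ} (hD : UniqueDiffOn ℝ D) (hf : ContDiffOn ℝ (⊤ : ℕ∞) f D) {A T : ℝ}
    (hA : 0 ≤ A) (hT : 1 ≤ T) (hB : ∀ m, ∀ v : Fin m → ℝ × ℝ, ∀ z ∈ D,
      |iteratedFDerivWithin ℝ m f D z v| ≤ A * T ^ m * m.factorial * ∏ i, (|(v i).1| + |(v i).2|))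
    (star : ∀ z0 ∈ D, ∀ r > 0, ∃ z1 ∈ D, dist z1 z0 < r ∧ ∀ᶠ z in 𝓝[D] z0, ∀ t ∈ Icc (0:ℝ) 1, z1 + t • (z - z1) ∈ D) :
    AnalyticOn ℝ f D := by
  have hN : ∀ m, ∀ z ∈ D, ‖iteratedFDerivWithin ℝ m f D z‖ ≤ A * (2 * T) ^ m * m.factorial := by
    intro m z hz
    refine ContinuousMultilinearMap.opNorm_le_bound (by positivity) fun v => ?_
    refine (hB m v z hz).trans ?_
    calc _ ≤ A * T ^ m * m.factorial * ∏ i, (2 * ‖v i‖) := by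
          gcongr with i
          have h1 := norm_fst_le (v i)
          have h2 := norm_snd_le (v i)
          rw [Real.norm_eq_abs] at h1 h2
          linarith
      _ = _ := by rw [Finset.prod_mul_distrib, Finset.prod_const, Finset.card_univ, Fintype.card_fin, mul_pow]; ring
  intro z0 hz0
  rw [analyticWithinAt_iff_exists_analyticAt, insert_eq_of_mem hz0]
  set r := 1 / (8 * T) with hr
  have r0 : 0 < r := by positivity
  obtain ⟨z1, hz1, hd1, hst⟩ := star z0 hz0 r r0
  let p : FormalMultilinearSeries ℝ (ℝ × ℝ) ℝ := fun n => ((n.factorial : ℝ)⁻¹) • iteratedFDerivWithin ℝ n f D z1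
  have hpn : ∀ n, ‖p n‖ ≤ A * (2 * T) ^ n := fun n => by
    have : (0:ℝ) < n.factorial := by positivity
    simp only [p, norm_smul, norm_inv, RCLike.norm_natCast]
    rw [inv_mul_le_iff₀ this]
    refine (hN n z1 hz1).trans (le_of_eq ?_); ring
  have hrad : ENNReal.ofReal (2 * r) ≤ p.radius := by
    refine p.le_radius_of_bound A (r := (2 * r).toNNReal) fun n => ?_
    rw [Real.coe_toNNReal _ (by positivity)]
    calc _ ≤ A * (2 * T) ^ n * (2 * r) ^ n := by gcongr; exact hpn n
      _ = A * (1/2) ^ n := by rw [mul_assoc, ← mul_pow]; congr 2; rw [hr]; field_simp; norm_num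
      _ ≤ A * 1 := by gcongr; exact pow_le_one₀ (by norm_num) (by norm_num)
      _ = A := mul_one A
  have hpos : 0 < p.radius := lt_of_lt_of_le (by simpa using r0) hrad
  have hfp := p.hasFPowerSeriesOnBall hpos
  have hfp2 := hfp.comp_sub z1
  rw [zero_add] at hfp2
  refine ⟨fun z => p.sum (z - z1), ?_, hfp2.analyticAt_of_mem ?_⟩
  swap
  · refine Metric.eball_subset_eball hrad ?_
    rw [Metric.mem_eball, edist_dist]
    rw [ENNReal.ofReal_lt_ofReal_iff (by positivity), dist_comm]; linarith
  have near : ∀ᶠ z in 𝓝[D] z0, dist z z1 < 2 * r := by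
    have : Metric.ball z1 (2 * r) ∈ 𝓝 z0 := Metric.isOpen_ball.mem_nhds (by
      rw [Metric.mem_ball, dist_comm]; linarith)
    exact mem_nhdsWithin_of_mem_nhds this
  filter_upwards [hst, near, self_mem_nhdsWithin] with z h1 h2 hz
  set w := z - z1 with hw
  have hwn : ‖w‖ < 2 * r := by rwa [hw, ← dist_eq_norm]
  have hs1 : HasSum (fun n => p n fun _ => w) (p.sum w) :=
    p.hasSum (Metric.eball_subset_eball hrad (by
      rw [Metric.mem_eball, edist_zero_right, ← ofReal_norm_eq_enorm, ENNReal.ofReal_lt_ofReal_iff (by positivity)]; exact hwn))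
  refine tendsto_nhds_unique ?_ hs1.tendsto_sum_nat
  -- Taylor along the segment
  let φ : ℕ → ℝ → ℝ := fun k t => iteratedFDerivWithin ℝ k f D (z1 + t • w) (fun _ => w)
  have hφ : ∀ k, ∀ t ∈ Icc (0:ℝ) 1, HasDerivWithinAt (φ k) (φ (k + 1) t) (Icc 0 1) t := by
    intro k t ht
    have g1 : HasFDerivWithinAt (iteratedFDerivWithin ℝ k f D) (fderivWithin ℝ (iteratedFDerivWithin ℝ k f D) D (z1 + t • w)) D (z1 + t • w) :=
      ((hf.differentiableOn_iteratedFDerivWithin (m := k) (by exact_mod_cast WithTop.coe_lt_top k) hD) _ (h1 t ht)).hasFDerivWithinAt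
    have g2 : HasDerivWithinAt (fun t : ℝ => z1 + t • w) w (Icc 0 1) t := by
      have := ((hasDerivAt_id t).smul_const w).const_add z1
      simpa using this.hasDerivWithinAt
    have g3 := (g1.comp_hasDerivWithinAt t g2 h1)
    have g4 := (ContinuousMultilinearMap.apply ℝ (fun _ : Fin k => ℝ × ℝ) ℝ (fun _ => w)).hasFDerivAt.comp_hasDerivWithinAt t g3
    refine g4.congr_deriv ?_
    simp only [φ, iteratedFDerivWithin_succ_apply_left]
    rfl
  have hbd : ∀ n, |f z - ∑ k ∈ Finset.range n, p k fun _ => w| ≤ A * (4 * T * r) ^ n := by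
    intro n
    have := taylor01 n φ (A * (2 * T) ^ n * n.factorial * (2 * r) ^ n) hφ (fun t ht => by
      refine ((iteratedFDerivWithin ℝ n f D (z1 + t • w)).le_opNorm _).trans ?_
      rw [Finset.prod_const, Finset.card_univ, Fintype.card_fin]
      gcongr
      exact hN n _ (h1 t ht)) 1 (by simp)
    have e0 : φ 0 1 = f z := by simp [φ, hw]
    have e1 : ∀ k, φ k 0 * 1 ^ k / k.factorial = p k fun _ => w := fun k => by
      simp [φ, p, div_eq_inv_mul]
    simp only [e0, e1] at this
    refine this.trans (le_of_eq ?_)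
    have : (0:ℝ) < n.factorial := by positivity
    field_simp
    rw [one_pow, mul_one, mul_assoc, ← mul_pow]; congr 2; ring
  rw [tendsto_iff_norm_sub_tendsto_zero]
  have hq : Tendsto (fun n : ℕ => A * (4 * T * r) ^ n) atTop (𝓝 0) := by
    have := (tendsto_pow_atTop_nhds_zero_of_lt_one (r := 4 * T * r) (by positivity) (by rw [hr]; field_simp; norm_num)).const_mul A
    simpa using this
  refine squeeze_zero (fun _ => norm_nonneg _) (fun n => ?_) hq
  rw [← norm_neg, neg_sub]; exact hbd n

theorem eG_le {s : ℝ} (k : ℕ) : eG s k ≤ (k.factorial : ℝ) ^ s := by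
  unfold eG
  have : (0:ℝ) ≤ (k.factorial : ℝ) ^ s := by positivity
  refine div_le_self this ?_
  have : (0:ℝ) ≤ k := by positivity
  nlinarith

theorem phys {p0 R S s c : ℝ} (hs : 1 ≤ s) (hp0 : p0 < 0) (hR : 1 ≤ R) (hS : 1 ≤ S) (hc : 1 ≤ c)
    {U V : ℝ → ℝ → ℝ} (hUV : ∀ n b, Gs p0 R S s n b 0 U c ∧ Gs p0 R S s n b 0 V c)
    {ψ : ℝ × ℝ → ℝ} {D : Set (ℝ × ℝ)} (hD : UniqueDiffOn ℝ D) (hP : ∀ z ∈ D, -ψ z ∈ Icc p0 0)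
    (hd : ∀ z ∈ D, HasFDerivWithinAt ψ (U z.1 (-ψ z) • ContinuousLinearMap.fst ℝ ℝ ℝ
      - V z.1 (-ψ z) • ContinuousLinearMap.snd ℝ ℝ ℝ) D z)
    (star : ∀ z0 ∈ D, ∀ r > 0, ∃ z1 ∈ D, dist z1 z0 < r ∧ ∀ᶠ z in 𝓝[D] z0, ∀ t ∈ Icc (0:ℝ) 1, z1 + t • (z - z1) ∈ D) :
    GevreyOn2 s D ψ ∧ (s = 1 → AnalyticOn ℝ ψ D) := by
  set A := 4 * (1 - p0) with hA
  set T := R + 8 * c * S with hT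
  have T1 : 1 ≤ T := by have : 0 ≤ 8 * c * S := by positivity
                        rw [hT]; linarith
  have A1 : 1 ≤ A := by rw [hA]; linarith
  let h : ℕ → ℝ → ℝ := fun k p => match k with
    | 0 => -p
    | 1 => -1
    | _ => 0
  have hF : ∀ n b, Gs p0 R S s n b 0 (fun _ p => h 0 (clp p0 p)) A := by
    refine Gv.of_p hp0 (by linarith) (by linarith) h _ ?_ ?_
    · intro k p hp
      match k with
      | 0 => exact (hasDerivAt_neg p).hasDerivWithinAt
      | 1 => exact (hasDerivAt_const p _).hasDerivWithinAt
      | k + 2 => exact (hasDerivAt_const p _).hasDerivWithinAt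
    · intro k p hp
      match k with
      | 0 => simp only [h, abs_neg, eG]; rw [abs_of_nonpos hp.2]; simp; linarith [hp.1]
      | 1 =>
        simp [h, eG]; norm_num
        have : A / 4 * 1 ≤ A / 4 * S := by gcongr
        have e : 1 ≤ A / 4 := by rw [hA]; linarith
        linarith
      | k + 2 => simp only [h, abs_zero]; have := (eG_pos s (k + 2 + 0)).le; positivity
  have key := fun m => words hs hp0 (by linarith) (by linarith) (by linarith) (fun n b => (hUV n b).1) (fun n b => (hUV n b).2)
    (P := fun z => -ψ z) hD hP (fun z hz => (hd z hz).neg.congr_fderiv (by ext <;> simp)) m _ 0 A (by linarith) hF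
  have e : EqOn ψ (fun z => h 0 (clp p0 (-ψ z))) D := fun z hz => by
    simp only [h, clp_eq (hP z hz), neg_neg]
  have cd : ContDiffOn ℝ (⊤ : ℕ∞) ψ D := contDiffOn_infty.mpr fun m => (key m).1.congr e
  have bd : ∀ m, ∀ v : Fin m → ℝ × ℝ, ∀ z ∈ D,
      |iteratedFDerivWithin ℝ m ψ D z v| ≤ A * T ^ m * (m.factorial : ℝ) ^ s * ∏ i, (|(v i).1| + |(v i).2|) := by
    intro m v z hz
    rw [iteratedFDerivWithin_congr e hz]
    refine ((key m).2 v z hz).trans ?_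
    rw [zero_add]
    gcongr
    exact eG_le m
  refine ⟨⟨cd, A * T, one_le_mul_of_one_le_of_one_le A1 T1, fun a b z hz => ?_⟩, fun hs1 => anal2 (A := A) (T := T) hD cd (by linarith) T1 ?_ star⟩
  · refine (bd _ _ z hz).trans ?_
    rw [Finset.prod_eq_one (fun i _ => by split_ifs <;> simp), mul_one]
    gcongr
    rw [mul_pow, pow_succ, pow_succ]
    have := one_le_pow₀ (n := a + b) A1
    have : 0 < T ^ (a + b) := by positivity
    calc A * T ^ (a + b) = (1 * A) * (T ^ (a + b) * 1) := by ring
      _ ≤ _ := by gcongr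
  · subst hs1
    simpa only [Real.rpow_one] using bd

end

section

open MeasureTheory Filter Topology

def Om (d : ℝ) (η : ℝ → ℝ) : Set (ℝ × ℝ) := {z | -d ≤ z.2 ∧ z.2 ≤ η z.1}

theorem loc_lip {η : ℝ → ℝ} (hη : ContDiff ℝ 2 η) (x0 : ℝ) : ∃ L ≥ 0, ∃ r > 0, ∀ x x', |x - x0| < r → |x' - x0| < r →
    |η x - η x'| ≤ L * |x - x'| := by
  obtain ⟨K, t, ht, hK⟩ := (hη.contDiffAt (x := x0) |>.of_le (by norm_num : (1 : WithTop ℕ∞) ≤ 2)).exists_lipschitzOnWith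
  obtain ⟨r, hr, hb⟩ := Metric.mem_nhds_iff.mp ht
  exact ⟨K, K.2, r, hr, fun x x' h h' => hK.dist_le_mul x (hb h) x' (hb h')⟩

theorem Om_ud {d : ℝ} {η : ℝ → ℝ} (hη : ContDiff ℝ 2 η) (hd : ∀ x, -d < η x) : UniqueDiffOn ℝ (Om d η) := by
  rintro ⟨x0, y0⟩ ⟨h1, h2⟩
  obtain ⟨L, L0, r, hr, hL⟩ := loc_lip hη x0
  simp only at h1 h2
  have hc : ConvexOn ℝ univ (fun z : ℝ × ℝ => |z.1 - x0|) := by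
    have := (convexOn_univ_norm (E := ℝ)).comp_affineMap ((LinearMap.fst ℝ ℝ ℝ).toAffineMap - AffineMap.const ℝ (ℝ × ℝ) x0)
    exact this
  have hl : ConvexOn ℝ univ (fun z : ℝ × ℝ => z.2) := (LinearMap.snd ℝ ℝ ℝ).convexOn convex_univ
  have hl' : ConcaveOn ℝ univ (fun z : ℝ × ℝ => z.2) := (LinearMap.snd ℝ ℝ ℝ).concaveOn convex_univ
  have c1 := (hl'.convex_ge (-d)).inter ((hc.convex_lt r).inter (((hc.smul L0).add hl).convex_le (η x0)))
  refine UniqueDiffWithinAt.mono (uniqueDiffWithinAt_convex c1 ⟨(x0, (η x0 - d) / 2), ?_⟩ (subset_closure ?_)) ?_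
  · rw [mem_interior]
    refine ⟨{z : ℝ × ℝ | -d < z.2 ∧ |z.1 - x0| < r ∧ L * |z.1 - x0| + z.2 < η x0}, ?_, ?_, ?_⟩
    · rintro z ⟨a, b, c⟩
      exact ⟨⟨trivial, a.le⟩, ⟨trivial, b⟩, ⟨trivial, c.le⟩⟩
    · simp only [setOf_and]
      refine IsOpen.inter (isOpen_lt ?_ ?_) (IsOpen.inter (isOpen_lt ?_ ?_) (isOpen_lt ?_ ?_)) <;> fun_prop
    · have := hd x0
      refine ⟨?_, ?_, ?_⟩ <;> simp <;> linarith
  · refine ⟨⟨trivial, h1⟩, ⟨trivial, ?_⟩, ⟨trivial, ?_⟩⟩ <;> simpa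
  · rintro z ⟨⟨-, a⟩, ⟨-, b⟩, ⟨-, c⟩⟩
    refine ⟨a, ?_⟩
    have := hL z.1 x0 b (by simpa)
    have c : L * |z.1 - x0| + z.2 ≤ η x0 := c
    linarith [(abs_le.mp this).1]

theorem Om_cl {d : ℝ} {η : ℝ → ℝ} (hd : ∀ x, -d < η x) :
    Om d η ⊆ closure {z : ℝ × ℝ | -d < z.2 ∧ z.2 < η z.1} := by
  rintro ⟨x, y⟩ ⟨h1, h2⟩
  simp only at h1 h2
  have hx := hd x
  have t : Tendsto (fun θ : ℝ => (x, y + θ * ((η x - d) / 2 - y))) (𝓝[>] 0) (𝓝 (x, y)) := by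
    have : Continuous (fun θ : ℝ => (x, y + θ * ((η x - d) / 2 - y))) := by fun_prop
    have := (this.tendsto 0).mono_left (nhdsWithin_le_nhds (s := Ioi 0))
    simpa using this
  refine mem_closure_of_tendsto t ?_
  filter_upwards [Ioo_mem_nhdsGT (show (0:ℝ) < 1 by norm_num)] with θ ⟨a, b⟩
  constructor
  · show -d < y + θ * ((η x - d) / 2 - y)
    nlinarith
  · show y + θ * ((η x - d) / 2 - y) < η x
    nlinarith

theorem Om_open {d : ℝ} {η : ℝ → ℝ} (hη : ContDiff ℝ 2 η) : IsOpen {z : ℝ × ℝ | -d < z.2 ∧ z.2 < η z.1} := by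
  have := hη.continuous
  simp only [setOf_and]
  refine IsOpen.inter (isOpen_lt ?_ ?_) (isOpen_lt ?_ ?_) <;> fun_prop

theorem Om_star {d : ℝ} {η : ℝ → ℝ} (hη : ContDiff ℝ 2 η) (hd : ∀ x, -d < η x) :
    ∀ z0 ∈ Om d η, ∀ r > 0, ∃ z1 ∈ Om d η, dist z1 z0 < r ∧
      ∀ᶠ z in 𝓝[Om d η] z0, ∀ t ∈ Icc (0:ℝ) 1, z1 + t • (z - z1) ∈ Om d η := by
  rintro ⟨x0, y0⟩ ⟨h1, h2⟩ r hr
  simp only at h1 h2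
  obtain ⟨L, L0, r', hr', hL⟩ := loc_lip hη x0
  have hx := hd x0
  obtain ⟨y1, a1, a2, a3⟩ : ∃ y1, -d ≤ y1 ∧ y1 < η x0 ∧ |y1 - y0| < r := by
    obtain ⟨h, k1, k2⟩ : ∃ h, 0 < h ∧ h < r := exists_between hr
    rcases h2.lt_or_eq with h2 | h2
    · exact ⟨y0, h1, h2, by simpa⟩
    · refine ⟨max (-d) (y0 - h), le_max_left _ _, max_lt hx (by linarith), ?_⟩
      rw [abs_lt]
      constructor
      · have := le_max_right (-d) (y0 - h); linarith
      · have : max (-d) (y0 - h) ≤ y0 := max_le h1 (by linarith)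
        linarith
  refine ⟨(x0, y1), ⟨a1, a2.le⟩, ?_, ?_⟩
  · rw [Prod.dist_eq]; simp [hr]; exact a3
  have e1 : ∀ᶠ z : ℝ × ℝ in 𝓝[Om d η] (x0, y0), |z.1 - x0| < r' ∧ 2 * L * |z.1 - x0| < η x0 - y1 := by
    refine mem_nhdsWithin_of_mem_nhds (IsOpen.mem_nhds ?_ ?_)
    · simp only [setOf_and]
      refine IsOpen.inter (isOpen_lt ?_ ?_) (isOpen_lt ?_ ?_) <;> fun_prop
    constructor <;> simp [hr', a2]
  filter_upwards [e1, self_mem_nhdsWithin] with z ⟨b1, b2⟩ ⟨b3, b4⟩ t ⟨t0, t1⟩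
  constructor
  · show -d ≤ y1 + t * (z.2 - y1)
    nlinarith
  · show y1 + t * (z.2 - y1) ≤ η (x0 + t * (z.1 - x0))
    have c1 := hL z.1 (x0 + t * (z.1 - x0)) b1 (by
      rw [add_sub_cancel_left, abs_mul, abs_of_nonneg t0]
      have := abs_nonneg (z.1 - x0)
      nlinarith)
    rw [show z.1 - (x0 + t * (z.1 - x0)) = (1 - t) * (z.1 - x0) by ring, abs_mul, abs_of_nonneg (sub_nonneg.mpr t1)] at c1
    have c2 := hL z.1 x0 b1 (by simpa)
    have c3 := (abs_le.mp c1).2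
    have c4 := (abs_le.mp c2).1
    have : 0 ≤ (1 - t) * (η x0 - y1 - 2 * (L * |z.1 - x0|)) := mul_nonneg (by linarith) (by linarith)
    have : 0 ≤ (1 - t) * (η z.1 - η x0 + L * |z.1 - x0|) := mul_nonneg (by linarith) (by linarith)
    have : t * z.2 ≤ t * η z.1 := by gcongr
    linarith

end

section

open MeasureTheory Filter Topology

/-- the linear form `(x,y) ↦ u x + v y` -/
def lin (u v : ℝ) : ℝ × ℝ →L[ℝ] ℝ := u • ContinuousLinearMap.fst ℝ ℝ ℝ + v • ContinuousLinearMap.snd ℝ ℝ ℝ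

theorem lin_eq (L : ℝ × ℝ →L[ℝ] ℝ) : L = lin (L (1, 0)) (L (0, 1)) := by
  ext <;> simp [lin]

theorem mpw_facts {d : ℝ} {η : ℝ → ℝ} (hη : ContDiff ℝ 2 η) (hd : ∀ x, -d < η x) {ψ : ℝ × ℝ → ℝ}
    (h : ContDiffOn ℝ 2 ψ (Om d η)) :
    (∀ z ∈ Om d η, HasFDerivWithinAt ψ (lin (mpw (Om d η) 1 0 ψ z) (mpw (Om d η) 0 1 ψ z)) (Om d η) z) ∧
    (∀ z ∈ Om d η, HasFDerivWithinAt (mpw (Om d η) 1 0 ψ) (lin (mpw (Om d η) 2 0 ψ z) (mpw (Om d η) 1 1 ψ z)) (Om d η) z) ∧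
    (∀ z ∈ Om d η, HasFDerivWithinAt (mpw (Om d η) 0 1 ψ) (lin (mpw (Om d η) 1 1 ψ z) (mpw (Om d η) 0 2 ψ z)) (Om d η) z) ∧
    (∀ i j, i + j = 2 → ContinuousOn (mpw (Om d η) i j ψ) (Om d η)) := by
  have ud := Om_ud hη hd
  obtain ⟨S, hS⟩ : ∃ S, S = Om d η := ⟨_, rfl⟩
  have hsub : {z : ℝ × ℝ | -d < z.2 ∧ z.2 < η z.1} ⊆ S := by
    rw [hS]; exact fun z hz => ⟨hz.1.le, hz.2.le⟩
  have hcl : S ⊆ closure (interior S) := by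
    refine (hS ▸ Om_cl hd).trans (closure_mono ?_)
    exact interior_maximal hsub (Om_open hη)
  rw [← hS] at ud h ⊢
  have m1 : ∀ i j, i + j = 1 → ∀ z ∈ S, mpw S i j ψ z = fderivWithin ℝ ψ S z (if 0 < i then (1, 0) else (0, 1)) := by
    intro i j hij z hz
    obtain ⟨rfl, rfl⟩ | ⟨rfl, rfl⟩ : (i = 1 ∧ j = 0) ∨ (i = 0 ∧ j = 1) := by omega
    · exact iteratedFDerivWithin_one_apply (ud z hz) _
    · exact iteratedFDerivWithin_one_apply (ud z hz) _
  have m2 : ∀ i j, i + j = 2 → ∀ z ∈ S, mpw S i j ψ z = fderivWithin ℝ (fderivWithin ℝ ψ S) S z (if 0 < i then (1, 0) else (0, 1))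
      (if 1 < i then (1, 0) else (0, 1)) := by
    intro i j hij z hz
    obtain ⟨rfl, rfl⟩ | ⟨rfl, rfl⟩ | ⟨rfl, rfl⟩ : (i = 2 ∧ j = 0) ∨ (i = 0 ∧ j = 2) ∨ (i = 1 ∧ j = 1) := by omega
    · exact iteratedFDerivWithin_two_apply ψ ud hz _
    · exact iteratedFDerivWithin_two_apply ψ ud hz _
    · exact iteratedFDerivWithin_two_apply ψ ud hz _
  have d1 : ContDiffOn ℝ 1 (fderivWithin ℝ ψ S) S := h.fderivWithin ud (by norm_num)
  have d2 : ContDiffOn ℝ 0 (fderivWithin ℝ (fderivWithin ℝ ψ S) S) S := d1.fderivWithin ud (by norm_num)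
  have D : ∀ z ∈ S, HasFDerivWithinAt (fderivWithin ℝ ψ S) (fderivWithin ℝ (fderivWithin ℝ ψ S) S z) S z := fun z hz =>
    (d1.differentiableOn (by norm_num) z hz).hasFDerivWithinAt
  have sym : ∀ z ∈ S, ∀ u v, fderivWithin ℝ (fderivWithin ℝ ψ S) S z u v = fderivWithin ℝ (fderivWithin ℝ ψ S) S z v u := by
    intro z hz u v
    exact (h z hz).isSymmSndFDerivWithinAt (by simp) ud (hcl hz) hz u v
  refine ⟨fun z hz => ?_, fun z hz => ?_, fun z hz => ?_, fun i j hij => ?_⟩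
  · have := (h.differentiableOn (by norm_num) z hz).hasFDerivWithinAt
    rw [lin_eq (fderivWithin ℝ ψ S z)] at this
    rw [m1 1 0 rfl z hz, m1 0 1 rfl z hz]; exact this
  · have := (D z hz).clm_apply (hasFDerivWithinAt_const ((1:ℝ), (0:ℝ)) z S)
    refine (this.congr (fun y hy => m1 1 0 rfl y hy) (m1 1 0 rfl z hz)).congr_fderiv ?_
    rw [lin_eq (_ + _), m2 2 0 rfl z hz, m2 1 1 rfl z hz]
    simp [sym z hz (0,1) (1,0)]
  · have := (D z hz).clm_apply (hasFDerivWithinAt_const ((0:ℝ), (1:ℝ)) z S)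
    refine (this.congr (fun y hy => m1 0 1 rfl y hy) (m1 0 1 rfl z hz)).congr_fderiv ?_
    rw [lin_eq (_ + _), m2 0 2 rfl z hz, m2 1 1 rfl z hz]
    simp
  · exact ((d2.continuousOn.clm_apply continuousOn_const).clm_apply continuousOn_const).congr (m2 i j hij)

end

section

open MeasureTheory Filter Topology

structure Hod (p0 d δ : ℝ) (η : ℝ → ℝ) (ψ A B a b c : ℝ × ℝ → ℝ) : Prop where
  hp : p0 < 0
  hδ : 0 < δ
  hd : ∀ x, -d < η x
  hη : ContDiff ℝ 2 η
  top : ∀ x, ψ (x, η x) = 0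
  bot : ∀ x, ψ (x, -d) = -p0
  neg : ∀ z ∈ Om d η, B z ≤ -δ
  dψ : ∀ z ∈ Om d η, HasFDerivWithinAt ψ (lin (A z) (B z)) (Om d η) z
  dA : ∀ z ∈ Om d η, HasFDerivWithinAt A (lin (a z) (b z)) (Om d η) z
  dB : ∀ z ∈ Om d η, HasFDerivWithinAt B (lin (b z) (c z)) (Om d η) z
  ca : ContinuousOn a (Om d η)
  cb : ContinuousOn b (Om d η)
  cc : ContinuousOn c (Om d η)

variable {p0 d δ : ℝ} {η : ℝ → ℝ} {ψ A B a b c : ℝ × ℝ → ℝ}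

theorem lin_app (u v : ℝ) (z : ℝ × ℝ) : lin u v z = u * z.1 + v * z.2 := by simp [lin]

theorem Om_nhds (hη : ContDiff ℝ 2 η) {z : ℝ × ℝ} (h1 : -d < z.2) (h2 : z.2 < η z.1) : Om d η ∈ 𝓝 z :=
  mem_of_superset ((Om_open hη).mem_nhds ⟨h1, h2⟩) fun _ h => ⟨h.1.le, h.2.le⟩

/-- vertical mean value theorem -/
theorem ymv (hη : ContDiff ℝ 2 η) {F u v : ℝ × ℝ → ℝ}
    (hF : ∀ z ∈ Om d η, HasFDerivWithinAt F (lin (u z) (v z)) (Om d η) z) {x y y' : ℝ} (h1 : -d ≤ y) (h2 : y < y') (h3 : y' ≤ η x) :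
    ∃ t ∈ Ioo y y', F (x, y') - F (x, y) = v (x, t) * (y' - y) := by
  have hc : ContinuousOn F (Om d η) := fun z hz => (hF z hz).continuousWithinAt
  obtain ⟨t, ht, e⟩ := exists_hasDerivAt_eq_slope (fun y => F (x, y)) (fun y => v (x, y)) h2
    (hc.comp (Continuous.continuousOn (by fun_prop)) fun t ht => ⟨h1.trans ht.1, ht.2.trans h3⟩) (fun t ht => by
      have a1 : -d < t := lt_of_le_of_lt h1 ht.1
      have a2 : t < η x := lt_of_lt_of_le ht.2 h3
      have := ((hF (x, t) ⟨a1.le, a2.le⟩).hasFDerivAt (Om_nhds hη a1 a2)).comp_hasDerivAt t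
        ((hasDerivAt_const t x).prodMk (hasDerivAt_id t))
      refine this.congr_deriv ?_
      simp [lin_app])
  refine ⟨t, ht, ?_⟩
  rw [e]; field_simp [(sub_pos.mpr h2).ne']

theorem Hod.slope (h : Hod p0 d δ η ψ A B a b c) {x y y' : ℝ} (h1 : -d ≤ y) (h2 : y ≤ y') (h3 : y' ≤ η x) :
    δ * (y' - y) ≤ ψ (x, y) - ψ (x, y') := by
  rcases h2.eq_or_lt with rfl | h2
  · simp
  obtain ⟨t, ht, e⟩ := ymv h.hη h.dψ h1 h2 h3
  have := h.neg (x, t) ⟨h1.trans ht.1.le, ht.2.le.trans h3⟩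
  nlinarith only [this, e, sub_pos.mpr h2]

theorem Hod.slope' (h : Hod p0 d δ η ψ A B a b c) {x y y' : ℝ} (h1 : (x, y) ∈ Om d η) (h2 : (x, y') ∈ Om d η) :
    δ * |y - y'| ≤ |ψ (x, y) - ψ (x, y')| := by
  rcases le_total y y' with hh | hh
  · rw [abs_sub_comm y, abs_of_nonneg (sub_nonneg.mpr hh)]
    exact (h.slope h1.1 hh h2.2).trans (le_abs_self _)
  · rw [abs_sub_comm (ψ _), abs_of_nonneg (sub_nonneg.mpr hh)]
    exact (h.slope h2.1 hh h1.2).trans (le_abs_self _)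

theorem Hod.cψ (h : Hod p0 d δ η ψ A B a b c) : ContinuousOn ψ (Om d η) := fun z hz => (h.dψ z hz).continuousWithinAt

theorem Hod.mem (h : Hod p0 d δ η ψ A B a b c) {z : ℝ × ℝ} (hz : z ∈ Om d η) : -ψ z ∈ Icc p0 0 := by
  have h1 := h.slope (x := z.1) le_rfl hz.1 hz.2
  have h2 := h.slope (x := z.1) hz.1 hz.2 le_rfl
  have := mul_nonneg h.hδ.le (sub_nonneg.mpr hz.1)
  have := mul_nonneg h.hδ.le (sub_nonneg.mpr hz.2)
  rw [h.bot] at h1; rw [h.top] at h2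
  constructor <;> linarith

/-- height function in hodograph variables -/
structure HY (p0 d : ℝ) (η : ℝ → ℝ) (ψ : ℝ × ℝ → ℝ) (Y : ℝ → ℝ → ℝ) : Prop where
  mem : ∀ q p, (q, Y q p) ∈ Om d η
  eq : ∀ q p, ψ (q, Y q p) = -clp p0 p

theorem Hod.exY (h : Hod p0 d δ η ψ A B a b c) : ∃ Y, HY p0 d η ψ Y := by
  have : ∀ q p, ∃ y, (q, y) ∈ Om d η ∧ ψ (q, y) = -clp p0 p := by
    intro q p
    have hc : ContinuousOn (fun y => ψ (q, y)) (Icc (-d) (η q)) :=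
      h.cψ.comp (Continuous.continuousOn (by fun_prop)) fun t ht => ht
    have := intermediate_value_Icc' (h.hd q).le hc
    have hm := clp_mem h.hp.le (p := p)
    obtain ⟨y, hy, e⟩ := this (show -clp p0 p ∈ _ by
      rw [h.top, h.bot]; exact ⟨by linarith [hm.2], by linarith [hm.1]⟩)
    exact ⟨y, hy, e⟩
  choose Y h1 h2 using this
  exact ⟨Y, h1, h2⟩

variable {Y : ℝ → ℝ → ℝ}

theorem Hod.uniq (h : Hod p0 d δ η ψ A B a b c) (hY : HY p0 d η ψ Y) {z : ℝ × ℝ} (hz : z ∈ Om d η) {p : ℝ}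
    (e : ψ z = -clp p0 p) : Y z.1 p = z.2 := by
  have := h.slope' (x := z.1) (y := Y z.1 p) (y' := z.2) (hY.mem _ _) hz
  rw [hY.eq, show (z.1, z.2) = z from rfl, e, sub_self, abs_zero] at this
  by_contra hne
  have := mul_pos h.hδ (abs_pos.mpr (sub_ne_zero.mpr hne))
  linarith

theorem Hod.cY (h : Hod p0 d δ η ψ A B a b c) (hY : HY p0 d η ψ Y) : Continuous (fun z : ℝ × ℝ => Y z.1 z.2) := by
  rw [continuous_iff_continuousAt]
  rintro ⟨q0, r0⟩
  have cη := h.hη.continuous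
  have hm := hY.mem q0 r0
  obtain ⟨π, hπ⟩ : ∃ π : ℝ → ℝ, π = fun q => max (-d) (min (Y q0 r0) (η q)) := ⟨_, rfl⟩
  have πc : Continuous π := by rw [hπ]; fun_prop
  have πm : ∀ q, (q, π q) ∈ Om d η := fun q => by
    rw [hπ]; exact ⟨le_max_left _ _, max_le (h.hd q).le (min_le_right _ _)⟩
  have π0 : π q0 = Y q0 r0 := by
    rw [hπ]; simp only [min_eq_left hm.2]; exact max_eq_right hm.1
  have hψc : Continuous (fun q => ψ (q, π q)) := by
    rw [← continuousOn_univ]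
    exact h.cψ.comp (Continuous.continuousOn (by fun_prop)) fun q _ => πm q
  have t1 : Tendsto (fun z : ℝ × ℝ => δ⁻¹ * |-clp p0 z.2 - ψ (z.1, π z.1)|) (𝓝 (q0, r0)) (𝓝 0) := by
    have hcc : Continuous (fun z : ℝ × ℝ => δ⁻¹ * |-clp p0 z.2 - ψ (z.1, π z.1)|) :=
      continuous_const.mul ((((clp_cont p0).comp continuous_snd).neg.sub (hψc.comp continuous_fst)).abs)
    have := hcc.tendsto (q0, r0)
    simpa [π0, hY.eq] using this
  have t2 : Tendsto (fun z : ℝ × ℝ => Y z.1 z.2 - π z.1) (𝓝 (q0, r0)) (𝓝 0) := by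
    refine squeeze_zero_norm (fun z => ?_) t1
    have := h.slope' (hY.mem z.1 z.2) (πm z.1)
    rw [hY.eq] at this
    rw [Real.norm_eq_abs, inv_mul_eq_div, le_div_iff₀ h.hδ, mul_comm]; exact this
  have t3 := t2.add ((πc.comp continuous_fst).tendsto (q0, r0))
  simpa [ContinuousAt, π0] using t3

theorem Hod.compc (h : Hod p0 d δ η ψ A B a b c) (hY : HY p0 d η ψ Y) {F : ℝ × ℝ → ℝ} (hF : ContinuousOn F (Om d η)) :
    Continuous (fun z : ℝ × ℝ => F (z.1, Y z.1 z.2)) := by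
  have := h.cY hY
  rw [← continuousOn_univ]
  exact hF.comp (Continuous.continuousOn (by fun_prop)) fun z _ => hY.mem z.1 z.2

theorem Hod.int (h : Hod p0 d δ η ψ A B a b c) (hY : HY p0 d η ψ Y) {q p : ℝ} (hp : p ∈ Ioo p0 0) : Om d η ∈ 𝓝 (q, Y q p) := by
  have hm := hY.mem q p
  have e := hY.eq q p
  rw [clp_eq (Ioo_subset_Icc_self hp)] at e
  refine Om_nhds h.hη (lt_of_le_of_ne hm.1 fun h1 => ?_) (lt_of_le_of_ne hm.2 fun h1 => ?_)
  · simp only at h1; rw [← h1, h.bot] at e; linarith [hp.1]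
  · simp only at h1; rw [h1, h.top] at e; linarith [hp.2]

theorem Hod.fdY (h : Hod p0 d δ η ψ A B a b c) (hY : HY p0 d η ψ Y) {q p : ℝ} (hp : p ∈ Ioo p0 0) :
    HasFDerivAt (fun z : ℝ × ℝ => Y z.1 z.2) (lin (A (q, Y q p) / (-B (q, Y q p))) (1 / (-B (q, Y q p)))) (q, p) := by
  have hm := hY.mem q p
  have hB : B (q, Y q p) ≠ 0 := by have := h.neg _ hm; linarith [h.hδ]
  have d1 := (h.dψ _ hm).hasFDerivAt (h.int hY hp)
  generalize A (q, Y q p) = α at *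
  generalize B (q, Y q p) = γ at *
  let f' : (ℝ × ℝ) ≃L[ℝ] (ℝ × ℝ) := ContinuousLinearEquiv.equivOfInverse
    ((ContinuousLinearMap.fst ℝ ℝ ℝ).prod (-lin α γ)) ((ContinuousLinearMap.fst ℝ ℝ ℝ).prod (lin (α / (-γ)) (1 / (-γ))))
    (fun z => by ext <;> simp [lin_app]; field_simp; ring) (fun z => by ext <;> simp [lin_app]; field_simp; ring)
  have d2 : HasFDerivAt (fun z : ℝ × ℝ => (z.1, -ψ z)) (f' : (ℝ × ℝ) →L[ℝ] (ℝ × ℝ)) (q, Y q p) :=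
    hasFDerivAt_fst.prodMk d1.neg
  have d3 := HasFDerivAt.of_local_left_inverse (g := fun z : ℝ × ℝ => (z.1, Y z.1 z.2)) (a := (q, p))
    ((continuous_fst.prodMk (h.cY hY)).continuousAt) d2 (by
      have : {z : ℝ × ℝ | z.2 ∈ Ioo p0 0} ∈ 𝓝 (q, p) := (isOpen_Ioo.preimage continuous_snd).mem_nhds hp
      filter_upwards [this] with z hz
      ext
      · rfl
      · simp [hY.eq, clp_eq (Ioo_subset_Icc_self hz)])
  refine (HasFDerivAt.comp (g := Prod.snd) (q, p) hasFDerivAt_snd d3).congr_fderiv ?_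
  ext <;> simp [f', lin_app]

theorem Hod.fdF (h : Hod p0 d δ η ψ A B a b c) (hY : HY p0 d η ψ Y) {q p : ℝ} (hp : p ∈ Ioo p0 0) {F u v : ℝ × ℝ → ℝ}
    (hF : ∀ z ∈ Om d η, HasFDerivWithinAt F (lin (u z) (v z)) (Om d η) z) :
    HasDerivAt (fun q => F (q, Y q p)) (u (q, Y q p) + v (q, Y q p) * (A (q, Y q p) / (-B (q, Y q p)))) q ∧
    HasDerivAt (fun p => F (q, Y q p)) (v (q, Y q p) * (1 / (-B (q, Y q p)))) p := by
  have d1 := (hF _ (hY.mem q p)).hasFDerivAt (h.int hY hp)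
  have d2 := h.fdY hY hp (q := q)
  constructor
  · have := d1.comp_hasDerivAt (f := fun q => (q, Y q p)) q ((hasDerivAt_id q).prodMk
      (d2.comp_hasDerivAt (f := fun q => (q, p)) q ((hasDerivAt_id q).prodMk (hasDerivAt_const q p))))
    exact this.congr_deriv (by simp [lin_app])
  · have := d1.comp_hasDerivAt (f := fun p => (q, Y q p)) p ((hasDerivAt_const p q).prodMk
      (d2.comp_hasDerivAt (f := fun p => (q, p)) p ((hasDerivAt_const p q).prodMk (hasDerivAt_id p))))
    exact this.congr_deriv (by simp [lin_app])

end

section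

open MeasureTheory Filter Topology

variable {p0 d δ : ℝ} {η : ℝ → ℝ} {ψ A B a b c : ℝ × ℝ → ℝ}

theorem dd_bound {N K μ : ℝ} (hμ : μ ∈ Ioo (0:ℝ) 1) (hη : ContDiff ℝ 2 η) (hN : ∀ x, |η x| ≤ N)
    (hK : ∀ x x' : ℝ, |deriv (deriv η) x - deriv (deriv η) x'| ≤ K * |x - x'| ^ μ) (x : ℝ) :
    |deriv (deriv η) x| ≤ 4 * N + 2 * |K| := by
  have d1 : Differentiable ℝ η := hη.differentiable (by norm_num)
  have d2 : Differentiable ℝ (deriv η) := by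
    have : ContDiff ℝ (1 + 1) η := by norm_num; exact hη
    exact (contDiff_succ_iff_deriv.mp this).2.2.differentiable (by norm_num)
  obtain ⟨s, hs, e1⟩ := exists_deriv_eq_slope η (show x + 1 < x + 2 by linarith) d1.continuous.continuousOn d1.differentiableOn
  obtain ⟨r, hr, e2⟩ := exists_deriv_eq_slope η (show x - 1 < x by linarith) d1.continuous.continuousOn d1.differentiableOn
  obtain ⟨t, ht, e3⟩ := exists_deriv_eq_slope (deriv η) (show r < s by linarith [hr.2, hs.1]) d2.continuous.continuousOn d2.differentiableOn
  have f1 : deriv η s = η (x + 2) - η (x + 1) := by rw [e1]; norm_num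
  have f2 : deriv η r = η x - η (x - 1) := by rw [e2]; norm_num
  have b1 : |deriv (deriv η) t| ≤ 4 * N := by
    rw [e3, f1, f2, abs_div, div_le_iff₀ (abs_pos.mpr (by linarith [hr.2, hs.1]))]
    have n1 := abs_le.mp (hN (x + 2)); have n2 := abs_le.mp (hN (x + 1)); have n3 := abs_le.mp (hN x); have n4 := abs_le.mp (hN (x - 1))
    have : 1 ≤ |s - r| := le_trans (by linarith [hr.2, hs.1]) (le_abs_self _)
    refine le_trans ?_ (le_mul_of_one_le_right (by linarith) this)
    rw [abs_le]; constructor <;> linarith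
  have b2 : |x - t| ^ μ ≤ 2 := by
    have : |x - t| ≤ 2 := by rw [abs_le]; constructor <;> linarith [ht.1, ht.2, hs.2, hr.1]
    refine (Real.rpow_le_rpow (abs_nonneg _) this hμ.1.le).trans ?_
    exact (Real.rpow_le_rpow_of_exponent_le (by norm_num) hμ.2.le).trans (by norm_num)
  have b3 := hK x t
  have b4 : K * |x - t| ^ μ ≤ |K| * 2 := mul_le_mul (le_abs_self _) b2 (by positivity) (abs_nonneg _)
  have := abs_sub_abs_le_abs_sub (deriv (deriv η) x) (deriv (deriv η) t)
  linarith

theorem Hod.curve (h : Hod p0 d δ η ψ A B a b c) {F u v : ℝ × ℝ → ℝ}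
    (hF : ∀ z ∈ Om d η, HasFDerivWithinAt F (lin (u z) (v z)) (Om d η) z) (x : ℝ) :
    HasDerivAt (fun x => F (x, η x)) (u (x, η x) + v (x, η x) * deriv η x) x := by
  have hm : ∀ x, (x, η x) ∈ Om d η := fun x => ⟨(h.hd x).le, le_rfl⟩
  have d1 := ((h.hη.differentiable (by norm_num)) x).hasDerivAt
  have := (hF _ (hm x)).comp_hasDerivWithinAt (s := univ) x ((hasDerivAt_id x).prodMk d1).hasDerivWithinAt (fun y _ => hm y)
  rw [hasDerivWithinAt_univ] at this
  exact this.congr_deriv (by simp [lin_app])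

theorem alg_bound {δ A B a b c t e f r M : ℝ} (h0 : A = -B * t) (h1 : a + 2 * b * t + c * t ^ 2 = -B * e)
    (h2 : A * (a + b * t) + B * (b + c * t) + t * r = 0) (h3 : a + c = f) (hδ : 0 < δ) (hB : B ≤ -δ)
    (mB : |B| ≤ M) (mt : |t| ≤ M) (me : |e| ≤ M) (mf : |f| ≤ M) (mr : |r| / δ ≤ M) :
    |b| ≤ 3 * M ^ 2 + 2 * M + 1 ∧ |c| ≤ 3 * M ^ 2 + 2 * M + 1 := by
  have M0 := (abs_nonneg _).trans mB
  have B0 : B ≠ 0 := by linarith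
  obtain ⟨k, hk⟩ : ∃ k, k = r / B := ⟨_, rfl⟩
  have mk : |k| ≤ M := by
    rw [hk, abs_div]
    refine le_trans (div_le_div_of_nonneg_left (abs_nonneg _) hδ ?_) mr
    rw [abs_of_neg (by linarith)]; linarith
  have h4 : -t * a + (1 - t ^ 2) * b + t * c = - k * t := by
    have : r = k * B := by rw [hk]; field_simp
    rw [this, h0] at h2
    have : B * (-t * a + (1 - t ^ 2) * b + t * c + k * t) = 0 := by linear_combination h2
    rcases mul_eq_zero.mp this with h | h
    · exact absurd h B0
    · linear_combination h
  obtain ⟨u, hu⟩ : ∃ u, u = -B * e - f := ⟨_, rfl⟩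
  obtain ⟨w, hw⟩ : ∃ w, w = -k * t + t * f := ⟨_, rfl⟩
  have e1 : u = 2 * t * b - (1 - t ^ 2) * c := by rw [hu]; linear_combination -h1 + h3
  have e2 : w = (1 - t ^ 2) * b + 2 * t * c := by rw [hw]; linear_combination -h4 - t * h3
  have e3 : u ^ 2 + w ^ 2 = (b ^ 2 + c ^ 2) * (1 + t ^ 2) ^ 2 := by rw [e1, e2]; ring
  have mul2 : ∀ {x y : ℝ}, |x| ≤ M → |y| ≤ M → |x * y| ≤ M ^ 2 := fun hx hy => by
    rw [abs_mul, sq]; exact mul_le_mul hx hy (abs_nonneg _) M0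
  have bu : |u| ≤ M ^ 2 + M := by
    rw [hu]; refine (abs_sub _ _).trans (add_le_add ?_ mf)
    rw [neg_mul, abs_neg]; exact mul2 mB me
  have bw : |w| ≤ 2 * M ^ 2 := by
    rw [hw]; refine (abs_add_le _ _).trans ?_
    have := mul2 mk mt; have := mul2 mt mf
    rw [neg_mul, abs_neg]; linarith
  have e4 : b ^ 2 + c ^ 2 ≤ (|u| + |w|) ^ 2 := by
    have : b ^ 2 + c ^ 2 ≤ u ^ 2 + w ^ 2 := by
      rw [e3]; refine le_mul_of_one_le_right (by positivity) ?_
      exact one_le_pow₀ (by linarith [sq_nonneg t])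
    have h5 := mul_nonneg (abs_nonneg u) (abs_nonneg w)
    rw [← sq_abs u, ← sq_abs w] at this
    linarith [add_sq |u| |w|]
  have n0 : 0 ≤ |u| + |w| := by positivity
  constructor
  · have := abs_le_of_sq_le_sq (show b ^ 2 ≤ (|u| + |w|) ^ 2 by linarith [sq_nonneg c]) n0
    linarith
  · have := abs_le_of_sq_le_sq (show c ^ 2 ≤ (|u| + |w|) ^ 2 by linarith [sq_nonneg b]) n0
    linarith

theorem Hod.N (h : Hod p0 d δ η ψ A B a b c) (x : ℝ) : η x + d ≤ -p0 / δ := by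
  have := h.slope (x := x) le_rfl (h.hd x).le le_rfl
  rw [h.top, h.bot] at this
  rw [le_div_iff₀ h.hδ]; linarith

theorem Hod.bounds (h : Hod p0 d δ η ψ A B a b c) {H E Q r f0 f1 : ℝ} (hr : 0 ≤ r)
    (hH : ∀ x y, (x, y) ∈ Om d η → |a (x, y) - a (x, η x)| ≤ H ∧ |b (x, y) - b (x, η x)| ≤ H ∧ |c (x, y) - c (x, η x)| ≤ H)
    (hE : ∀ x, |deriv (deriv η) x| ≤ E)
    (surf : ∀ x, A (x, η x) ^ 2 + B (x, η x) ^ 2 + 2 * (η x + d) * r = Q)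
    (pde : ∀ x, a (x, η x) + c (x, η x) = f1 * η x + f0) :
    ∃ M, 1 ≤ M ∧ ∀ z ∈ Om d η, |A z| ≤ M ∧ |B z| ≤ M ∧ |a z| ≤ M ∧ |b z| ≤ M ∧ |c z| ≤ M := by
  have hm : ∀ x, (x, η x) ∈ Om d η := fun x => ⟨(h.hd x).le, le_rfl⟩
  have hδ := h.hδ
  have hN0 : 0 < -p0 / δ := div_pos (by linarith [h.hp]) hδ
  have hN := h.N
  generalize -p0 / δ = N at *
  have sA : ∀ x, A (x, η x) ^ 2 ≤ Q ∧ B (x, η x) ^ 2 ≤ Q := fun x => by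
    have := surf x
    have h1 : 0 ≤ 2 * (η x + d) * r := mul_nonneg (by linarith [h.hd x]) hr
    constructor <;> linarith [sq_nonneg (A (x, η x)), sq_nonneg (B (x, η x))]
  have Q0 : 0 ≤ Q := (sq_nonneg _).trans (sA 0).1
  have sq1 : ∀ {y : ℝ}, y ^ 2 ≤ Q → |y| ≤ Q + 1 := fun {y} hy => by
    have : |y| ^ 2 ≤ Q := by rwa [sq_abs]
    nlinarith only [this, sq_nonneg (|y| - 1), abs_nonneg y]
  have t0 : ∀ x, A (x, η x) = -B (x, η x) * deriv η x := fun x => by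
    have h1 := h.curve h.dψ x
    simp only [h.top] at h1
    linarith [h1.unique (hasDerivAt_const x (0:ℝ))]
  have d2 : ∀ x, HasDerivAt (deriv η) (deriv (deriv η) x) x := fun x => by
    have : ContDiff ℝ (1 + 1) η := by norm_num; exact h.hη
    exact ((contDiff_succ_iff_deriv.mp this).2.2.differentiable (by norm_num) x).hasDerivAt
  have t1 : ∀ x, a (x, η x) + 2 * b (x, η x) * deriv η x + c (x, η x) * deriv η x ^ 2 = -B (x, η x) * deriv (deriv η) x := fun x => by
    have h1 := (h.curve h.dA x).add ((h.curve h.dB x).mul (d2 x))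
    have h2 : ((fun x => A (x, η x)) + (fun x => B (x, η x)) * deriv η) = fun _ => 0 := by
      funext x; simp only [Pi.add_apply, Pi.mul_apply, t0 x]; ring
    rw [h2] at h1
    linear_combination h1.unique (hasDerivAt_const x (0:ℝ))
  have t2 : ∀ x, A (x, η x) * (a (x, η x) + b (x, η x) * deriv η x) + B (x, η x) * (b (x, η x) + c (x, η x) * deriv η x) + deriv η x * r = 0 := fun x => by
    have h1 := (((h.curve h.dA x).pow 2).add ((h.curve h.dB x).pow 2)).add
      (((((h.hη.differentiable (by norm_num)) x).hasDerivAt.add_const d).const_mul 2).mul_const r)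
    have h2 := h1.congr_of_eventuallyEq (f₁ := fun _ => Q) (Eventually.of_forall fun x => by
      simp only [Pi.add_apply, Pi.pow_apply]; exact (surf x).symm)
    have := h2.unique (hasDerivAt_const x Q)
    simp only [Nat.cast_ofNat, Nat.add_one_sub_one, pow_one] at this
    linear_combination this / 2
  have tb : ∀ x, |deriv η x| ≤ (Q + 1) / δ := fun x => by
    rw [le_div_iff₀ hδ]
    have h1 := sq1 (sA x).1
    rw [t0 x, abs_mul, abs_neg] at h1
    have h2 : δ ≤ |B (x, η x)| := by
      have := h.neg _ (hm x); rw [abs_of_neg (by linarith)]; linarith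
    nlinarith only [h1, h2, abs_nonneg (deriv η x)]
  have tf : ∀ x, |f1 * η x + f0| ≤ |f1| * (N + |d|) + |f0| := fun x => by
    refine (abs_add_le _ _).trans (add_le_add ?_ le_rfl)
    rw [abs_mul]; refine mul_le_mul_of_nonneg_left ?_ (abs_nonneg _)
    have := abs_le.mp (le_refl |d|)
    rw [abs_le]; constructor <;> linarith [h.hd x, hN x]
  have E0 := (abs_nonneg _).trans (hE 0)
  have e2 : 0 ≤ (Q + 1) / δ := by positivity
  have e3 : 0 ≤ |f1| * (N + |d|) + |f0| := by positivity
  have e4 : 0 ≤ |r| / δ := by positivity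
  obtain ⟨M, hM⟩ : ∃ M, M = (Q + 1) + (Q + 1) / δ + E + (|f1| * (N + |d|) + |f0|) + |r| / δ := ⟨_, rfl⟩
  have bd : ∀ x, |b (x, η x)| ≤ 3 * M ^ 2 + 2 * M + 1 ∧ |c (x, η x)| ≤ 3 * M ^ 2 + 2 * M + 1 := fun x => by
    refine alg_bound (t0 x) (t1 x) (t2 x) (pde x) hδ (h.neg _ (hm x)) ?_ ?_ ?_ ?_ ?_
    · have := sq1 (sA x).2; linarith
    · have := tb x; linarith
    · have := hE x; linarith
    · have := tf x; linarith
    · linarith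
  have M0 : 0 ≤ M := by linarith
  obtain ⟨G, hG⟩ : ∃ G, G = 3 * M ^ 2 + 2 * M + 1 := ⟨_, rfl⟩
  rw [← hG] at bd
  have G0 : M ≤ G := by rw [hG]; linarith [sq_nonneg M]
  have ba : ∀ x, |a (x, η x)| ≤ G + M := fun x => by
    have e : a (x, η x) = (f1 * η x + f0) - c (x, η x) := by linarith [pde x]
    rw [e]; refine (abs_sub _ _).trans ?_
    have := tf x; have := (bd x).2; linarith
  have H0 : 0 ≤ H := (abs_nonneg _).trans (hH 0 _ (hm 0)).1
  have tri : ∀ {x y K L : ℝ}, |x - y| ≤ K → |y| ≤ L → |x| ≤ L + K := fun {x y K L} h1 h2 => by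
    have := abs_sub_abs_le_abs_sub x y; linarith
  have in2 : ∀ z ∈ Om d η, |a z| ≤ G + M + H ∧ |b z| ≤ G + H ∧ |c z| ≤ G + H := fun z hz => by
    obtain ⟨h1, h2, h3⟩ := hH z.1 z.2 hz
    exact ⟨tri h1 (ba _), tri h2 (bd _).1, tri h3 (bd _).2⟩
  have vert : ∀ {F u v : ℝ × ℝ → ℝ} {K : ℝ}, (∀ z ∈ Om d η, HasFDerivWithinAt F (lin (u z) (v z)) (Om d η) z) → 0 ≤ K →
      (∀ z ∈ Om d η, |v z| ≤ K) → ∀ z ∈ Om d η, |F z - F (z.1, η z.1)| ≤ K * N := by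
    rintro F u v K hF K0 hv ⟨x, y⟩ hz
    rcases hz.2.eq_or_lt with e | l
    · simp only at e; simp only [e, sub_self, abs_zero]; positivity
    obtain ⟨t, ht, e⟩ := ymv h.hη hF hz.1 l le_rfl
    rw [abs_sub_comm, e, abs_mul]
    refine mul_le_mul (hv _ ⟨hz.1.trans ht.1.le, ht.2.le⟩) ?_ (abs_nonneg _) K0
    have := hN x; have := hz.1; simp only at this l
    rw [abs_of_pos (by simpa using l)]; simp only; linarith
  have GH : 0 ≤ (G + H) * N := mul_nonneg (by linarith) hN0.le
  refine ⟨2 * G + H + M + (G + H) * N + 1, by linarith, fun z hz => ?_⟩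
  have b1 := vert h.dA (by linarith) (fun z hz => (in2 z hz).2.1) z hz
  have b2 := vert h.dB (by linarith) (fun z hz => (in2 z hz).2.2) z hz
  have c1 := tri b1 (sq1 (sA _).1)
  have c2 := tri b2 (sq1 (sA _).2)
  have QM : Q + 1 ≤ M := by linarith
  obtain ⟨h1, h2, h3⟩ := in2 z hz
  exact ⟨by linarith, by linarith, by linarith, by linarith, by linarith⟩

end

section

open MeasureTheory Filter Topology

variable {p0 d δ : ℝ} {η : ℝ → ℝ} {ψ A B a b c : ℝ × ℝ → ℝ} {Y : ℝ → ℝ → ℝ}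

def BD (F : ℝ → ℝ → ℝ) (u : ℝ) : Prop := Continuous (fun z : ℝ × ℝ => F z.1 z.2) ∧ ∀ q p, |F q p| ≤ u

theorem BD.mul {F G : ℝ → ℝ → ℝ} {u v : ℝ} (hF : BD F u) (hG : BD G v) : BD (F * G) (u * v) :=
  ⟨hF.1.mul hG.1, fun q p => by
    rw [Pi.mul_apply, Pi.mul_apply, abs_mul]
    exact mul_le_mul (hF.2 q p) (hG.2 q p) (abs_nonneg _) ((abs_nonneg _).trans (hF.2 q p))⟩
theorem BD.add {F G : ℝ → ℝ → ℝ} {u v : ℝ} (hF : BD F u) (hG : BD G v) : BD (F + G) (u + v) :=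
  ⟨hF.1.add hG.1, fun q p => (abs_add_le _ _).trans (add_le_add (hF.2 q p) (hG.2 q p))⟩
theorem BD.neg {F : ℝ → ℝ → ℝ} {u : ℝ} (hF : BD F u) : BD (-F) u :=
  ⟨hF.1.neg, fun q p => by rw [Pi.neg_apply, Pi.neg_apply, abs_neg]; exact hF.2 q p⟩
theorem BD.mono {F : ℝ → ℝ → ℝ} {u v : ℝ} (hF : BD F u) (h : u ≤ v) : BD F v := ⟨hF.1, fun q p => (hF.2 q p).trans h⟩
theorem BD.cb {F : ℝ → ℝ → ℝ} {u : ℝ} (hF : BD F u) : CB F := ⟨hF.1, u, hF.2⟩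

theorem HY.clamp (h : Hod p0 d δ η ψ A B a b c) (hY : HY p0 d η ψ Y) (q p : ℝ) : Y q p = Y q (clp p0 p) := by
  refine (h.uniq hY (z := (q, Y q p)) (hY.mem q p) (p := clp p0 p) ?_).symm
  rw [hY.eq, clp_eq (clp_mem h.hp.le _)]

theorem DD_lip {K : ℝ} {F Fq : ℝ → ℝ → ℝ} (hp : p0 < 0) (hF : CB F) (hq : QD p0 F Fq) (hb : ∀ q p, |Fq q p| ≤ K)
    (hc : ∀ q p, F q p = F q (clp p0 p)) : ∀ s > 0, ∀ q p, |DD s F q p| ≤ K := by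
  intro s hs q p
  have e : DD s F q p = DD s F q (clp p0 p) := by simp only [DD]; rw [hc (q + s) p, hc q p]
  rw [e]
  refine icc_of_ioo hp (hF.DD s) (fun q p hpp => ?_) q _ (clp_mem hp.le _)
  obtain ⟨ξ, -, e⟩ := hq.mv hpp q hs
  rw [← e]; exact hb _ _

theorem Hod.flow (h : Hod p0 d δ η ψ A B a b c) (hY : HY p0 d η ψ Y) {M Q R : ℝ} (hM : 1 ≤ M)
    (hb : ∀ z ∈ Om d η, |A z| ≤ M ∧ |B z| ≤ M ∧ |a z| ≤ M ∧ |b z| ≤ M ∧ |c z| ≤ M) {rh bb cc : ℝ → ℝ}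
    (pde : ∀ z ∈ Om d η, a z + c z = cc (-ψ z) * z.2 + bb (-ψ z))
    (surf : ∀ x, A (x, η x) ^ 2 + B (x, η x) ^ 2 + 2 * (η x + d) * rh 0 = Q)
    (rhc : Continuous rh) (ccc : Continuous cc) (bbc : Continuous bb) (rhd : ∀ p ∈ Ioo p0 0, HasDerivAt rh (cc p) p)
    (brh : ∀ p, |rh p| ≤ R) (bcc : ∀ p, |cc p| ≤ R) :
    ∃ K Uq W Wp, WFlow p0 d Q K δ Y Uq W Wp rh bb cc ∧ (W 0 = fun q p => A (q, Y q p)) ∧ (W 1 = fun q p => -B (q, Y q p)) := by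
  have hδ := h.hδ
  obtain ⟨m, hm⟩ : ∃ m, m = M + 1 / δ := ⟨_, rfl⟩
  have δi : 0 < 1 / δ := by positivity
  have bc : ∀ {F : ℝ × ℝ → ℝ}, ContinuousOn F (Om d η) → (∀ z ∈ Om d η, |F z| ≤ M) → BD (fun q p => F (q, Y q p)) m :=
    fun hF hb => ⟨h.compc hY hF, fun q p => (hb _ (hY.mem q p)).trans (by linarith)⟩
  have bU := bc (fun z hz => (h.dA z hz).continuousWithinAt) (fun z hz => (hb z hz).1)
  have bB := bc (fun z hz => (h.dB z hz).continuousWithinAt) (fun z hz => (hb z hz).2.1)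
  have ba := bc h.ca (fun z hz => (hb z hz).2.2.1)
  have b_b := bc h.cb (fun z hz => (hb z hz).2.2.2.1)
  have b_c := bc h.cc (fun z hz => (hb z hz).2.2.2.2)
  have qF := fun {q p : ℝ} (hp : p ∈ Ioo p0 0) => h.fdY hY hp (q := q)
  have dA := fun {q p : ℝ} (hp : p ∈ Ioo p0 0) => h.fdF hY hp (q := q) h.dA
  have dB := fun {q p : ℝ} (hp : p ∈ Ioo p0 0) => h.fdF hY hp (q := q) h.dB
  have hneg : ∀ q p, δ ≤ -B (q, Y q p) := fun q p => by linarith [h.neg _ (hY.mem q p)]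
  have hcl := HY.clamp h hY
  obtain ⟨U, hU⟩ : ∃ U : ℝ → ℝ → ℝ, U = fun q p => A (q, Y q p) := ⟨_, rfl⟩
  obtain ⟨V, hV⟩ : ∃ V : ℝ → ℝ → ℝ, V = fun q p => -B (q, Y q p) := ⟨_, rfl⟩
  obtain ⟨a1, ha1⟩ : ∃ a1 : ℝ → ℝ → ℝ, a1 = fun q p => a (q, Y q p) := ⟨_, rfl⟩
  obtain ⟨b1, hb1⟩ : ∃ b1 : ℝ → ℝ → ℝ, b1 = fun q p => b (q, Y q p) := ⟨_, rfl⟩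
  obtain ⟨c1, hc1⟩ : ∃ c1 : ℝ → ℝ → ℝ, c1 = fun q p => c (q, Y q p) := ⟨_, rfl⟩
  have hVp : ∀ q p, δ ≤ V q p := fun q p => by rw [hV]; exact hneg q p
  have hV0 : ∀ q p, V q p ≠ 0 := fun q p => by have := hVp q p; linarith
  obtain ⟨ga, hga⟩ : ∃ ga : ℝ → ℝ → ℝ, ga = fun q p => 1 / V q p := ⟨_, rfl⟩
  have gaV : ∀ q p, ga q p * V q p = 1 := fun q p => by rw [hga]; exact div_mul_cancel₀ _ (hV0 q p)
  have bV : BD V m := by rw [hV]; exact bB.neg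
  rw [← hU] at bU; rw [← ha1] at ba; rw [← hb1] at b_b; rw [← hc1] at b_c
  have bg : BD ga m := by
    rw [hga]
    refine ⟨continuous_const.div bV.1 fun z => hV0 _ _, fun q p => ?_⟩
    rw [abs_of_pos (div_pos one_pos (lt_of_lt_of_le hδ (hVp q p)))]
    have := one_div_le_one_div_of_le hδ (hVp q p); linarith
  -- derivatives in the new variables
  have Yq : ∀ q, ∀ p ∈ Ioo p0 0, HasDerivAt (fun q => Y q p) (U q p * ga q p) q := fun q p hp => by
    have := (qF hp (q := q)).comp_hasDerivAt (f := fun q => (q, p)) q ((hasDerivAt_id q).prodMk (hasDerivAt_const q p))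
    exact this.congr_deriv (by simp [lin_app, hga, hU, hV]; ring)
  have Yp : ∀ q, ∀ p ∈ Ioo p0 0, HasDerivAt (Y q) (ga q p) p := fun q p hp => by
    have := (qF hp (q := q)).comp_hasDerivAt (f := fun p => (q, p)) p ((hasDerivAt_const p q).prodMk (hasDerivAt_id p))
    exact this.congr_deriv (by simp [lin_app, hga, hV])
  have Uq : ∀ q, ∀ p ∈ Ioo p0 0, HasDerivAt (fun q => U q p) (a1 q p + b1 q p * (U q p * ga q p)) q := fun q p hp => by
    rw [hU]; exact (dA hp (q := q)).1.congr_deriv (by simp only [hga, ha1, hb1, hV]; ring)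
  have Up : ∀ q, ∀ p ∈ Ioo p0 0, HasDerivAt (U q) (b1 q p * ga q p) p := fun q p hp => by
    rw [hU]; exact (dA hp (q := q)).2.congr_deriv (by simp only [hga, hb1, hV])
  have Vq : ∀ q, ∀ p ∈ Ioo p0 0, HasDerivAt (fun q => V q p) (-(b1 q p + c1 q p * (U q p * ga q p))) q := fun q p hp => by
    rw [hV]; exact (dB hp (q := q)).1.neg.congr_deriv (by simp only [hga, hb1, hc1, hU, hV]; ring)
  have Vp : ∀ q, ∀ p ∈ Ioo p0 0, HasDerivAt (V q) (-(c1 q p * ga q p)) p := fun q p hp => by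
    rw [hV]; exact (dB hp (q := q)).2.neg.congr_deriv (by simp only [hga, hc1, hV])
  have pd : ∀ q, ∀ p ∈ Ioo p0 0, a1 q p + c1 q p = cc p * Y q p + bb p := fun q p hp => by
    have := pde _ (hY.mem q p)
    rw [hY.eq, neg_neg, clp_eq (Ioo_subset_Icc_self hp)] at this
    rw [ha1, hc1]; exact this
  have tp : ∀ q, Y q 0 = η q ∧ Y q p0 = -d := fun q => by
    constructor
    · exact h.uniq hY (z := (q, η q)) (hY.mem q 0 |> fun _ => ⟨(h.hd q).le, le_rfl⟩) (by rw [h.top, clp_eq ⟨h.hp.le, le_rfl⟩, neg_zero])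
    · exact h.uniq hY (z := (q, -d)) ⟨le_rfl, (h.hd q).le⟩ (by rw [h.bot, clp_eq ⟨le_rfl, h.hp.le⟩])
  have clU : ∀ q p, U q p = U q (clp p0 p) := fun q p => by rw [hU]; simp only; rw [← hcl q p]
  have clV : ∀ q p, V q p = V q (clp p0 p) := fun q p => by rw [hV]; simp only; rw [← hcl q p]
  have clg : ∀ q p, ga q p = ga q (clp p0 p) := fun q p => by rw [hga]; simp only; rw [← clV q p]
  have tpV : ∀ q, U q 0 ^ 2 + V q 0 ^ 2 + 2 * (Y q 0 + d) * rh 0 = Q := fun q => by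
    rw [hU, hV]; simp only [(tp q).1]; rw [neg_sq]; exact surf q
  have cY : CB Y := ⟨h.cY hY, -p0 / δ + |d|, fun q p => by
    have h1 := hY.mem q p
    have := h.N q
    have hN0 : 0 < -p0 / δ := div_pos (by linarith [h.hp]) hδ
    rw [abs_le]; constructor <;> linarith [h1.1, h1.2, le_abs_self d, neg_abs_le d]⟩
  refine ⟨4 * m ^ 6 + R, a1 + b1 * (U * ga), ![U, V, U * ga, ga],
    ![b1 * ga, -(c1 * ga), ga * ga * (b1 + c1 * (U * ga)), c1 * ga * (ga * ga)], ?_, hU, hV⟩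
  have hp := h.hp
  have m1 : 1 ≤ m := by linarith
  clear hU hV hga ha1 hb1 hc1 qF dA dB hneg hb pde surf bB bc h hM hm hY hcl
  have R0 : 0 ≤ R := (abs_nonneg _).trans (brh 0)
  have bal := bU.mul bg
  have bUq := ba.add (b_b.mul bal)
  have bVq := b_b.add (b_c.mul bal)
  have bgq := (bg.mul bg).mul bVq
  have k : ∀ i ≤ 6, m ^ i ≤ m ^ 6 := fun i hi => pow_le_pow_right₀ m1 hi
  have k1 := k 1 (by norm_num); have k2 := k 2 (by norm_num); have k3 := k 3 (by norm_num); have k4 := k 4 (by norm_num); have k5 := k 5 (by norm_num)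
  have k0 : 0 < m ^ 6 := by positivity
  rw [pow_one] at k1
  have galq : ∀ q, ∀ p ∈ Ioo p0 0, HasDerivAt (fun q => ga q p) ((ga * ga * (b1 + c1 * (U * ga))) q p) q := fun q p hp => by
    have e : (fun q => ga q p) = fun q => (V q p)⁻¹ := by funext q; exact eq_inv_of_mul_eq_one_left (gaV q p)
    rw [e]
    refine ((Vq q p hp).inv (hV0 q p)).congr_deriv ?_
    rw [show ga = fun q p => (V q p)⁻¹ from by funext q p; exact eq_inv_of_mul_eq_one_left (gaV q p)]
    simp only [Pi.mul_apply, Pi.add_apply]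
    have := hV0 q p
    field_simp
  have galp : ∀ q, ∀ p ∈ Ioo p0 0, HasDerivAt (ga q) ((c1 * ga * (ga * ga)) q p) p := fun q p hp => by
    have e : ga q = fun p => (V q p)⁻¹ := by funext p; exact eq_inv_of_mul_eq_one_left (gaV q p)
    rw [e]
    refine ((Vp q p hp).inv (hV0 q p)).congr_deriv ?_
    rw [show ga = fun q p => (V q p)⁻¹ from by funext q p; exact eq_inv_of_mul_eq_one_left (gaV q p)]
    simp only [Pi.mul_apply]
    have := hV0 q p
    field_simp
  have alp : ∀ q, ∀ p ∈ Ioo p0 0, HasDerivAt ((U * ga) q) ((ga * ga * (b1 + c1 * (U * ga))) q p) p := fun q p hp =>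
    ((Up q p hp).mul (galp q p hp)).congr_deriv (by simp only [Pi.mul_apply, Pi.add_apply]; ring)
  have bp0 := b_b.mul bg
  have bp1 := (b_c.mul bg).neg
  have bp3 := (b_c.mul bg).mul (bg.mul bg)
  have eqn : ∀ {x : ℝ}, x ≤ 4 * m ^ 6 → x ≤ 4 * m ^ 6 + R := fun h => by linarith
  have l1 : m ≤ 4 * m ^ 6 := by linarith
  have l2 : m * m ≤ 4 * m ^ 6 := by linarith only [k2, k0]
  have l3 : m + m * (m * m) ≤ 4 * m ^ 6 := by linarith only [k1, k3, k0]
  have l4 : m * m * (m + m * (m * m)) ≤ 4 * m ^ 6 := by linarith only [k5, k3, k0]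
  have l5 : m * m * (m * m) ≤ 4 * m ^ 6 := by linarith only [k4, k0]
  have bl := (bUq.mul bg).add (bU.mul bgq)
  have l6 : (m + m * (m * m)) * m + m * (m * m * (m + m * (m * m))) ≤ 4 * m ^ 6 := by linarith only [k2, k4, k0]
  exact {
    hp := hp, hδ := hδ
    hK := by linarith
    pY := ⟨cY, bg.cb, Yp⟩
    pW := fun i => by
      fin_cases i
      · exact ⟨bU.cb, bp0.cb, Up⟩
      · exact ⟨bV.cb, bp1.cb, Vp⟩
      · exact ⟨bal.cb, bgq.cb, alp⟩
      · exact ⟨bg.cb, bp3.cb, galp⟩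
    cUq := bUq.cb
    qY := fun p hp q => Yq q p hp
    qU := fun p hp q => Uq q p hp
    qga := fun p hp q => galq q p hp
    gaV := by funext q p; exact gaV q p
    alV := by
      funext q p
      show U q p * ga q p * V q p = U q p
      rw [mul_assoc, gaV, mul_one]
    Vpos := hVp
    eq2 := fun q p hp => by
      show U q p * (b1 q p * ga q p) + V q p * -(c1 q p * ga q p) = a1 q p + b1 q p * (U q p * ga q p) - _
      rw [← pd q p hp]
      linear_combination (-c1 q p) * gaV q p
    rhc := rhc, ccc := ccc, bbc := bbc, rhd := rhd
    top := tpV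
    bot := fun q => (tp q).2
    bW := fun i q p => by
      fin_cases i
      · exact (bU.2 q p).trans (eqn l1)
      · exact (bV.2 q p).trans (eqn l1)
      · exact (bal.2 q p).trans (eqn l2)
      · exact (bg.2 q p).trans (eqn l1)
    bWp := fun i q p => by
      fin_cases i
      · exact (bp0.2 q p).trans (eqn l2)
      · exact (bp1.2 q p).trans (eqn l2)
      · exact (bgq.2 q p).trans (eqn l4)
      · exact (bp3.2 q p).trans (eqn l5)
    bUq := fun q p => (bUq.2 q p).trans (eqn l3)
    brh := fun p => (brh p).trans (by linarith)
    bcc := fun p => (bcc p).trans (by linarith)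
    lip := fun i => by
      fin_cases i
      · exact DD_lip hp bU.cb (fun p hp q => Uq q p hp) (fun q p => (bUq.2 q p).trans (eqn l3)) clU
      · exact DD_lip hp bV.cb (fun p hp q => Vq q p hp) (fun q p => (bVq.neg.2 q p).trans (eqn l3)) clV
      · exact DD_lip hp bal.cb (fun p hp q => (Uq q p hp).mul (galq q p hp)) (fun q p => (bl.2 q p).trans (eqn l6))
          (fun q p => by show U q p * ga q p = U q _ * ga q _; rw [← clU, ← clg])
      · exact DD_lip hp bg.cb (fun p hp q => galq q p hp) (fun q p => (bgq.2 q p).trans (eqn l4)) clg }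

end

section

open MeasureTheory Filter Topology

theorem hold_cont {f : ℝ → ℝ} {S : Set ℝ} {μ K : ℝ} (hμ : 0 < μ) (h : ∀ p ∈ S, ∀ p' ∈ S, |f p - f p'| ≤ K * |p - p'| ^ μ) :
    ContinuousOn f S := by
  intro x hx
  have t : Tendsto (fun p => K * |p - x| ^ μ) (𝓝[S] x) (𝓝 0) := by
    have : Continuous (fun p => K * |p - x| ^ μ) :=
      continuous_const.mul ((continuous_id.sub continuous_const).abs.rpow_const fun _ => Or.inr hμ.le)
    have := (this.tendsto x).mono_left (nhdsWithin_le_nhds (s := S))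
    simpa [Real.zero_rpow hμ.ne'] using this
  have : Tendsto (fun p => f p - f x) (𝓝[S] x) (𝓝 0) := by
    refine squeeze_zero_norm' ?_ t
    filter_upwards [self_mem_nhdsWithin] with p hp using h p hp x hx
  have := this.add_const (f x)
  simpa [ContinuousWithinAt] using this

theorem clp_comp {p0 : ℝ} (hp : p0 < 0) {f : ℝ → ℝ} (h : ContinuousOn f (Icc p0 0)) : Continuous (fun p => f (clp p0 p)) := by
  rw [← continuousOn_univ]
  exact h.comp (clp_cont p0).continuousOn fun p _ => clp_mem hp.le p

theorem itd {f : ℝ → ℝ} {p0 : ℝ} (hp : p0 < 0) (h : ContDiffOn ℝ (⊤ : ℕ∞) f (Icc p0 0)) (k : ℕ) :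
    ∀ p ∈ Icc p0 0, HasDerivWithinAt (iteratedDerivWithin k f (Icc p0 0)) (iteratedDerivWithin (k + 1) f (Icc p0 0) p) (Icc p0 0) p := by
  intro p hpp
  have := (h.differentiableOn_iteratedDerivWithin (m := k) (by exact_mod_cast WithTop.coe_lt_top _) (uniqueDiffOn_Icc hp) p hpp).hasDerivWithinAt
  rwa [iteratedDerivWithin_succ]

theorem gb {s M C x : ℝ} (hs : 1 ≤ s) (hM : 1 ≤ M) (hC : 0 ≤ C) (k : ℕ) (h : |x| ≤ C * M ^ k * (((2:ℝ) ^ s) ^ k * (k.factorial : ℝ) ^ s)) :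
    |x| ≤ (4 * M * 2 ^ s) ^ k * (C * eG s k) := by
  refine h.trans ?_
  have h1 : ((k:ℝ) + 1) ^ 2 ≤ 4 ^ k := by
    have : ((k:ℝ) + 1) ≤ 2 ^ k := by exact_mod_cast Nat.lt_two_pow_self (n := k)
    calc ((k:ℝ) + 1) ^ 2 ≤ (2 ^ k) ^ 2 := by gcongr
      _ = 4 ^ k := by rw [← pow_mul, mul_comm, pow_mul]; norm_num
  unfold eG
  have h2 : (1:ℝ) ≤ 4 ^ k / ((k:ℝ) + 1) ^ 2 := by rw [le_div_iff₀ (by positivity)]; linarith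
  have e : (4 * M * 2 ^ s) ^ k * (C * ((k.factorial : ℝ) ^ s / ((k:ℝ) + 1) ^ 2)) =
     C * M ^ k * (((2:ℝ) ^ s) ^ k * (k.factorial : ℝ) ^ s) * (4 ^ k / ((k:ℝ) + 1) ^ 2) := by
    rw [mul_pow, mul_pow]; ring
  rw [e]
  exact le_mul_of_one_le_right (by positivity) h2

theorem fact_succ_rpow {s : ℝ} (hs : 1 ≤ s) (k : ℕ) : ((k + 1).factorial : ℝ) ^ s ≤ ((2:ℝ) ^ s) ^ k * (k.factorial : ℝ) ^ s := by
  rw [Nat.factorial_succ]; push_cast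
  rw [Real.mul_rpow (by positivity) (by positivity)]
  refine mul_le_mul_of_nonneg_right ?_ (by positivity)
  rw [← Real.rpow_natCast, ← Real.rpow_mul (by norm_num), mul_comm, Real.rpow_mul (by norm_num), Real.rpow_natCast]
  have : ((k:ℝ) + 1) ≤ 2 ^ k := by exact_mod_cast Nat.lt_two_pow_self (n := k)
  exact Real.rpow_le_rpow (by positivity) this (by linarith)

end

/-- Theorem 5.1-type result for pure-gravity stratified water waves (no surface tension):
with `β ∈ C^{0,μ}` and `ρ ∈ C^{1,μ}` on `[p₀,0]` and no stagnation points, every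
streamline — each level set `{ψ = c}`, `c ∈ [0,−p₀]`, in `Ω̄`, including the free surface —
is the graph of a real-analytic function; if moreover `β, ρ ∈ G^s([p₀,0])` for some
`s ≥ 1`, then `ψ` is smooth on `Ω̄` and belongs to `G^s(Ω̄)`, and is real analytic on `Ω̄`
when `s = 1`. -/
theorem gravity_stratified_regularity
    (p₀ d g Q μ δ : ℝ)
    (hp₀ : p₀ < 0) (hd : 0 < d) (hg : 0 < g)
    (hμ : μ ∈ Set.Ioo (0 : ℝ) 1) (hδ : 0 < δ)
    (η : ℝ → ℝ) (ψ : ℝ × ℝ → ℝ) (β ρ : ℝ → ℝ)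
    (hηd : ∀ x, -d < η x)
    (Ωo Ωc : Set (ℝ × ℝ))
    (hΩo : Ωo = {z : ℝ × ℝ | -d < z.2 ∧ z.2 < η z.1})
    (hΩc : Ωc = {z : ℝ × ℝ | -d ≤ z.2 ∧ z.2 ≤ η z.1})
    -- η ∈ C^{2,μ}
    (hη : ContDiff ℝ 2 η)
    (hη2 : ∃ K, ∀ x x' : ℝ, |deriv (deriv η) x - deriv (deriv η) x'| ≤ K * |x - x'| ^ μ)
    -- ψ ∈ C²(Ω̄) with μ-Hölder continuous second derivatives
    (hψ : ContDiffOn ℝ 2 ψ Ωc)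
    (hψ2 : ∀ a b : ℕ, a + b = 2 → ∃ K, ∀ z ∈ Ωc, ∀ z' ∈ Ωc,
      |mpw Ωc a b ψ z - mpw Ωc a b ψ z'| ≤ K * (edist2 z z') ^ μ)
    -- β ∈ C^{0,μ}([p₀,0])
    (hβ : ∃ K, ∀ p ∈ Set.Icc p₀ 0, ∀ p' ∈ Set.Icc p₀ 0, |β p - β p'| ≤ K * |p - p'| ^ μ)
    -- ρ ∈ C^{1,μ}([p₀,0]), ρ > 0
    (hρpos : ∀ p ∈ Set.Icc p₀ 0, 0 < ρ p)
    (hρ : ∀ p ∈ Set.Icc p₀ 0, DifferentiableAt ℝ ρ p)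
    (hρ' : ∃ K, ∀ p ∈ Set.Icc p₀ 0, ∀ p' ∈ Set.Icc p₀ 0,
      |deriv ρ p - deriv ρ p'| ≤ K * |p - p'| ^ μ)
    -- Yih's equation Δψ − g y ρ'(−ψ) = −β(−ψ) in Ω
    (hpde : ∀ z ∈ Ωo,
      mpw Ωc 2 0 ψ z + mpw Ωc 0 2 ψ z - g * z.2 * deriv ρ (-ψ z) = -β (-ψ z))
    -- Bernoulli condition (no surface tension) on the free surface
    (hsurf : ∀ x : ℝ,
      (mpw Ωc 1 0 ψ (x, η x)) ^ 2 + (mpw Ωc 0 1 ψ (x, η x)) ^ 2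
        + 2 * g * (η x + d) * ρ (-ψ (x, η x)) = Q)
    -- kinematic boundary conditions
    (htop : ∀ x : ℝ, ψ (x, η x) = 0)
    (hbot : ∀ x : ℝ, ψ (x, -d) = -p₀)
    -- no stagnation: ψ_y ≤ −δ on Ω̄
    (hstag : ∀ z ∈ Ωc, mpw Ωc 0 1 ψ z ≤ -δ) :
    ((∀ c ∈ Set.Icc 0 (-p₀), ∃ f : ℝ → ℝ, AnalyticOnNhd ℝ f Set.univ ∧
        {z ∈ Ωc | ψ z = c} = {z : ℝ × ℝ | ∃ x : ℝ, z = (x, f x)}) ∧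
      AnalyticOnNhd ℝ η Set.univ) ∧
    (∀ s : ℝ, 1 ≤ s → GevreyOnIcc s p₀ β → GevreyOnIcc s p₀ ρ →
      GevreyOn2 s Ωc ψ ∧ (s = 1 → AnalyticOn ℝ ψ Ωc)) := by
  obtain ⟨Kη, hKη⟩ := hη2
  obtain ⟨Kβ, hKβ⟩ := hβ
  obtain ⟨Kρ, hKρ⟩ := hρ'
  obtain ⟨Ka, hKa⟩ := hψ2 2 0 rfl
  obtain ⟨Kb, hKb⟩ := hψ2 1 1 rfl
  obtain ⟨Kc, hKc⟩ := hψ2 0 2 rfl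
  have hΩ : Ωc = Om d η := hΩc
  clear hΩc hψ2
  subst hΩ
  obtain ⟨f1, f2, f3, f4⟩ := mpw_facts hη hηd hψ
  have H : Hod p₀ d δ η ψ (mpw (Om d η) 1 0 ψ) (mpw (Om d η) 0 1 ψ) (mpw (Om d η) 2 0 ψ) (mpw (Om d η) 1 1 ψ)
      (mpw (Om d η) 0 2 ψ) := ⟨hp₀, hδ, hηd, hη, htop, hbot, hstag, f1, f2, f3, f4 2 0 rfl, f4 1 1 rfl, f4 0 2 rfl⟩
  obtain ⟨A, hA⟩ : ∃ A, A = mpw (Om d η) 1 0 ψ := ⟨_, rfl⟩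
  obtain ⟨B, hB⟩ : ∃ B, B = mpw (Om d η) 0 1 ψ := ⟨_, rfl⟩
  obtain ⟨a, ha⟩ : ∃ a, a = mpw (Om d η) 2 0 ψ := ⟨_, rfl⟩
  obtain ⟨b, hb⟩ : ∃ b, b = mpw (Om d η) 1 1 ψ := ⟨_, rfl⟩
  obtain ⟨c, hc⟩ : ∃ c, c = mpw (Om d η) 0 2 ψ := ⟨_, rfl⟩
  rw [← hA, ← hB, ← ha, ← hb, ← hc] at H
  rw [← ha] at hKa; rw [← hb] at hKb; rw [← hc] at hKc
  simp only [← hA, ← hB, ← ha, ← hc] at hsurf hpde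
  clear f1 f2 f3 f4 hA hB ha hb hc hψ hstag
  have cβ := hold_cont hμ.1 hKβ
  have cρ' := hold_cont hμ.1 hKρ
  have cρ : ContinuousOn ρ (Icc p₀ 0) := fun p hp => (hρ p hp).continuousAt.continuousWithinAt
  have hmem : ∀ z ∈ Om d η, -ψ z ∈ Icc p₀ 0 := fun z hz => H.mem hz
  have cψ := H.cψ
  have pde : ∀ z ∈ Om d η, a z + c z = g * deriv ρ (-ψ z) * z.2 + -β (-ψ z) := by
    refine Set.EqOn.of_subset_closure (s := Ωo) ?_ (H.ca.add H.cc) ?_ ?_ ?_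
    · intro z hz
      have := hpde z hz
      show a z + c z = _
      linear_combination this
    · have k1 : ContinuousOn (fun z => deriv ρ (-ψ z)) (Om d η) := cρ'.comp cψ.neg hmem
      have k2 : ContinuousOn (fun z => β (-ψ z)) (Om d η) := cβ.comp cψ.neg hmem
      exact ((continuousOn_const.mul k1).mul continuousOn_snd).add k2.neg
    · rw [hΩo]; exact fun z hz => ⟨hz.1.le, hz.2.le⟩
    · rw [hΩo]; exact Om_cl hηd
  have c0 : clp p₀ 0 = 0 := clp_eq ⟨hp₀.le, le_rfl⟩
  have m0 : (0:ℝ) ∈ Icc p₀ 0 := ⟨hp₀.le, le_rfl⟩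
  have sf : ∀ x, A (x, η x) ^ 2 + B (x, η x) ^ 2 + 2 * (η x + d) * (g * ρ (clp p₀ 0)) = Q := fun x => by
    have := hsurf x
    rw [htop, neg_zero] at this
    rw [c0]; linear_combination this
  have hN := H.N
  have N0 : 0 < -p₀ / δ := div_pos (by linarith) hδ
  obtain ⟨N, hNe⟩ : ∃ N, N = -p₀ / δ := ⟨_, rfl⟩
  rw [← hNe] at hN N0
  have hE := dd_bound hμ hη (N := N + d) (fun x => by rw [abs_le]; constructor <;> linarith [hN x, hηd x]) hKη
  have hol : ∀ x y, (x, y) ∈ Om d η → edist2 (x, y) (x, η x) ^ μ ≤ 1 + N := fun x y hz => by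
    have e : edist2 (x, y) (x, η x) = |y - η x| := by
      unfold edist2; simp only [sub_self]; rw [← Real.sqrt_sq_eq_abs]; congr 1; ring
    have h1 := hz.1; have h2 := hz.2; simp only at h1 h2
    have : |y - η x| ≤ 1 + N := by rw [abs_le]; constructor <;> linarith [hN x]
    rw [e]
    refine (Real.rpow_le_rpow (abs_nonneg _) this hμ.1.le).trans ?_
    exact (Real.rpow_le_rpow_of_exponent_le (by linarith) hμ.2.le).trans (by rw [Real.rpow_one])
  have hol2 : ∀ {K : ℝ} {F : ℝ × ℝ → ℝ}, |K| ≤ |Ka| + |Kb| + |Kc| → (∀ z ∈ Om d η, ∀ z' ∈ Om d η, |F z - F z'| ≤ K * edist2 z z' ^ μ) →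
      ∀ x y, (x, y) ∈ Om d η → |F (x, y) - F (x, η x)| ≤ (|Ka| + |Kb| + |Kc|) * (1 + N) := fun {K F} hK hF x y hz => by
    refine (hF _ hz (x, η x) ⟨(hηd x).le, le_rfl⟩).trans ?_
    refine mul_le_mul ((le_abs_self _).trans hK) (hol x y hz) ?_ (by positivity)
    exact Real.rpow_nonneg (Real.sqrt_nonneg _) _
  obtain ⟨M, hM, hMb⟩ := H.bounds (mul_nonneg hg.le (hρpos _ (clp_mem hp₀.le 0)).le)
    (fun x y hz => ⟨hol2 (by linarith [abs_nonneg Kb, abs_nonneg Kc]) hKa x y hz,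
      hol2 (by linarith [abs_nonneg Ka, abs_nonneg Kc]) hKb x y hz, hol2 (by linarith [abs_nonneg Ka, abs_nonneg Kb]) hKc x y hz⟩)
    hE sf (f1 := g * deriv ρ 0) (f0 := -β 0) (fun x => by
      have := pde (x, η x) ⟨(hηd x).le, le_rfl⟩
      rwa [htop, neg_zero] at this)
  obtain ⟨Y, hY⟩ := H.exY
  obtain ⟨R1, hR1⟩ := isCompact_Icc.exists_bound_of_continuousOn cρ
  obtain ⟨R2, hR2⟩ := isCompact_Icc.exists_bound_of_continuousOn cρ'
  have r1 : ∀ p, |g * ρ (clp p₀ p)| ≤ g * R1 + g * R2 := fun p => by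
    have h1 := hR1 _ (clp_mem hp₀.le p); have h2 := (norm_nonneg _).trans (hR2 _ (clp_mem hp₀.le p))
    rw [Real.norm_eq_abs] at h1
    rw [abs_mul, abs_of_pos hg]; nlinarith only [h1, h2, hg]
  have r2 : ∀ p, |g * deriv ρ (clp p₀ p)| ≤ g * R1 + g * R2 := fun p => by
    have h1 := hR2 _ (clp_mem hp₀.le p); have h2 := (norm_nonneg _).trans (hR1 _ (clp_mem hp₀.le p))
    rw [Real.norm_eq_abs] at h1
    rw [abs_mul, abs_of_pos hg]; nlinarith only [h1, h2, hg]
  obtain ⟨K, Uq, W, Wp, hW, hW0, hW1⟩ := H.flow hY hM hMb (rh := fun p => g * ρ (clp p₀ p)) (cc := fun p => g * deriv ρ (clp p₀ p))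
    (bb := fun p => -β (clp p₀ p)) (fun z hz => by rw [clp_eq (hmem z hz)]; exact pde z hz) sf
    (continuous_const.mul (clp_comp hp₀ cρ)) (continuous_const.mul (clp_comp hp₀ cρ')) (clp_comp hp₀ cβ).neg
    (fun p hp => by
      have h1 := ((hρ p (Ioo_subset_Icc_self hp)).hasDerivAt).const_mul g
      simp only [clp_eq (Ioo_subset_Icc_self hp)]
      refine h1.congr_of_eventuallyEq ?_
      filter_upwards [isOpen_Ioo.mem_nhds hp] with r hr
      rw [clp_eq (Ioo_subset_Icc_self hr)]) r1 r2
  refine ⟨⟨fun c hc => ?_, ?_⟩, fun s hs gβ gρ => ?_⟩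
  · have hcm : -c ∈ Icc p₀ 0 := ⟨by linarith [hc.2], by linarith [hc.1]⟩
    refine ⟨fun q => Y q (-c), hW.anal hcm, ?_⟩
    ext z
    constructor
    · rintro ⟨h1, h2⟩
      exact ⟨z.1, Prod.ext rfl (H.uniq hY h1 (by rw [clp_eq hcm, neg_neg, h2])).symm⟩
    · rintro ⟨x, rfl⟩
      exact ⟨hY.mem _ _, by rw [hY.eq, clp_eq hcm, neg_neg]⟩
  · have e : η = fun q => Y q 0 := by
      funext q
      exact (H.uniq hY (z := (q, η q)) ⟨(hηd q).le, le_rfl⟩ (by rw [htop, c0, neg_zero])).symm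
    rw [e]; exact hW.anal m0
  · obtain ⟨sβ, M1, hM1, bβ⟩ := gβ
    obtain ⟨sρ, M2, hM2, bρ⟩ := gρ
    obtain ⟨L, hL⟩ : ∃ L, L = M1 + M2 := ⟨_, rfl⟩
    have L1 : 1 ≤ L := by linarith
    have L2 : 0 ≤ (1 + g) * L ^ 2 := by positivity
    obtain ⟨k, R, S, hk, hR, hS, hG⟩ := hW.gev hs (c0 := (1 + g) * L ^ 2) (S0 := 4 * L * 2 ^ s)
      (fun k p => -iteratedDerivWithin k β (Icc p₀ 0) p) (fun k p => g * iteratedDerivWithin (k + 1) ρ (Icc p₀ 0) p)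
      (fun p hp => by simp only [iteratedDerivWithin_zero, clp_eq hp])
      (fun p hp => by
        simp only [zero_add, iteratedDerivWithin_one, clp_eq hp]
        rw [(hρ p hp).derivWithin (uniqueDiffOn_Icc hp₀ p hp)])
      (fun k p hp => (itd hp₀ sβ k p hp).neg) (fun k p hp => (itd hp₀ sρ (k + 1) p hp).const_mul g) (by positivity)
      (fun k p hp => gb hs L1 L2 k (by
        rw [abs_neg]
        refine (bβ k p hp).trans ?_
        have h1 : M1 ^ (k + 1) ≤ L ^ (k + 1) := pow_le_pow_left₀ (by linarith) (by linarith) _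
        have h2 : (1:ℝ) ≤ ((2:ℝ) ^ s) ^ k := one_le_pow₀ (Real.one_le_rpow (by norm_num) (by linarith))
        have h3 : 0 ≤ (k.factorial : ℝ) ^ s := by positivity
        have h4 : L ^ (k + 1) ≤ (1 + g) * L ^ 2 * L ^ k := by
          have : (1 + g) * L ^ 2 * L ^ k = L ^ (k + 1) * ((1 + g) * L) := by ring
          rw [this]; exact le_mul_of_one_le_right (by positivity) (by nlinarith)
        exact mul_le_mul (h1.trans h4) (le_mul_of_one_le_left h3 h2) h3 (by positivity)))
      (fun k p hp => gb hs L1 L2 k (by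
        rw [abs_mul, abs_of_pos hg]
        have h1 : M2 ^ (k + 1 + 1) ≤ L ^ (k + 1 + 1) := pow_le_pow_left₀ (by linarith) (by linarith) _
        have h2 := mul_le_mul h1 (fact_succ_rpow hs k) (by positivity) (by positivity)
        have h3 := mul_le_mul_of_nonneg_left ((bρ (k + 1) p hp).trans h2) hg.le
        refine h3.trans ?_
        have h4 : 0 ≤ L ^ (k + 1 + 1) * (((2:ℝ) ^ s) ^ k * (k.factorial : ℝ) ^ s) := by positivity
        have e : (1 + g) * L ^ 2 * L ^ k * (((2:ℝ) ^ s) ^ k * (k.factorial : ℝ) ^ s) =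
          (1 + g) * (L ^ (k + 1 + 1) * (((2:ℝ) ^ s) ^ k * (k.factorial : ℝ) ^ s)) := by ring
        rw [e, add_mul, one_mul]; linarith))
    refine phys hs hp₀ hR hS hk hG (Om_ud hη hηd) hmem (fun z hz => ?_) (Om_star hη hηd)
    have e : Y z.1 (clp p₀ (-ψ z)) = z.2 := H.uniq hY hz (by rw [clp_eq (clp_mem hp₀.le _), clp_eq (hmem z hz), neg_neg])
    refine (H.dψ z hz).congr_fderiv ?_
    simp only [cl, hW0, hW1, e, lin, Prod.mk.eta]
    ext <;> simp
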